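/- arXiv:1611.09096 — 4 statements merged into one kernel-verified Lean document; each statement's English description precedes it below -/
import Mathlib

section
/- Let P be a set of n points in regular wheel configuration in the plane, where n ≥ 4 is even, and let C be a 1-plane Hamiltonian cycle on P. Then C contains at least two boundary edges, and every diagonal edge of C has at least one boundary edge of C on each of its two sides. -/
open Finset

noncomputable section

/-- The Euclidean plane. -/
abbrev Pt : Type := EuclideanSpace ℝ (Fin 2)

/-- The open straight-line segment drawn for an unordered pair of indices. -/
def seg {n : ℕ} (v : Fin n → Pt) (e : Sym2 (Fin n)) : Set Pt :=
  Sym2.lift ⟨fun a b => openSegment ℝ (v a) (v b),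
    fun a b => openSegment_symm ℝ (v a) (v b)⟩ e

/-- Two drawn edges cross: they share no endpoint and their open segments meet. -/
def EdgesCross {n : ℕ} (v : Fin n → Pt) (e f : Sym2 (Fin n)) : Prop :=
  (∀ a, a ∈ e → a ∉ f) ∧ (seg v e ∩ seg v f).Nonempty

/-- A set of drawn edges is 1-plane: each edge is crossed by at most one other edge. -/
def OnePlane {n : ℕ} (v : Fin n → Pt) (E : Set (Sym2 (Fin n))) : Prop :=
  ∀ e ∈ E, {f | f ∈ E ∧ EdgesCross v e f}.Subsingleton

/-- `σ` is a Hamiltonian cycle on all `n` vertices. -/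
def IsHamCycle {n : ℕ} (σ : Equiv.Perm (Fin n)) : Prop :=
  σ.IsCycle ∧ σ.support = Finset.univ

/-- The edge set of the Hamiltonian cycle `σ`. -/
def cycEdges {n : ℕ} (σ : Equiv.Perm (Fin n)) : Set (Sym2 (Fin n)) :=
  {e | ∃ i : Fin n, e = s(i, σ i)}

/-- `σ` is a 1-plane Hamiltonian cycle for the point placement `v`. -/
def IsOnePlaneHC {n : ℕ} (v : Fin n → Pt) (σ : Equiv.Perm (Fin n)) : Prop :=
  IsHamCycle σ ∧ OnePlane v (cycEdges σ)

/-- `k` lies on the counterclockwise arc from `j` to `i` (inclusive), indices mod `m`. -/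
def InArc {m : ℕ} (j i k : Fin m) : Prop := (k - j).val ≤ (i - j).val

/-- `w` lists the `m` rim points of a regular wheel with center `x`: they are the
vertices of a regular `m`-gon, labeled counterclockwise, centered at `x`. -/
def IsRegularWheel {m : ℕ} (w : Fin m → Pt) (x : Pt) : Prop :=
  ∃ r θ : ℝ, 0 < r ∧ ∀ i : Fin m,
    w i 0 = x 0 + r * Real.cos (θ + 2 * Real.pi * (i : ℕ) / m) ∧
    w i 1 = x 1 + r * Real.sin (θ + 2 * Real.pi * (i : ℕ) / m)

/-- The `m + 1` points of the wheel: the rim points followed by the center. -/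
def wheelPts {m : ℕ} (w : Fin m → Pt) (x : Pt) : Fin (m + 1) → Pt :=
  Fin.snoc w x
/-- The rim index obtained by reducing `t` modulo `m`. -/
def rimIdx (m : ℕ) [NeZero m] (t : ℕ) : Fin m :=
  ⟨t % m, Nat.mod_lt _ (NeZero.pos m)⟩

section RimIdx

variable {m : ℕ} [NeZero m]

theorem rimIdx_add_self (t : ℕ) : rimIdx m (t + m) = rimIdx m t :=
  Fin.ext (Nat.add_mod_right t m)

theorem rimIdx_add_one (t : ℕ) : rimIdx m t + 1 = rimIdx m (t + 1) := by
  apply Fin.ext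
  simp [rimIdx, Fin.val_add]

theorem exists_rimIdx_eq (p : ℕ) (a : Fin m) :
    ∃ t, p ≤ t ∧ t < p + m ∧ rimIdx m t = a := by
  have hm := NeZero.pos m
  have ha := a.isLt
  have hp := Nat.mod_lt p hm
  have hdiv := Nat.mod_add_div p m
  rcases le_or_gt (p % m) a.val with h | h
  · refine ⟨a.val + m * (p / m), by omega, by omega, Fin.ext ?_⟩
    simp [rimIdx, Nat.mod_eq_of_lt ha]
  · refine ⟨a.val + m * (p / m) + m, by omega, by omega, Fin.ext ?_⟩
    simp [rimIdx, Nat.mod_eq_of_lt ha]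

theorem rimIdx_ne {s t : ℕ} (hst : s < t) (hts : t < s + m) : rimIdx m s ≠ rimIdx m t := by
  intro h
  have h' : s % m = t % m := congrArg Fin.val h
  have hdvd := (Nat.modEq_iff_dvd' hst.le).1 h'
  exact absurd (Nat.le_of_dvd (by omega) hdvd) (by omega)

theorem rimIdx_sub_val {p t : ℕ} (hp : p ≤ t) (ht : t < p + m) :
    (rimIdx m t - rimIdx m p).val = t - p := by
  have hd : t - p < m := by omega
  have h : rimIdx m t = rimIdx m (t - p) + rimIdx m p := by
    apply Fin.ext
    simp only [rimIdx, Fin.val_add, Nat.mod_add_mod, Nat.add_mod_mod]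
    congr 1
    omega
  rw [h, add_sub_cancel_right]
  exact Nat.mod_eq_of_lt hd

theorem inArc_rimIdx {p q t : ℕ} (hpt : p ≤ t) (htq : t ≤ q) (hq : q < p + m) :
    InArc (rimIdx m p) (rimIdx m q) (rimIdx m t) := by
  unfold InArc
  rw [rimIdx_sub_val hpt (by omega), rimIdx_sub_val (by omega) hq]
  omega

end RimIdx

/-- Twice the signed area of the triangle `A B C`. -/
def signedArea (A B C : Pt) : ℝ :=
  (B 0 - A 0) * (C 1 - A 1) - (B 1 - A 1) * (C 0 - A 0)

/-- The diagonals of a convex quadrilateral meet. -/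
theorem openSegment_inter_nonempty {A B C D : Pt} (hBCD : 0 < signedArea B C D)
    (hACD : 0 < signedArea A C D) (hABD : 0 < signedArea A B D) (hABC : 0 < signedArea A B C) :
    (openSegment ℝ A C ∩ openSegment ℝ B D).Nonempty := by
  have hsum : signedArea B C D + signedArea A B D = signedArea A C D + signedArea A B C := by
    unfold signedArea
    ring
  have hpos : 0 < signedArea B C D + signedArea A B D := by positivity
  refine ⟨(signedArea B C D / (signedArea B C D + signedArea A B D)) • A +
    (signedArea A B D / (signedArea B C D + signedArea A B D)) • C,
    ⟨_, _, by positivity, by positivity, by field_simp, rfl⟩,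
    signedArea A C D / (signedArea B C D + signedArea A B D),
    signedArea A B C / (signedArea B C D + signedArea A B D),
    by positivity, by positivity, by rw [← add_div, ← hsum]; field_simp, ?_⟩
  ext i
  fin_cases i
  all_goals
    simp only [PiLp.add_apply, PiLp.smul_apply, smul_eq_mul]
    field_simp
    simp [signedArea]
    ring

theorem signedArea_circle_pos {A B C x : Pt} {r α β γ : ℝ} (hr : 0 < r)
    (hA0 : A 0 = x 0 + r * Real.cos α) (hA1 : A 1 = x 1 + r * Real.sin α)
    (hB0 : B 0 = x 0 + r * Real.cos β) (hB1 : B 1 = x 1 + r * Real.sin β)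
    (hC0 : C 0 = x 0 + r * Real.cos γ) (hC1 : C 1 = x 1 + r * Real.sin γ)
    (hαβ : α < β) (hβγ : β < γ) (hγα : γ < α + 2 * Real.pi) :
    0 < signedArea A B C := by
  have key : signedArea A B C = 4 * r ^ 2 * (Real.sin ((β - α) / 2) *
      Real.sin ((γ - β) / 2) * Real.sin ((γ - α) / 2)) := by
    obtain ⟨u, rfl⟩ : ∃ u, β = α + 2 * u := ⟨(β - α) / 2, by ring⟩
    obtain ⟨v, rfl⟩ : ∃ v, γ = α + 2 * u + 2 * v := ⟨(γ - (α + 2 * u)) / 2, by ring⟩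
    rw [signedArea, hA0, hA1, hB0, hB1, hC0, hC1,
      show (α + 2 * u - α) / 2 = u by ring,
      show (α + 2 * u + 2 * v - (α + 2 * u)) / 2 = v by ring,
      show (α + 2 * u + 2 * v - α) / 2 = u + v by ring,
      show α + 2 * u + 2 * v = α + 2 * (u + v) by ring]
    have h1 : Real.cos (α + 2 * u) - Real.cos α = -2 * Real.sin (α + u) * Real.sin u := by
      rw [Real.cos_sub_cos]; ring_nf
    have h2 : Real.sin (α + 2 * u) - Real.sin α = 2 * Real.sin u * Real.cos (α + u) := by
      rw [Real.sin_sub_sin]; ring_nf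
    have h3 : Real.cos (α + 2 * (u + v)) - Real.cos α =
        -2 * Real.sin (α + u + v) * Real.sin (u + v) := by
      rw [Real.cos_sub_cos]; ring_nf
    have h4 : Real.sin (α + 2 * (u + v)) - Real.sin α =
        2 * Real.sin (u + v) * Real.cos (α + u + v) := by
      rw [Real.sin_sub_sin]; ring_nf
    have h5 : Real.sin v =
        Real.sin (α + u + v) * Real.cos (α + u) - Real.cos (α + u + v) * Real.sin (α + u) := by
      rw [← Real.sin_sub]; ring_nf
    linear_combination
      r ^ 2 * (Real.sin (α + 2 * (u + v)) - Real.sin α) * h1 +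
      r ^ 2 * (-2 * Real.sin (α + u) * Real.sin u) * h4 -
      r ^ 2 * (Real.cos (α + 2 * (u + v)) - Real.cos α) * h2 -
      r ^ 2 * (2 * Real.sin u * Real.cos (α + u)) * h3 -
      4 * r ^ 2 * Real.sin u * Real.sin (u + v) * h5
  rw [key]
  have h1 : 0 < Real.sin ((β - α) / 2) := Real.sin_pos_of_pos_of_lt_pi (by linarith) (by linarith)
  have h2 : 0 < Real.sin ((γ - β) / 2) := Real.sin_pos_of_pos_of_lt_pi (by linarith) (by linarith)
  have h3 : 0 < Real.sin ((γ - α) / 2) := Real.sin_pos_of_pos_of_lt_pi (by linarith) (by linarith)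
  positivity

section Wheel

variable {m : ℕ} [NeZero m] {w : Fin m → Pt} {x : Pt}

theorem rim_coords {r θ : ℝ} (h : ∀ i : Fin m,
    w i 0 = x 0 + r * Real.cos (θ + 2 * Real.pi * (i : ℕ) / m) ∧
    w i 1 = x 1 + r * Real.sin (θ + 2 * Real.pi * (i : ℕ) / m)) (t : ℕ) :
    w (rimIdx m t) 0 = x 0 + r * Real.cos (θ + 2 * Real.pi * t / m) ∧
    w (rimIdx m t) 1 = x 1 + r * Real.sin (θ + 2 * Real.pi * t / m) := by
  have hm : (m : ℝ) ≠ 0 := Nat.cast_ne_zero.2 (NeZero.ne m)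
  have ht : (t : ℝ) = (t % m : ℕ) + m * (t / m : ℕ) := by
    exact_mod_cast (Nat.mod_add_div t m).symm
  have hang : θ + 2 * Real.pi * t / m =
      θ + 2 * Real.pi * (t % m : ℕ) / m + (t / m : ℕ) * (2 * Real.pi) := by
    rw [ht]
    field_simp
    ring
  rw [hang, Real.cos_add_nat_mul_two_pi, Real.sin_add_nat_mul_two_pi]
  exact h (rimIdx m t)

theorem chords_cross (hw : IsRegularWheel w x) {p c q t : ℕ} (hpc : p < c) (hcq : c < q)
    (hqt : q < t) (htp : t < p + m) :
    EdgesCross (wheelPts w x) s((rimIdx m p).castSucc, (rimIdx m q).castSucc)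
      s((rimIdx m c).castSucc, (rimIdx m t).castSucc) := by
  obtain ⟨r, θ, hr, h⟩ := hw
  have hm : (0 : ℝ) < m := Nat.cast_pos.2 (NeZero.pos m)
  have hpi := Real.pi_pos
  have hmono : ∀ {i j : ℕ}, i < j → θ + 2 * Real.pi * i / m < θ + 2 * Real.pi * j / m := by
    intro i j hij
    have : (i : ℝ) < j := Nat.cast_lt.2 hij
    gcongr
  have hwrap : ∀ {i j : ℕ}, j < i + m →
      θ + 2 * Real.pi * j / m < θ + 2 * Real.pi * i / m + 2 * Real.pi := by
    intro i j hij
    refine (hmono hij).trans_eq ?_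
    push_cast
    field_simp
    ring
  have harea : ∀ {i j k : ℕ}, i < j → j < k → k < i + m →
      0 < signedArea (w (rimIdx m i)) (w (rimIdx m j)) (w (rimIdx m k)) := fun hij hjk hki =>
    signedArea_circle_pos hr (rim_coords h _).1 (rim_coords h _).2 (rim_coords h _).1
      (rim_coords h _).2 (rim_coords h _).1 (rim_coords h _).2 (hmono hij) (hmono hjk) (hwrap hki)
  refine ⟨?_, ?_⟩
  · have h1 := rimIdx_ne (m := m) hpc (by omega)
    have h2 := rimIdx_ne (m := m) (hpc.trans (hcq.trans hqt)) htp
    have h3 := rimIdx_ne (m := m) hcq (by omega)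
    have h4 := rimIdx_ne (m := m) hqt (by omega)
    intro a ha
    rcases Sym2.mem_iff.1 ha with rfl | rfl
    · simp [h1, h2]
    · simp [h3.symm, h4]
  · simp only [seg, Sym2.lift_mk, wheelPts, Fin.snoc_castSucc]
    exact openSegment_inter_nonempty (harea hcq hqt (by omega))
      (harea (hpc.trans hcq) hqt htp) (harea hpc (hcq.trans hqt) htp) (harea hpc hcq (by omega))

theorem radial_cross (hw : IsRegularWheel w x) (hm5 : 5 ≤ m) (p : ℕ) :
    EdgesCross (wheelPts w x) s((rimIdx m p).castSucc, (rimIdx m (p + 2)).castSucc)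
      s((rimIdx m (p + 1)).castSucc, Fin.last m) := by
  obtain ⟨r, θ, hr, h⟩ := hw
  have hm : (5 : ℝ) ≤ m := by exact_mod_cast hm5
  have hpi := Real.pi_pos
  have hδ : 2 * Real.pi / m < Real.pi / 2 := by
    rw [div_lt_div_iff₀ (by linarith) (by norm_num)]
    nlinarith
  have hδ0 : 0 < 2 * Real.pi / m := by positivity
  have hcos : 0 < Real.cos (2 * Real.pi / m) := Real.cos_pos_of_mem_Ioo ⟨by linarith, hδ⟩
  have hcos1 : Real.cos (2 * Real.pi / m) < 1 := by
    rw [← Real.cos_zero]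
    exact Real.cos_lt_cos_of_nonneg_of_le_pi_div_two le_rfl hδ.le hδ0
  refine ⟨?_, ?_⟩
  · have h1 := rimIdx_ne (m := m) (Nat.lt_add_one p) (by omega)
    have h2 := rimIdx_ne (m := m) (Nat.lt_add_one (p + 1)) (by omega)
    intro a ha
    rcases Sym2.mem_iff.1 ha with rfl | rfl
    · simp [h1, Fin.castSucc_ne_last]
    · simp [h2.symm, Fin.castSucc_ne_last]
  · simp only [seg, Sym2.lift_mk, wheelPts, Fin.snoc_castSucc, Fin.snoc_last]
    refine ⟨(1 / 2 : ℝ) • w (rimIdx m p) + (1 / 2 : ℝ) • w (rimIdx m (p + 2)),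
      ⟨1 / 2, 1 / 2, by norm_num, by norm_num, by norm_num, rfl⟩,
      Real.cos (2 * Real.pi / m), 1 - Real.cos (2 * Real.pi / m), hcos, by linarith, by ring, ?_⟩
    have e0 := rim_coords h p
    have e1 := rim_coords h (p + 1)
    have e2 := rim_coords h (p + 2)
    rw [show θ + 2 * Real.pi * (p : ℕ) / m =
      θ + 2 * Real.pi * (p + 1 : ℕ) / m - 2 * Real.pi / m by push_cast; ring] at e0
    rw [show θ + 2 * Real.pi * (p + 2 : ℕ) / m =
      θ + 2 * Real.pi * (p + 1 : ℕ) / m + 2 * Real.pi / m by push_cast; ring] at e2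
    rw [Real.cos_sub, Real.sin_sub] at e0
    rw [Real.cos_add _ (2 * Real.pi / m), Real.sin_add _ (2 * Real.pi / m)] at e2
    ext i
    fin_cases i
    · simp only [PiLp.add_apply, PiLp.smul_apply, smul_eq_mul, Fin.zero_eta]
      rw [e0.1, e1.1, e2.1]
      ring
    · simp only [PiLp.add_apply, PiLp.smul_apply, smul_eq_mul, Fin.mk_one]
      rw [e0.2, e1.2, e2.2]
      ring

end Wheel

section HamCycle

variable {n : ℕ} {σ : Equiv.Perm (Fin n)}

theorem apply_mem_cycEdges (u : Fin n) : s(u, σ u) ∈ cycEdges σ := ⟨u, rfl⟩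

theorem symm_apply_mem_cycEdges (u : Fin n) : s(u, σ.symm u) ∈ cycEdges σ :=
  ⟨σ.symm u, by rw [Equiv.apply_symm_apply, Sym2.eq_swap]⟩

theorem IsHamCycle.apply_ne (hσ : IsHamCycle σ) (u : Fin n) : σ u ≠ u :=
  Equiv.Perm.mem_support.1 (hσ.2 ▸ Finset.mem_univ u)

theorem IsHamCycle.apply_ne_symm_apply (hσ : IsHamCycle σ) (hn : 3 ≤ n) (u : Fin n) :
    σ u ≠ σ.symm u := by
  intro h
  have h2 : (σ ^ 2) u = u := by
    rw [pow_two, Equiv.Perm.mul_apply, h, Equiv.apply_symm_apply]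
  have h3 : σ ^ 2 = 1 := hσ.1.pow_eq_one_iff.2 ⟨u, hσ.apply_ne u, h2⟩
  have h4 := Nat.le_of_dvd two_pos (orderOf_dvd_of_pow_eq_one h3)
  rw [hσ.1.orderOf, hσ.2, Finset.card_univ, Fintype.card_fin] at h4
  omega

theorem IsHamCycle.ne_of_mem_cycEdges (hσ : IsHamCycle σ) {u v : Fin n}
    (h : s(u, v) ∈ cycEdges σ) : u ≠ v := by
  obtain ⟨i, hi⟩ := h
  rintro rfl
  rcases Sym2.eq_iff.1 hi with ⟨h1, h2⟩ | ⟨h1, h2⟩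
  · exact hσ.apply_ne i (h2.symm.trans h1)
  · exact hσ.apply_ne i (h1.symm.trans h2)

end HamCycle

section OnePlaneHamCycle

variable {m : ℕ} [NeZero m] {w : Fin m → Pt} {x : Pt} {σ : Equiv.Perm (Fin (m + 1))}

theorem exists_rimIdx_castSucc_eq (p : ℕ) {y : Fin (m + 1)} (hy : y ≠ Fin.last m) :
    ∃ t, p ≤ t ∧ t < p + m ∧ y = (rimIdx m t).castSucc := by
  obtain ⟨a, rfl⟩ := Fin.exists_castSucc_eq.2 hy
  obtain ⟨t, h1, h2, rfl⟩ := exists_rimIdx_eq p a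
  exact ⟨t, h1, h2, rfl⟩

/-- A diagonal from `p` to `p + l` has a boundary edge on the arc from `p` to `p + l`: otherwise, for
a shortest such arc, every edge at an inner vertex of the arc is radial or crosses the diagonal. -/
theorem exists_boundary_of_diagonal (hw : IsRegularWheel w x) (hm : m ≠ 4)
    (hC : IsOnePlaneHC (wheelPts w x) σ) (l : ℕ) : ∀ p : ℕ, 2 ≤ l → l + 2 ≤ m →
    s((rimIdx m p).castSucc, (rimIdx m (p + l)).castSucc) ∈ cycEdges σ →
    ∃ j, p ≤ j ∧ j < p + l ∧
      s((rimIdx m j).castSucc, (rimIdx m (j + 1)).castSucc) ∈ cycEdges σ := by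
  induction l using Nat.strong_induction_on with
  | _ l ih =>
  intro p hl hlm hd
  by_contra! hno
  obtain ⟨hσ, hplane⟩ := hC
  have hshort : ∀ c t, p ≤ c → c < t → t ≤ p + l → t < c + l →
      s((rimIdx m c).castSucc, (rimIdx m t).castSucc) ∉ cycEdges σ := by
    intro c t hpc hct htl htc hmem
    obtain ⟨d, rfl⟩ : ∃ d, t = c + d := ⟨t - c, by omega⟩
    rcases Nat.lt_or_ge d 2 with h | h
    · obtain rfl : d = 1 := by omega
      exact hno c hpc (by omega) hmem
    · obtain ⟨j, h1, h2, h3⟩ := ih d (by omega) c h (by omega) hmem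
      exact hno j (by omega) (by omega) h3
  have hout : ∀ c y, p < c → c < p + l → s((rimIdx m c).castSucc, y) ∈ cycEdges σ →
      y ≠ Fin.last m →
      EdgesCross (wheelPts w x) s((rimIdx m p).castSucc, (rimIdx m (p + l)).castSucc)
        s((rimIdx m c).castSucc, y) := by
    intro c y hpc hcl hmem hy
    obtain ⟨t, hpt, htm, rfl⟩ := exists_rimIdx_castSucc_eq p hy
    rcases lt_trichotomy t c with h | rfl | h
    · rw [Sym2.eq_swap] at hmem
      exact absurd hmem (hshort t c hpt h hcl.le (by omega))
    · exact absurd rfl (hσ.ne_of_mem_cycEdges hmem)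
    · by_cases htl : t ≤ p + l
      · exact absurd hmem (hshort c t hpc.le h htl (by omega))
      · exact chords_cross hw hpc hcl (by omega) htm
  have huniq : ∀ e ∈ cycEdges σ, ∀ f ∈ cycEdges σ,
      EdgesCross (wheelPts w x) s((rimIdx m p).castSucc, (rimIdx m (p + l)).castSucc) e →
      EdgesCross (wheelPts w x) s((rimIdx m p).castSucc, (rimIdx m (p + l)).castSucc) f →
      e = f := fun e he f hf h1 h2 => hplane _ hd ⟨he, h1⟩ ⟨hf, h2⟩
  have hne : ∀ u, σ u ≠ σ.symm u := hσ.apply_ne_symm_apply (by omega)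
  have hrad : ∀ c, p < c → c < p + l →
      σ (rimIdx m c).castSucc = Fin.last m ∨ σ.symm (rimIdx m c).castSucc = Fin.last m := by
    intro c hpc hcl
    by_contra! h
    exact hne _ (Sym2.congr_right.1 (huniq _ (apply_mem_cycEdges _) _ (symm_apply_mem_cycEdges _)
      (hout c _ hpc hcl (apply_mem_cycEdges _) h.1)
      (hout c _ hpc hcl (symm_apply_mem_cycEdges _) h.2)))
  rcases hl.eq_or_lt with rfl | hl3
  · have hcr : ∀ y, s((rimIdx m (p + 1)).castSucc, y) ∈ cycEdges σ →
        EdgesCross (wheelPts w x) s((rimIdx m p).castSucc, (rimIdx m (p + 2)).castSucc)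
          s((rimIdx m (p + 1)).castSucc, y) := by
      intro y hmem
      by_cases hy : y = Fin.last m
      · rw [hy]
        exact radial_cross hw (by omega) p
      · exact hout (p + 1) y (by omega) (by omega) hmem hy
    exact hne _ (Sym2.congr_right.1 (huniq _ (apply_mem_cycEdges _) _ (symm_apply_mem_cycEdges _)
      (hcr _ (apply_mem_cycEdges _)) (hcr _ (symm_apply_mem_cycEdges _))))
  · have hcc : (rimIdx m (p + 1)).castSucc ≠ (rimIdx m (p + 2)).castSucc := fun h =>
      rimIdx_ne (Nat.lt_add_one (p + 1)) (by omega) (Fin.castSucc_injective m h)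
    have hn12 : s((rimIdx m (p + 1)).castSucc, (rimIdx m (p + 2)).castSucc) ∉ cycEdges σ :=
      hshort (p + 1) (p + 2) (by omega) (by omega) (by omega) (by omega)
    have hcontra : ∀ y z, s((rimIdx m (p + 1)).castSucc, y) ∈ cycEdges σ →
        s((rimIdx m (p + 2)).castSucc, z) ∈ cycEdges σ → y ≠ Fin.last m → z ≠ Fin.last m →
        False := by
      intro y z hy hz hyl hzl
      have heq := huniq _ hy _ hz (hout (p + 1) y (by omega) (by omega) hy hyl)
        (hout (p + 2) z (by omega) (by omega) hz hzl)
      rcases Sym2.eq_iff.1 heq with ⟨h, -⟩ | ⟨-, h⟩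
      · exact hcc h
      · exact hn12 (h ▸ hy)
    rcases hrad (p + 1) (by omega) (by omega) with h1 | h1 <;>
      rcases hrad (p + 2) (by omega) (by omega) with h2 | h2
    · exact hcc (σ.injective (h1.trans h2.symm))
    · exact hcontra _ _ (symm_apply_mem_cycEdges _) (apply_mem_cycEdges _)
        (fun h => hne _ (h1.trans h.symm)) (fun h => hne _ (h.trans h2.symm))
    · exact hcontra _ _ (apply_mem_cycEdges _) (symm_apply_mem_cycEdges _)
        (fun h => hne _ (h.trans h1.symm)) (fun h => hne _ (h2.trans h.symm))
    · exact hcc (σ.symm.injective (h1.trans h2.symm))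

/-- A Hamiltonian cycle without diagonals has two boundary edges, those at a rim vertex that is not
adjacent to the center. -/
theorem exists_two_boundary_of_no_diagonal (hm : 3 ≤ m) (hσ : IsHamCycle σ)
    (hno : ∀ p l, 2 ≤ l → l + 2 ≤ m →
      s((rimIdx m p).castSucc, (rimIdx m (p + l)).castSucc) ∉ cycEdges σ) :
    ∃ k l : Fin m, k ≠ l ∧ s(k.castSucc, (k + 1).castSucc) ∈ cycEdges σ ∧
      s(l.castSucc, (l + 1).castSucc) ∈ cycEdges σ := by
  obtain ⟨u, hu⟩ : ∃ u, u ∉ ({Fin.last m, σ (Fin.last m), σ.symm (Fin.last m)} : Finset _) := by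
    by_contra! h
    have h1 := Finset.card_le_card (fun u _ => h u : Finset.univ ⊆ _)
    have h2 := Finset.card_le_three (a := Fin.last m) (b := σ (Fin.last m))
      (c := σ.symm (Fin.last m))
    rw [Finset.card_univ, Fintype.card_fin] at h1
    omega
  simp only [Finset.mem_insert, Finset.mem_singleton, not_or] at hu
  obtain ⟨t, ht, -, rfl⟩ := exists_rimIdx_castSucc_eq 1 hu.1
  obtain ⟨s, rfl⟩ : ∃ s, t = s + 1 := ⟨t - 1, by omega⟩
  have hnbr : ∀ y, s((rimIdx m (s + 1)).castSucc, y) ∈ cycEdges σ → y ≠ Fin.last m →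
      y = (rimIdx m s).castSucc ∨ y = (rimIdx m (s + 2)).castSucc := by
    intro y hmem hy
    obtain ⟨q, hq1, hq2, rfl⟩ := exists_rimIdx_castSucc_eq (s + 1) hy
    obtain ⟨d, rfl⟩ : ∃ d, q = s + 1 + d := ⟨q - (s + 1), by omega⟩
    by_cases hd : 2 ≤ d ∧ d + 2 ≤ m
    · exact absurd hmem (hno _ _ hd.1 hd.2)
    · obtain rfl | rfl | hd' : d = 0 ∨ d = 1 ∨ s + 1 + d = s + m := by omega
      · exact absurd rfl (hσ.ne_of_mem_cycEdges hmem)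
      · exact Or.inr rfl
      · rw [hd', rimIdx_add_self]
        exact Or.inl rfl
  have hσu : σ (rimIdx m (s + 1)).castSucc ≠ Fin.last m :=
    fun h => hu.2.2 (σ.eq_symm_apply.2 h)
  have hσu' : σ.symm (rimIdx m (s + 1)).castSucc ≠ Fin.last m :=
    fun h => hu.2.1 (σ.symm_apply_eq.1 h)
  have h1 := apply_mem_cycEdges (σ := σ) (rimIdx m (s + 1)).castSucc
  have h2 := symm_apply_mem_cycEdges (σ := σ) (rimIdx m (s + 1)).castSucc
  have hne := hσ.apply_ne_symm_apply (by omega) (rimIdx m (s + 1)).castSucc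
  refine ⟨rimIdx m s, rimIdx m (s + 1), rimIdx_ne (by omega) (by omega), ?_⟩
  rw [rimIdx_add_one, rimIdx_add_one, Sym2.eq_swap]
  rcases hnbr _ h1 hσu with h3 | h3 <;> rcases hnbr _ h2 hσu' with h4 | h4
  · exact absurd (h3.trans h4.symm) hne
  · exact ⟨h3 ▸ h1, h4 ▸ h2⟩
  · exact ⟨h4 ▸ h2, h3 ▸ h1⟩
  · exact absurd (h3.trans h4.symm) hne

end OnePlaneHamCycle

/-- a 1-plane Hamiltonian cycle on `n = m + 1 ≥ 4` points in
regular wheel configuration (`n` even) has at least two boundary edges, and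
every diagonal edge of it has a boundary edge of it on each of its two sides. -/
theorem stmt11 {m : ℕ} [NeZero m] (hn : 4 ≤ m + 1) (heven : Even (m + 1))
    (w : Fin m → Pt) (x : Pt) (hw : IsRegularWheel w x)
    (σ : Equiv.Perm (Fin (m + 1))) (hC : IsOnePlaneHC (wheelPts w x) σ) :
    (∃ k l : Fin m, k ≠ l ∧
      s(k.castSucc, (k + 1).castSucc) ∈ cycEdges σ ∧
      s(l.castSucc, (l + 1).castSucc) ∈ cycEdges σ) ∧
    (∀ a b : Fin m, s(a.castSucc, b.castSucc) ∈ cycEdges σ →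
      a ≠ b → b ≠ a + 1 → a ≠ b + 1 →
      (∃ k : Fin m, InArc a b k ∧ InArc a b (k + 1) ∧
        s(k.castSucc, (k + 1).castSucc) ∈ cycEdges σ) ∧
      (∃ k : Fin m, InArc b a k ∧ InArc b a (k + 1) ∧
        s(k.castSucc, (k + 1).castSucc) ∈ cycEdges σ)) := by
  have hm4 : m ≠ 4 := by
    rintro rfl
    exact absurd heven (by decide)
  have hboth : ∀ p l, 2 ≤ l → l + 2 ≤ m →
      s((rimIdx m p).castSucc, (rimIdx m (p + l)).castSucc) ∈ cycEdges σ →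
      (∃ j, p ≤ j ∧ j < p + l ∧
        s((rimIdx m j).castSucc, (rimIdx m j + 1).castSucc) ∈ cycEdges σ) ∧
      (∃ j, p + l ≤ j ∧ j < p + m ∧
        s((rimIdx m j).castSucc, (rimIdx m j + 1).castSucc) ∈ cycEdges σ) := by
    intro p l hl hlm hmem
    simp only [rimIdx_add_one]
    refine ⟨exists_boundary_of_diagonal hw hm4 hC l p hl hlm hmem, ?_⟩
    obtain ⟨j, h1, h2, h3⟩ := exists_boundary_of_diagonal hw hm4 hC (m - l) (p + l)
      (by omega) (by omega) (by
        rwa [show p + l + (m - l) = p + m by omega, rimIdx_add_self, Sym2.eq_swap])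
    exact ⟨j, h1, by omega, h3⟩
  refine ⟨?_, ?_⟩
  · by_cases h : ∃ p l, 2 ≤ l ∧ l + 2 ≤ m ∧
        s((rimIdx m p).castSucc, (rimIdx m (p + l)).castSucc) ∈ cycEdges σ
    · obtain ⟨p, l, hl, hlm, hmem⟩ := h
      obtain ⟨⟨j, hj1, hj2, hj⟩, k, hk1, hk2, hk⟩ := hboth p l hl hlm hmem
      exact ⟨rimIdx m j, rimIdx m k, rimIdx_ne (by omega) (by omega), hj, hk⟩
    · exact exists_two_boundary_of_no_diagonal (by omega) hC.1
        fun p l hl hlm hmem => h ⟨p, l, hl, hlm, hmem⟩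
  · intro a b hmem hab hba hab'
    obtain ⟨p, -, -, rfl⟩ := exists_rimIdx_eq 0 a
    obtain ⟨q, hq1, hq2, rfl⟩ := exists_rimIdx_eq p b
    obtain ⟨l, rfl⟩ : ∃ l, q = p + l := ⟨q - p, by omega⟩
    have hl0 : l ≠ 0 := by
      rintro rfl
      exact hab rfl
    have hl1 : l ≠ 1 := by
      rintro rfl
      exact hba (rimIdx_add_one p).symm
    have hlm : l + 1 ≠ m := by
      intro h
      apply hab'
      rw [rimIdx_add_one, add_assoc, h, rimIdx_add_self]
    obtain ⟨⟨j, hj1, hj2, hj⟩, k, hk1, hk2, hk⟩ := hboth p l (by omega) (by omega) hmem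
    refine ⟨⟨rimIdx m j, inArc_rimIdx hj1 hj2.le (by omega), ?_, hj⟩, rimIdx m k, ?_, ?_, hk⟩
    · rw [rimIdx_add_one]
      exact inArc_rimIdx (by omega) hj2 (by omega)
    · rw [← rimIdx_add_self p]
      exact inArc_rimIdx hk1 hk2.le (by omega)
    · rw [rimIdx_add_one, ← rimIdx_add_self p]
      exact inArc_rimIdx (by omega) hk2 (by omega)

end
end

section
/- Let P be a set of n points in regular wheel configuration in the plane, where n ≥ 8 is even, and let C be a 1-plane Hamiltonian cycle on P whose boundary edges are exactly the two edges v_r v_{r+1} and v_s v_{s+1} (with r ≠ s). Then for each k ∈ {r, s}, both v_k v_{k+2} and v_{k+1} v_{k−1} are edges of C. -/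
open Finset

noncomputable section

/-- Two segments meet when, in a rotated frame at `x`, the first is a chord perpendicular to the
first axis and the second joins points of the disk on different sides of it. -/
theorem openSegment_inter_of_frame {x A B P Q : Pt} {μ d e r p p' q q' : ℝ} (he : 0 < e)
    (hr : d ^ 2 + e ^ 2 = r ^ 2)
    (hA : A 0 = x 0 + d * Real.cos μ + e * Real.sin μ ∧
      A 1 = x 1 + d * Real.sin μ - e * Real.cos μ)
    (hB : B 0 = x 0 + d * Real.cos μ - e * Real.sin μ ∧
      B 1 = x 1 + d * Real.sin μ + e * Real.cos μ)
    (hP : P 0 = x 0 + p * Real.cos μ - p' * Real.sin μ ∧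
      P 1 = x 1 + p * Real.sin μ + p' * Real.cos μ)
    (hQ : Q 0 = x 0 + q * Real.cos μ - q' * Real.sin μ ∧
      Q 1 = x 1 + q * Real.sin μ + q' * Real.cos μ)
    (hp : d < p) (hp' : p ^ 2 + p' ^ 2 ≤ r ^ 2) (hq : q < d) (hq' : q ^ 2 + q' ^ 2 ≤ r ^ 2) :
    (openSegment ℝ A B ∩ openSegment ℝ P Q).Nonempty := by
  have hpq : 0 < p - q := by linarith
  obtain ⟨t, ht⟩ : ∃ t, t = (p - d) / (p - q) := ⟨_, rfl⟩
  have ht0 : 0 < t := ht ▸ div_pos (by linarith) hpq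
  have ht1 : t < 1 := by rw [ht, div_lt_one hpq]; linarith
  have hd : d = (1 - t) * p + t * q := by rw [ht]; field_simp; ring
  obtain ⟨g, hg⟩ : ∃ g, g = (1 - t) * p' + t * q' := ⟨_, rfl⟩
  have hgr : g ^ 2 < e ^ 2 := by
    have h1 : d ^ 2 + g ^ 2 = (1 - t) * (p ^ 2 + p' ^ 2) + t * (q ^ 2 + q' ^ 2)
        - t * (1 - t) * ((p - q) ^ 2 + (p' - q') ^ 2) := by rw [hg, hd]; ring
    have h2 : 0 < t * (1 - t) * ((p - q) ^ 2 + (p' - q') ^ 2) := by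
      have : 0 < 1 - t := by linarith
      positivity
    have h3 : (1 - t) * (p ^ 2 + p' ^ 2) ≤ (1 - t) * r ^ 2 :=
      mul_le_mul_of_nonneg_left hp' (by linarith)
    have h4 : t * (q ^ 2 + q' ^ 2) ≤ t * r ^ 2 := mul_le_mul_of_nonneg_left hq' ht0.le
    linarith
  obtain ⟨hg1, hg2⟩ := abs_lt.1 (abs_lt_of_sq_lt_sq hgr he.le)
  obtain ⟨τ, hτ⟩ : ∃ τ, τ = (g + e) / (2 * e) := ⟨_, rfl⟩
  have hτ0 : 0 < τ := hτ ▸ div_pos (by linarith) (by linarith)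
  have hτ1 : τ < 1 := by rw [hτ, div_lt_one (by linarith)]; linarith
  have hgτ : g = (2 * τ - 1) * e := by rw [hτ]; field_simp; ring
  refine ⟨(1 - τ) • A + τ • B, ⟨1 - τ, τ, by linarith, hτ0, by ring, rfl⟩,
    ⟨1 - t, t, by linarith, ht0, by ring, ?_⟩⟩
  ext k
  fin_cases k
  · simp only [PiLp.add_apply, PiLp.smul_apply, smul_eq_mul, Fin.zero_eta, hA.1, hB.1, hP.1, hQ.1]
    linear_combination (-Real.cos μ) * hd + Real.sin μ * (hg - hgτ)
  · simp only [PiLp.add_apply, PiLp.smul_apply, smul_eq_mul, Fin.mk_one, hA.2, hB.2, hP.2, hQ.2]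
    linear_combination (-Real.sin μ) * hd - Real.cos μ * (hg - hgτ)

/-- The residue of `i` modulo `m`. -/
def residue (m : ℕ) [NeZero m] (i : ℤ) : Fin m :=
  ⟨(i % m).toNat, by
    have hm : (0 : ℤ) < m := by exact_mod_cast Nat.pos_of_neZero m
    have := Int.emod_lt_of_pos i hm
    have := Int.emod_nonneg i hm.ne'
    omega⟩

/-- The index of the rim vertex with label `i` modulo `m`. -/
def rim (m : ℕ) [NeZero m] (i : ℤ) : Fin (m + 1) := (residue m i).castSucc

theorem wheelPts_rim {m : ℕ} [NeZero m] {w : Fin m → Pt} {x : Pt} {r θ : ℝ}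
    (hw : ∀ i : Fin m, w i 0 = x 0 + r * Real.cos (θ + 2 * Real.pi * (i : ℕ) / m) ∧
      w i 1 = x 1 + r * Real.sin (θ + 2 * Real.pi * (i : ℕ) / m)) (i : ℤ) :
    wheelPts w x (rim m i) 0 = x 0 + r * Real.cos (θ + 2 * Real.pi * i / m) ∧
      wheelPts w x (rim m i) 1 = x 1 + r * Real.sin (θ + 2 * Real.pi * i / m) := by
  have hm : (m : ℝ) ≠ 0 := by exact_mod_cast NeZero.ne m
  have hi : (((i % m).toNat : ℕ) : ℝ) = i - m * (i / m : ℤ) := by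
    have h1 : (((i % m).toNat : ℕ) : ℤ) = i - m * (i / m) := by
      rw [Int.toNat_of_nonneg (Int.emod_nonneg _ (by exact_mod_cast NeZero.ne m)), Int.emod_def]
    exact_mod_cast h1
  have ha : θ + 2 * Real.pi * (((i % m).toNat : ℕ) : ℝ) / m =
      θ + 2 * Real.pi * i / m - (i / m : ℤ) * (2 * Real.pi) := by
    rw [hi]; field_simp; ring
  have := hw (residue m i)
  rw [show ((residue m i : ℕ) : ℝ) = ((i % m).toNat : ℕ) from rfl, ha, Real.cos_sub_int_mul_two_pi, Real.sin_sub_int_mul_two_pi] at this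
  simpa [wheelPts, rim] using this

/-- A chord cutting off the arc from `i` to `j` away from the center meets every segment joining
a vertex inside the arc to the center or to a vertex outside it. -/
theorem chord_inter {m : ℕ} [NeZero m] {w : Fin m → Pt} {x : Pt} (hw : IsRegularWheel w x)
    {i j a : ℤ} (hij : 2 * (j - i) < m) (hia : i < a) (haj : a < j) {c : Fin (m + 1)}
    (hc : c = Fin.last m ∨ ∃ b, j < b ∧ b < i + m ∧ c = rim m b) :
    (openSegment ℝ (wheelPts w x (rim m i)) (wheelPts w x (rim m j)) ∩
      openSegment ℝ (wheelPts w x (rim m a)) (wheelPts w x c)).Nonempty := by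
  obtain ⟨r, θ, hr, hw⟩ := hw
  have hm : (0 : ℝ) < m := by exact_mod_cast Nat.pos_of_neZero m
  have hπ := Real.pi_pos
  set μ : ℝ := θ + Real.pi * (i + j) / m with hμ
  set δ : ℝ := Real.pi * (j - i) / m with hδ
  have hij' : 2 * ((j : ℝ) - i) < m := by exact_mod_cast hij
  have hia' : (i : ℝ) < a := by exact_mod_cast hia
  have haj' : (a : ℝ) < j := by exact_mod_cast haj
  have hδ0 : 0 < δ := div_pos (mul_pos hπ (by linarith)) hm
  have hδ1 : δ < Real.pi / 2 := by
    rw [hδ, div_lt_iff₀ hm]; nlinarith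
  have hcos : 0 < Real.cos δ := Real.cos_pos_of_mem_Ioo ⟨by linarith, hδ1⟩
  have hsin : 0 < Real.sin δ := Real.sin_pos_of_pos_of_lt_pi hδ0 (by linarith)
  have frame : ∀ k : ℤ, ∀ β : ℝ, θ + 2 * Real.pi * k / m = μ + β →
      wheelPts w x (rim m k) 0 =
        x 0 + r * Real.cos β * Real.cos μ - r * Real.sin β * Real.sin μ ∧
      wheelPts w x (rim m k) 1 =
        x 1 + r * Real.cos β * Real.sin μ + r * Real.sin β * Real.cos μ := by
    intro k β hβ
    obtain ⟨h0, h1⟩ := wheelPts_rim hw k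
    rw [hβ, Real.cos_add] at h0
    rw [hβ, Real.sin_add] at h1
    exact ⟨by rw [h0]; ring, by rw [h1]; ring⟩
  have hi := frame i (-δ) (by rw [hμ, hδ]; field_simp; ring)
  have hj := frame j δ (by rw [hμ, hδ]; field_simp; ring)
  obtain ⟨α, hα⟩ : ∃ α, α = Real.pi * (2 * a - i - j) / m := ⟨_, rfl⟩
  have ha := frame a α (by rw [hμ, hα]; field_simp; ring)
  have hα' : |α| < δ := by
    rw [abs_lt, hα, hδ, ← neg_div, div_lt_div_iff_of_pos_right hm,
      div_lt_div_iff_of_pos_right hm]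
    constructor <;> nlinarith
  have hcα : Real.cos δ < Real.cos α := by
    rw [← Real.cos_abs α]
    exact Real.cos_lt_cos_of_nonneg_of_le_pi (abs_nonneg _) (by linarith) hα'
  have hcirc : ∀ β, (r * Real.cos β) ^ 2 + (r * Real.sin β) ^ 2 = r ^ 2 := fun β => by
    rw [mul_pow, mul_pow, ← mul_add, Real.cos_sq_add_sin_sq, mul_one]
  rw [Real.cos_neg, Real.sin_neg] at hi
  obtain ⟨q, q', hQ, hq, hq'⟩ : ∃ q q' : ℝ,
      (wheelPts w x c 0 = x 0 + q * Real.cos μ - q' * Real.sin μ ∧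
        wheelPts w x c 1 = x 1 + q * Real.sin μ + q' * Real.cos μ) ∧
      q < r * Real.cos δ ∧ q ^ 2 + q' ^ 2 ≤ r ^ 2 := by
    rcases hc with rfl | ⟨b, h1, h2, rfl⟩
    · refine ⟨0, 0, by simp [wheelPts], by positivity, by nlinarith⟩
    · obtain ⟨β, hβ⟩ : ∃ β, β = Real.pi * (2 * b - i - j) / m := ⟨_, rfl⟩
      refine ⟨_, _, frame b β (by rw [hμ, hβ]; field_simp; ring), ?_, (hcirc β).le⟩
      have h1' : (j : ℝ) < b := by exact_mod_cast h1
      have h2' : (b : ℝ) < i + m := by exact_mod_cast h2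
      have hβ1 : δ < β := by
        rw [hβ, hδ, div_lt_div_iff_of_pos_right hm]; nlinarith
      have hβ2 : β + δ < 2 * Real.pi := by
        rw [hβ, hδ, ← add_div, div_lt_iff₀ hm]; nlinarith
      refine mul_lt_mul_of_pos_left ?_ hr
      rcases le_total β Real.pi with h | h
      · exact Real.cos_lt_cos_of_nonneg_of_le_pi hδ0.le h hβ1
      · rw [← Real.cos_two_pi_sub β]
        exact Real.cos_lt_cos_of_nonneg_of_le_pi hδ0.le (by linarith) (by linarith)
  exact openSegment_inter_of_frame (mul_pos hr hsin) (hcirc δ)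
    ⟨by rw [hi.1]; ring, by rw [hi.2]; ring⟩ hj ha hQ
    (mul_lt_mul_of_pos_left hcα hr) (hcirc α).le hq hq'

theorem residue_natCast {m : ℕ} [NeZero m] (k : Fin m) : residue m (k : ℕ) = k := by
  ext
  have : ((k : ℕ) : ℤ) % m = (k : ℕ) :=
    Int.emod_eq_of_lt (by positivity) (by exact_mod_cast k.isLt)
  simp [residue, this]

theorem residue_eq_iff {m : ℕ} [NeZero m] (i j : ℤ) :
    residue m i = residue m j ↔ (m : ℤ) ∣ i - j := by
  have hm : (m : ℤ) ≠ 0 := by exact_mod_cast NeZero.ne m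
  have := Int.emod_nonneg i hm
  have := Int.emod_nonneg j hm
  rw [Fin.ext_iff, dvd_sub_comm, ← Int.modEq_iff_dvd, Int.ModEq]
  simp only [residue]
  omega

theorem residue_add_one {m : ℕ} [NeZero m] (hm : 2 ≤ m) (i : ℤ) :
    residue m i + 1 = residue m (i + 1) := by
  have h0 : (m : ℤ) ≠ 0 := by omega
  have h1 := Int.emod_nonneg i h0
  have h2 := Int.emod_lt_of_pos i (show (0 : ℤ) < m by omega)
  ext
  rw [Fin.val_add, Fin.val_one', Nat.mod_eq_of_lt (show 1 < m by omega)]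
  simp only [residue]
  have : (i + 1) % (m : ℤ) = (i % m + 1) % m := by simp
  rw [this]
  have e : (i % (m : ℤ) + 1) = (((i % (m : ℤ)).toNat + 1 : ℕ) : ℤ) := by omega
  rw [e, ← Int.natCast_mod, Int.toNat_natCast]

open Fin.CommRing in
theorem residue_sub_one {m : ℕ} [NeZero m] (hm : 2 ≤ m) (i : ℤ) :
    residue m i - 1 = residue m (i - 1) := by
  have := residue_add_one hm (i - 1)
  rw [sub_add_cancel] at this
  rw [← this]
  exact add_sub_cancel_right (residue m (i - 1)) 1

namespace IsHamCycle

variable {n : ℕ} {σ : Equiv.Perm (Fin n)}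

theorem eq_univ_of_mapsTo (hσ : IsHamCycle σ) {S : Set (Fin n)} (hS : S.Nonempty)
    (h : ∀ u ∈ S, σ u ∈ S) (y : Fin n) : y ∈ S := by
  obtain ⟨u, hu⟩ := hS
  have hne : ∀ z, σ z ≠ z := fun z =>
    Equiv.Perm.mem_support.1 (hσ.2 ▸ Finset.mem_univ z)
  obtain ⟨k, rfl⟩ := hσ.1.exists_pow_eq (hne u) (hne y)
  induction k with
  | zero => simpa using hu
  | succ k ih => rw [pow_succ']; exact h _ ih

theorem inv (hσ : IsHamCycle σ) : IsHamCycle σ⁻¹ :=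
  ⟨hσ.1.inv, by rw [Equiv.Perm.support_inv]; exact hσ.2⟩

theorem mem_cycEdges (a b : Fin n) : s(a, b) ∈ cycEdges σ ↔ b = σ a ∨ b = σ⁻¹ a := by
  simp only [cycEdges, Set.mem_ofPred_eq, Sym2.eq_iff, Equiv.Perm.eq_inv_iff_eq]
  constructor
  · rintro ⟨i, ⟨rfl, rfl⟩ | ⟨rfl, rfl⟩⟩ <;> simp
  · rintro (rfl | rfl)
    · exact ⟨a, by simp⟩
    · exact ⟨b, by simp⟩

theorem ne_inv (hσ : IsHamCycle σ) (hn : 3 ≤ n) (u : Fin n) : σ u ≠ σ⁻¹ u := by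
  intro h
  rw [Equiv.Perm.eq_inv_iff_eq] at h
  have huniv := hσ.eq_univ_of_mapsTo (S := ({u, σ u} : Finset (Fin n))) ⟨u, by simp⟩
    (by simp [h])
  have h1 : (Finset.univ : Finset (Fin n)) ⊆ {u, σ u} := fun y _ => by simpa using huniv y
  have h2 := (Finset.card_le_card h1).trans Finset.card_le_two
  rw [Finset.card_univ, Fintype.card_fin] at h2
  omega

theorem not_cut (hσ : IsHamCycle σ) {T : Set (Fin n)} {b : Fin n} (hT : T.Nonempty)
    (hu : ∃ u, u ∉ T ∧ u ≠ b) :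
    ¬ ∀ t ∈ T, ∀ u, s(t, u) ∈ cycEdges σ → u ∈ T ∨ u = b := by
  intro h
  obtain ⟨u, huT, hub⟩ := hu
  have h1 : ∀ t ∈ T, σ t ∈ T ∨ σ t = b := fun t ht =>
    h t ht _ ((mem_cycEdges _ _).2 (Or.inl rfl))
  have h2 : ∀ t ∈ T, σ⁻¹ t ∈ T ∨ σ⁻¹ t = b := fun t ht =>
    h t ht _ ((mem_cycEdges _ _).2 (Or.inr rfl))
  by_cases hb : σ b ∈ T ∨ σ b = b
  · have := hσ.eq_univ_of_mapsTo (S := insert b T) ⟨b, by simp⟩ (by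
      rintro t (rfl | ht)
      · simpa [or_comm] using hb
      · simpa [or_comm] using h1 t ht) u
    rcases this with e | e
    · exact hub e
    · exact huT e
  · refine huT (hσ.inv.eq_univ_of_mapsTo hT (fun t ht => (h2 t ht).resolve_right fun e => ?_) u)
    rw [Equiv.Perm.inv_eq_iff_eq] at e
    exact hb (Or.inl (e ▸ ht))

end IsHamCycle

theorem IsOnePlaneHC.eq_of_inter {n : ℕ} {p : Fin n → Pt} {σ : Equiv.Perm (Fin n)}
    (hC : IsOnePlaneHC p σ) {a b c d c' d' : Fin n} (hab : s(a, b) ∈ cycEdges σ)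
    (hcd : s(c, d) ∈ cycEdges σ) (hcd' : s(c', d') ∈ cycEdges σ)
    (hne : a ≠ c ∧ a ≠ d ∧ b ≠ c ∧ b ≠ d) (hne' : a ≠ c' ∧ a ≠ d' ∧ b ≠ c' ∧ b ≠ d')
    (h : (openSegment ℝ (p a) (p b) ∩ openSegment ℝ (p c) (p d)).Nonempty)
    (h' : (openSegment ℝ (p a) (p b) ∩ openSegment ℝ (p c') (p d')).Nonempty) :
    s(c, d) = s(c', d') := by
  refine hC.2 _ hab ⟨hcd, ?_, h⟩ ⟨hcd', ?_, h'⟩ <;>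
    · intro y hy
      simp only [Sym2.mem_iff] at hy ⊢
      rcases hy with rfl | rfl <;> tauto

/-- The combinatorial content of a 1-plane Hamiltonian cycle `G` on a regular wheel with `m` rim
points `v i` (indexed by `ℤ`, with period `m`) and center `x`. -/
structure WheelCycle {V : Type*} [DecidableEq V] (m : ℤ) (G : V → V → Prop) (v : ℤ → V) (x : V) :
    Prop where
  symm : ∀ {a b}, G a b → G b a
  rim_eq : ∀ i j, v i = v j ↔ m ∣ i - j
  rim_ne : ∀ i, v i ≠ x
  cover : ∀ u, u = x ∨ ∃ i, u = v i
  loopless : ∀ u, ¬ G u u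
  deg_le : ∀ {u a b c}, G u a → G u b → G u c → a = b ∨ a = c ∨ b = c
  deg_ge : ∀ u w, ∃ a, G u a ∧ a ≠ w
  no_short_cycle : ∀ S : Finset V, S.Nonempty → S.card ≤ 6 →
    ¬ ∀ u ∈ S, ∃ a ∈ S, ∃ b ∈ S, a ≠ b ∧ G u a ∧ G u b
  no_cut : ∀ (T : Set V) (b : V), T.Nonempty → (∃ u, u ∉ T ∧ u ≠ b) →
    ¬ ∀ t ∈ T, ∀ u, G t u → u ∈ T ∨ u = b
  cross_chord : ∀ {i j a a' : ℤ} {c c' : V}, 2 * (j - i) < m → G (v i) (v j) →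
    i < a → a < j → i < a' → a' < j → (∀ t, i ≤ t → t ≤ j → c ≠ v t) →
    (∀ t, i ≤ t → t ≤ j → c' ≠ v t) → G (v a) c → G (v a') c' → a = a' ∧ c = c'
  cross_spoke : ∀ {i j i' j' a : ℤ}, 2 * (j - i) < m → 2 * (j' - i') < m →
    G (v i) (v j) → G (v i') (v j') → G x (v a) → i < a → a < j → i' < a → a < j' →
    i = i' ∧ j = j'

namespace WheelCycle

variable {V : Type*} [DecidableEq V] {m h : ℤ} {G : V → V → Prop} {v : ℤ → V} {x : V}

theorem rim_inj (W : WheelCycle m G v x) {i j : ℤ} (e : v i = v j) (h1 : i < j + m)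
    (h2 : j < i + m) : i = j := by
  obtain ⟨q, hq⟩ := (W.rim_eq i j).1 e
  have hm : 0 < m := by omega
  have : q = 0 := by
    have : q < 1 := by nlinarith
    have : -1 < q := by nlinarith
    omega
  subst this; omega

theorem rim_add (W : WheelCycle m G v x) (i : ℤ) : v (i + m) = v i :=
  (W.rim_eq _ _).2 ⟨1, by ring⟩

theorem rim_sub (W : WheelCycle m G v x) (i : ℤ) : v (i - m) = v i :=
  (W.rim_eq _ _).2 ⟨-1, by ring⟩

theorem reflect (W : WheelCycle m G v x) : WheelCycle m G (fun i => v (-i)) x where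
  symm := W.symm
  rim_eq i j := by
    rw [W.rim_eq, ← dvd_neg]; ring_nf
  rim_ne i := W.rim_ne _
  cover u := (W.cover u).imp_right fun ⟨i, hi⟩ => ⟨-i, by simpa using hi⟩
  loopless := W.loopless
  deg_le := W.deg_le
  deg_ge := W.deg_ge
  no_short_cycle := W.no_short_cycle
  no_cut := W.no_cut
  cross_chord {i j a a' c c'} h0 hG h1 h2 h3 h4 h5 h6 h7 h8 := by
    have := W.cross_chord (i := -j) (j := -i) (a := -a) (a' := -a') (c := c) (c' := c')
      (by omega) (W.symm hG) (by omega) (by omega) (by omega) (by omega)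
      (fun t h h' => by simpa using h5 (-t) (by omega) (by omega))
      (fun t h h' => by simpa using h6 (-t) (by omega) (by omega)) h7 h8
    exact ⟨by omega, this.2⟩
  cross_spoke {i j i' j' a} h0 h0' hG hG' hx h1 h2 h3 h4 := by
    have := W.cross_spoke (i := -j) (j := -i) (i' := -j') (j' := -i') (a := -a)
      (by omega) (by omega) (W.symm hG) (W.symm hG') hx (by omega) (by omega) (by omega) (by omega)
    omega

/-- Every rim vertex has a representative index in a given window. -/
theorem exists_rim_window (W : WheelCycle m G v x) (hm : 0 < m) (i k : ℤ) :
    ∃ j, i ≤ j ∧ j < i + m ∧ v k = v j := by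
  refine ⟨i + (k - i) % m, ?_, ?_, ?_⟩
  · have := Int.emod_nonneg (k - i) hm.ne'; omega
  · have := Int.emod_lt_of_pos (k - i) hm; omega
  · rw [W.rim_eq]
    refine ⟨(k - i) / m, ?_⟩
    have := Int.emod_add_mul_ediv (k - i) m
    linarith

theorem adj_cases (W : WheelCycle m G v x) (hm : 0 < m) {i : ℤ} {c : V} (hc : G (v i) c) :
    c = x ∨ ∃ j, i < j ∧ j < i + m ∧ c = v j := by
  rcases W.cover c with h | ⟨k, rfl⟩
  · exact Or.inl h
  · obtain ⟨j, h1, h2, h3⟩ := W.exists_rim_window hm i k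
    refine Or.inr ⟨j, lt_of_le_of_ne h1 ?_, h2, h3⟩
    rintro rfl
    exact W.loopless _ (h3 ▸ hc)

/-- A vertex cannot have three rim neighbours. -/
theorem not_three_rim (W : WheelCycle m G v x) {u : V} {a b c : ℤ} (ha : G u (v a))
    (hb : G u (v b)) (hc : G u (v c)) (hab : a < b) (hbc : b < c) (hca : c < a + m) : False := by
  rcases W.deg_le ha hb hc with e | e | e <;>
    have := W.rim_inj e (by omega) (by omega) <;> omega

theorem not_spoke_of_two_rim (W : WheelCycle m G v x) {i a b : ℤ} (ha : G (v i) (v a))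
    (hb : G (v i) (v b)) (hx : G (v i) x) (hab : a < b) (hba : b < a + m) : False := by
  rcases W.deg_le ha hb hx with e | e | e
  · have := W.rim_inj e (by omega) (by omega); omega
  · exact W.rim_ne _ e
  · exact W.rim_ne _ e

theorem no_triangle (W : WheelCycle m G v x) {a b c : V} (hab : G a b) (hbc : G b c)
    (hca : G c a) : False := by
  have h1 : a ≠ b := fun e => W.loopless _ (e ▸ hab)
  have h2 : b ≠ c := fun e => W.loopless _ (e ▸ hbc)
  have h3 : c ≠ a := fun e => W.loopless _ (e ▸ hca)
  refine W.no_short_cycle {a, b, c} (by simp) (card_le_three.trans (by norm_num)) ?_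
  simp only [mem_insert, mem_singleton, forall_eq_or_imp, forall_eq]
  exact ⟨⟨b, by simp, c, by simp, h2, hab, W.symm hca⟩, ⟨a, by simp, c, by simp, h3.symm,
    W.symm hab, hbc⟩, ⟨a, by simp, b, by simp, h1, hca, W.symm hbc⟩⟩

theorem no_four_cycle (W : WheelCycle m G v x) {a b c d : V} (hab : G a b) (hbc : G b c)
    (hcd : G c d) (hda : G d a) (hac : a ≠ c) (hbd : b ≠ d) : False := by
  refine W.no_short_cycle {a, b, c, d} (by simp) (card_le_four.trans (by norm_num)) ?_
  simp only [mem_insert, mem_singleton, forall_eq_or_imp, forall_eq]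
  exact ⟨⟨b, by simp, d, by simp, hbd, hab, W.symm hda⟩, ⟨a, by simp, c, by simp, hac,
    W.symm hab, hbc⟩, ⟨b, by simp, d, by simp, hbd, W.symm hbc, hcd⟩,
    ⟨a, by simp, c, by simp, hac, hda, W.symm hcd⟩⟩

theorem no_six_cycle (W : WheelCycle m G v x) {a b c d e f : V} (hab : G a b) (hbc : G b c)
    (hcd : G c d) (hde : G d e) (hef : G e f) (hfa : G f a) (hac : a ≠ c) (hbd : b ≠ d)
    (hce : c ≠ e) (hdf : d ≠ f) (hea : e ≠ a) (hfb : f ≠ b) : False := by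
  refine W.no_short_cycle {a, b, c, d, e, f} (by simp) card_le_six ?_
  simp only [mem_insert, mem_singleton, forall_eq_or_imp, forall_eq]
  exact ⟨⟨b, by simp, f, by simp, hfb.symm, hab, W.symm hfa⟩, ⟨a, by simp, c, by simp, hac,
    W.symm hab, hbc⟩, ⟨b, by simp, d, by simp, hbd, W.symm hbc, hcd⟩,
    ⟨c, by simp, e, by simp, hce, W.symm hcd, hde⟩, ⟨d, by simp, f, by simp, hdf,
    W.symm hde, hef⟩, ⟨a, by simp, e, by simp, hea.symm, hfa, W.symm hef⟩⟩

/-- The boundary edge at `k` is cut off by a diagonal joining two vertices at distance two. -/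
def Ear (G : V → V → Prop) (v : ℤ → V) (k : ℤ) : Prop :=
  G (v k) (v (k + 1)) ∧ (G (v k) (v (k + 2)) ∨ G (v (k - 1)) (v (k + 1)))

/-- The arc cut off by a diagonal away from the center contains an ear or two adjacent
boundary edges. -/
theorem exists_ear_or_adjacent (W : WheelCycle m G v x) (i j : ℤ) (hE : G (v i) (v j))
    (hij : i + 2 ≤ j) (hm : 2 * (j - i) < m) :
    (∃ k, i ≤ k ∧ k < j ∧ Ear G v k) ∨
      ∃ y, i < y ∧ y < j ∧ G (v (y - 1)) (v y) ∧ G (v y) (v (y + 1)) := by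
  induction hn : (j - i).toNat using Nat.strong_induction_on generalizing i j with
  | _ n ih =>
  by_cases hs : ∃ a b, i ≤ a ∧ a + 2 ≤ b ∧ b ≤ j ∧ b - a < j - i ∧ G (v a) (v b)
  · obtain ⟨a, b, h1, h2, h3, h4, h5⟩ := hs
    rcases ih _ (by omega) a b h5 h2 (by omega) rfl with ⟨k, h6, h7, h8⟩ | ⟨y, h6, h7, h8⟩
    · exact Or.inl ⟨k, by omega, by omega, h8⟩
    · exact Or.inr ⟨y, by omega, by omega, h8⟩
  push Not at hs
  have key : ∀ a, i < a → a < j → ∀ c, G (v a) c →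
      (∀ t, i ≤ t → t ≤ j → c ≠ v t) ∨ c = v (a - 1) ∨ c = v (a + 1) := by
    intro a h1 h2 c hc
    by_cases hl : ∀ t, i ≤ t → t ≤ j → c ≠ v t
    · exact Or.inl hl
    push Not at hl
    obtain ⟨t, h3, h4, rfl⟩ := hl
    right
    rcases lt_trichotomy a t with h | h | h
    · by_cases h5 : t = a + 1
      · simp [h5]
      · exact absurd hc (hs a t (by omega) (by omega) h4 (by omega))
    · exact absurd hc (h ▸ W.loopless _)
    · by_cases h5 : t = a - 1
      · simp [h5]
      · exact absurd (W.symm hc) (hs t a (by omega) (by omega) (by omega) (by omega))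
  by_cases h2 : j = i + 2
  · subst h2
    have hear : G (v (i + 1)) (v i) ∨ G (v (i + 1)) (v (i + 2)) := by
      obtain ⟨c, hc, -⟩ := W.deg_ge (v (i + 1)) x
      obtain ⟨d, hd, hdc⟩ := W.deg_ge (v (i + 1)) c
      rcases key _ (by omega) (by omega) c hc with h | rfl | rfl
      · rcases key _ (by omega) (by omega) d hd with h' | rfl | rfl
        · exact absurd (W.cross_chord hm hE (by omega) (by omega) (by omega) (by omega)
            h' h hd hc).2 hdc
        · left; simpa using hd
        · right; convert hd using 2; ring
      · left; simpa using hc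
      · right; convert hc using 2; ring
    left
    rcases hear with h | h
    · exact ⟨i, by omega, by omega, W.symm h, Or.inl hE⟩
    · refine ⟨i + 1, by omega, by omega, ?_, Or.inr ?_⟩
      · convert h using 2; ring
      · convert hE using 2 <;> ring
  · right
    have hex : ∃ a, i < a ∧ a < j ∧ ∀ c, G (v a) c → c = v (a - 1) ∨ c = v (a + 1) := by
      by_contra! hno
      obtain ⟨c, hc, hc1, hc2⟩ := hno (i + 1) (by omega) (by omega)
      obtain ⟨d, hd, hd1, hd2⟩ := hno (i + 2) (by omega) (by omega)
      have l1 := (key _ (by omega) (by omega) c hc).resolve_right (by tauto)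
      have l2 := (key _ (by omega) (by omega) d hd).resolve_right (by tauto)
      have := W.cross_chord hm hE (by omega) (by omega) (by omega) (by omega) l1 l2 hc hd
      omega
    obtain ⟨a, h3, h4, h5⟩ := hex
    refine ⟨a, h3, h4, ?_, ?_⟩
    · obtain ⟨c, hc, hne⟩ := W.deg_ge (v a) (v (a + 1))
      rcases h5 c hc with rfl | rfl
      · exact W.symm hc
      · exact absurd rfl hne
    · obtain ⟨c, hc, hne⟩ := W.deg_ge (v a) (v (a - 1))
      rcases h5 c hc with rfl | rfl
      · exact absurd rfl hne
      · exact hc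

/-- If every diagonal outside an exceptional set cuts off an arc containing the boundary edge
at `s`, then the rim neighbours of each vertex are restricted accordingly. -/
theorem rim_nbr_cases (W : WheelCycle m G v x) (hmh : m = 2 * h + 1) {s : ℤ}
    {P : ℤ → ℤ → Prop}
    (H : ∀ i j, s < i → i ≤ s + m → i + 2 ≤ j → 2 * (j - i) < m → G (v i) (v j) →
      P i j ∨ s + m + 1 ≤ j)
    {y j : ℤ} (hy : s < y) (hy' : y ≤ s + m) (h1 : y < j) (h2 : j < y + m)
    (hG : G (v y) (v j)) :
    P y j ∨ P (j - m) y ∨ j = y + 1 ∨ j = y + m - 1 ∨ (s + m < j ∧ j ≤ y + h) ∨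
      (y + h < j ∧ j ≤ s + m) := by
  by_cases h3 : j = y + 1
  · simp [h3]
  by_cases h4 : j = y + m - 1
  · simp [h4]
  rcases le_or_gt j (y + h) with h5 | h5
  · rcases H y j hy hy' (by omega) (by omega) hG with h6 | h6
    · exact Or.inl h6
    · omega
  · rcases le_or_gt j (s + m) with h6 | h6
    · omega
    · rcases H (j - m) y (by omega) (by omega) (by omega) (by omega)
        (by rw [W.rim_sub]; exact W.symm hG) with h7 | h7
      · exact Or.inr (Or.inl h7)
      · omega

/-- `s` and `k` are the only indices of boundary edges in a window of length `m`. -/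
structure TwoBoundary (m : ℤ) (G : V → V → Prop) (v : ℤ → V) (s k : ℤ) : Prop where
  left : G (v s) (v (s + 1))
  right : G (v k) (v (k + 1))
  lt : s < k
  lt_add : k < s + m
  eq : ∀ i, s < i → i < s + m → G (v i) (v (i + 1)) → i = k

theorem TwoBoundary.reflect {s k : ℤ} (W : WheelCycle m G v x) (B : TwoBoundary m G v s k) :
    TwoBoundary m G (fun i => v (-i)) (-(s + 1)) (m - (k + 1)) where
  left := by
    have := W.symm B.left
    simpa using this
  right := by
    have := W.symm B.right
    rw [← W.rim_sub k, ← W.rim_sub (k + 1)] at this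
    convert this using 2 <;> ring
  lt := by have := B.lt_add; omega
  lt_add := by have := B.lt; omega
  eq i h1 h2 h3 := by
    have := B.eq (m - 1 - i) (by omega) (by omega) (by
      rw [← W.rim_sub, ← W.rim_sub (m - 1 - i + 1)]
      convert W.symm h3 using 2 <;> ring)
    omega

/-- With exactly two boundary edges, each of them is an ear. -/
theorem ear_of_twoBoundary (W : WheelCycle m G v x) (hmh : m = 2 * h + 1) (hh : 3 ≤ h) {s k : ℤ}
    (B : TwoBoundary m G v s k) : Ear G v k := by
  by_contra hear
  obtain ⟨hs, hk, hsk, hks, huniq⟩ := B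
  have hm : 0 < m := by omega
  have H : ∀ i j, s < i → i ≤ s + m → i + 2 ≤ j → 2 * (j - i) < m → G (v i) (v j) →
      (fun _ _ => False : ℤ → ℤ → Prop) i j ∨ s + m + 1 ≤ j := by
    intro i j h1 h2 h3 h4 h5
    right
    by_contra! h6
    rcases W.exists_ear_or_adjacent i j h5 h3 h4 with ⟨t, h7, h8, h9⟩ | ⟨y, h7, h8, h9, h10⟩
    · exact hear (huniq t (by omega) (by omega) h9.1 ▸ h9)
    · have e1 := huniq y (by omega) (by omega) h10
      have e2 := huniq (y - 1) (by omega) (by omega) (by simpa using h9)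
      omega
  have N : ∀ y j, s < y → y < s + m → y < j → j < y + m → G (v y) (v j) →
      (j = y + 1 ∧ y = k) ∨ (j = y + m - 1 ∧ y = s + 1) ∨ (j = y + m - 1 ∧ y = k + 1) ∨
      (s + m < j ∧ j ≤ y + h) ∨ (y + h < j ∧ j ≤ s + m) := by
    intro y j h1 h2 h3 h4 h5
    rcases W.rim_nbr_cases hmh H h1 h2.le h3 h4 h5 with h6 | h6 | h6 | h6 | h6 | h6
    · exact h6.elim
    · exact h6.elim
    · subst h6
      exact Or.inl ⟨rfl, huniq y (by omega) (by omega) h5⟩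
    · by_cases h7 : y = s + 1
      · exact Or.inr (Or.inl ⟨h6, h7⟩)
      · have := huniq (y - 1) (by omega) (by omega) (by
          have := W.symm h5
          rw [h6, ← W.rim_sub] at this
          convert this using 2 <;> ring)
        omega
    · omega
    · omega
  have hsm : G (v (s + m)) (v (s + m + 1)) := by
    rw [show s + m + 1 = s + 1 + m by ring, W.rim_add, W.rim_add]; exact hs
  -- the vertex opposite to the edge at `s`
  have hp : G (v (s + h + 1)) x ∧ (k = s + h + 1 ∨ k = s + h) := by
    obtain ⟨c, hc, hcx⟩ := W.deg_ge (v (s + h + 1)) x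
    obtain ⟨j, h1, h2, rfl⟩ := (W.adj_cases hm hc).resolve_left hcx
    have e1 := N _ j (by omega) (by omega) h1 h2 hc
    obtain ⟨d, hd, hdc⟩ := W.deg_ge (v (s + h + 1)) (v j)
    rcases W.adj_cases hm hd with rfl | ⟨j', h3, h4, rfl⟩
    · exact ⟨hd, by omega⟩
    · have e2 := N _ j' (by omega) (by omega) h3 h4 hd
      exact absurd (congrArg v (show j' = j by omega)) hdc
  obtain ⟨hpx, hkp⟩ := hp
  have hnext : ∀ c, G (v (s + h + 2)) c → c = x ∨ c = v (s + m + 1) ∨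
      (c = v (s + h + 1) ∧ k = s + h + 1) := by
    intro c hc
    rcases W.adj_cases hm hc with rfl | ⟨j, h1, h2, rfl⟩
    · exact Or.inl rfl
    · rcases N _ j (by omega) (by omega) h1 h2 hc with e | e | e | e | e
      · omega
      · omega
      · right; right
        refine ⟨?_, by omega⟩
        rw [e.1, ← W.rim_add (s + h + 1)]; congr 1; ring
      · right; left; congr 1; omega
      · omega
  have hprev : ∀ c, G (v (s + h)) c → c = x ∨ c = v (s + m) ∨
      (c = v (s + h + 1) ∧ k = s + h) := by
    intro c hc
    rcases W.adj_cases hm hc with rfl | ⟨j, h1, h2, rfl⟩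
    · exact Or.inl rfl
    · rcases N _ j (by omega) (by omega) h1 h2 hc with e | e | e | e | e
      · exact Or.inr (Or.inr ⟨by rw [e.1], by omega⟩)
      · omega
      · omega
      · omega
      · right; left; congr 1; omega
  have ne : ∀ i j, i < j → j < i + m → v i ≠ v j := fun i j h1 h2 e => by
    have := W.rim_inj e (by omega) (by omega); omega
  rcases hkp with rfl | rfl
  · have e2 : G (v (s + h + 1)) (v (s + h + 2)) := by
      convert hk using 2; ring
    have e3 : G (v (s + h + 2)) (v (s + m + 1)) := by
      obtain ⟨c, hc, hne⟩ := W.deg_ge (v (s + h + 2)) (v (s + h + 1))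
      rcases hnext c hc with rfl | rfl | ⟨rfl, -⟩
      · exact (W.no_triangle e2 hc (W.symm hpx)).elim
      · exact hc
      · exact absurd rfl hne
    have e4 : G (v (s + h)) x := by
      obtain ⟨c, hc, hne⟩ := W.deg_ge (v (s + h)) (v (s + m))
      rcases hprev c hc with rfl | rfl | ⟨-, e⟩
      · exact hc
      · exact absurd rfl hne
      · omega
    have e5 : G (v (s + h)) (v (s + m)) := by
      obtain ⟨c, hc, hne⟩ := W.deg_ge (v (s + h)) x
      rcases hprev c hc with rfl | rfl | ⟨-, e⟩
      · exact absurd rfl hne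
      · exact hc
      · omega
    exact W.no_six_cycle (W.symm e4) e5 hsm (W.symm e3) (W.symm e2) hpx (W.rim_ne _).symm
      (ne _ _ (by omega) (by omega)) (ne _ _ (by omega) (by omega)).symm
      (ne _ _ (by omega) (by omega)).symm (W.rim_ne _) (ne _ _ (by omega) (by omega)).symm
  · have e2 : G (v (s + h)) (v (s + h + 1)) := hk
    have e3 : G (v (s + h)) (v (s + m)) := by
      obtain ⟨c, hc, hne⟩ := W.deg_ge (v (s + h)) (v (s + h + 1))
      rcases hprev c hc with rfl | rfl | ⟨rfl, -⟩
      · exact (W.no_triangle e2 hpx (W.symm hc)).elim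
      · exact hc
      · exact absurd rfl hne
    have e4 : G (v (s + h + 2)) x := by
      obtain ⟨c, hc, hne⟩ := W.deg_ge (v (s + h + 2)) (v (s + m + 1))
      rcases hnext c hc with rfl | rfl | ⟨-, e⟩
      · exact hc
      · exact absurd rfl hne
      · omega
    have e5 : G (v (s + h + 2)) (v (s + m + 1)) := by
      obtain ⟨c, hc, hne⟩ := W.deg_ge (v (s + h + 2)) x
      rcases hnext c hc with rfl | rfl | ⟨-, e⟩
      · exact absurd rfl hne
      · exact hc
      · omega
    exact W.no_six_cycle (W.symm hpx) (W.symm e2) e3 hsm (W.symm e5) e4 (W.rim_ne _).symm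
      (ne _ _ (by omega) (by omega)) (ne _ _ (by omega) (by omega))
      (ne _ _ (by omega) (by omega)).symm (W.rim_ne _) (ne _ _ (by omega) (by omega)).symm

/-- An ear at `k` with `v k` adjacent to `v (k + 2)` does not have `v (k + 1)` joined to
the center. -/
theorem not_spoke_of_ear (W : WheelCycle m G v x) (hmh : m = 2 * h + 1) (hh : 3 ≤ h) {s k : ℤ}
    (B : TwoBoundary m G v s k) (hE : G (v k) (v (k + 2))) : ¬ G (v (k + 1)) x := by
  intro hx
  obtain ⟨hs, hk, hsk, hks, huniq⟩ := B
  have hm : 0 < m := by omega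
  have H : ∀ i j, s < i → i ≤ s + m → i + 2 ≤ j → 2 * (j - i) < m → G (v i) (v j) →
      (fun i j => i = k ∧ j = k + 2 : ℤ → ℤ → Prop) i j ∨ s + m + 1 ≤ j := by
    intro i j h1 h2 h3 h4 h5
    by_contra h6
    obtain ⟨h0, h6⟩ := not_or.1 h6
    rcases W.exists_ear_or_adjacent i j h5 h3 h4 with ⟨t, h7, h8, h9⟩ | ⟨y, h7, h8, h9, h10⟩
    · obtain rfl := huniq t (by omega) (by omega) h9.1
      by_cases h10 : t + 1 = j
      · subst h10
        exact W.not_spoke_of_two_rim (W.symm h5) (W.symm hk) hx (by omega) (by omega)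
      · exact h0 (W.cross_spoke h4 (by omega) h5 hE (W.symm hx) (by omega) (by omega) (by omega)
          (by omega))
    · have e1 := huniq y (by omega) (by omega) h10
      have e2 := huniq (y - 1) (by omega) (by omega) (by simpa using h9)
      omega
  have N : ∀ y j, s < y → y < s + m → y < j → j < y + m → G (v y) (v j) →
      (y = k ∧ j = k + 2) ∨ (y = k + 2 ∧ j = k + m) ∨
      (j = y + 1 ∧ y = k) ∨ (j = y + m - 1 ∧ y = s + 1) ∨ (j = y + m - 1 ∧ y = k + 1) ∨
      (s + m < j ∧ j ≤ y + h) ∨ (y + h < j ∧ j ≤ s + m) := by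
    intro y j h1 h2 h3 h4 h5
    rcases W.rim_nbr_cases hmh H h1 h2.le h3 h4 h5 with h6 | h6 | h6 | h6 | h6 | h6
    · omega
    · omega
    · subst h6
      have := huniq y (by omega) (by omega) h5
      omega
    · by_cases h7 : y = s + 1
      · omega
      · have := huniq (y - 1) (by omega) (by omega) (by
          have := W.symm h5
          rw [h6, ← W.rim_sub] at this
          convert this using 2 <;> ring)
        omega
    · omega
    · omega
  have hsm : G (v (s + m + 1)) (v (s + m)) := by
    rw [show s + m + 1 = s + 1 + m by ring, W.rim_add, W.rim_add]; exact W.symm hs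
  have hkm : v (k + m) = v k := W.rim_add k
  have hkp : k = s + h + 1 ∨ k = s + h := by
    obtain ⟨c, hc, hcx⟩ := W.deg_ge (v (s + h + 1)) x
    obtain ⟨j, h1, h2, rfl⟩ := (W.adj_cases hm hc).resolve_left hcx
    have e1 := N _ j (by omega) (by omega) h1 h2 hc
    by_cases hk2 : k + 2 = s + h + 1
    · obtain rfl : j = k + m := by omega
      obtain ⟨d, hd, hdc⟩ := W.deg_ge (v (s + h + 1)) (v (k + m))
      rcases W.adj_cases hm hd with rfl | ⟨j', h3, h4, rfl⟩
      · rw [← hk2] at hd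
        refine (W.no_four_cycle (W.symm hx) (W.symm hk) hE hd (W.rim_ne _).symm fun e => ?_).elim
        have := W.rim_inj e (by omega) (by omega)
        omega
      · have e2 := N _ j' (by omega) (by omega) h3 h4 hd
        exact absurd (congrArg v (show j' = k + m by omega)) hdc
    · omega
  rcases hkp with rfl | rfl
  · have hprev : ∀ c, G (v (s + h)) c → c = x ∨ c = v (s + m) := by
      intro c hc
      rcases W.adj_cases hm hc with rfl | ⟨j, h1, h2, rfl⟩
      · exact Or.inl rfl
      · have := N _ j (by omega) (by omega) h1 h2 hc
        right; congr 1; omega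
    have e1 : G (v (s + h)) x := by
      obtain ⟨c, hc, hne⟩ := W.deg_ge (v (s + h)) (v (s + m))
      exact (hprev c hc).resolve_right hne ▸ hc
    have e2 : G (v (s + h)) (v (s + m)) := by
      obtain ⟨c, hc, hne⟩ := W.deg_ge (v (s + h)) x
      exact (hprev c hc).resolve_left hne ▸ hc
    obtain ⟨c, hc, hne⟩ := W.deg_ge (v (s + h - 1)) (v (s + 2 * h))
    rcases W.adj_cases hm hc with rfl | ⟨j, h1, h2, rfl⟩
    · exact W.not_three_rim (W.symm hc) (W.symm e1) (W.symm hx) (by omega) (by omega) (by omega)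
    · have := N _ j (by omega) (by omega) h1 h2 hc
      have hj : j ≠ s + 2 * h := fun e => hne (congrArg v e)
      obtain rfl : j = s + m := by omega
      exact W.not_three_rim (W.symm hc) (W.symm e2) (W.symm hsm) (by omega) (by omega) (by omega)
  · have e1 : G (v (s + h + 2)) (v (s + m + 1)) := by
      obtain ⟨c, hc, hne⟩ := W.deg_ge (v (s + h + 2)) (v (s + h))
      rcases W.adj_cases hm hc with rfl | ⟨j, h1, h2, rfl⟩
      · refine (W.no_four_cycle (W.symm hx) (W.symm hk) hE hc (W.rim_ne _).symm fun e => ?_).elim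
        have := W.rim_inj e (by omega) (by omega)
        omega
      · have := N _ j (by omega) (by omega) h1 h2 hc
        have hj : j ≠ s + h + m := fun e => hne (e ▸ hkm)
        obtain rfl : j = s + m + 1 := by omega
        exact hc
    have hnext : ∀ c, G (v (s + h + 3)) c → c = x ∨ c = v (s + m + 2) := by
      intro c hc
      rcases W.adj_cases hm hc with rfl | ⟨j, h1, h2, rfl⟩
      · exact Or.inl rfl
      · have := N _ j (by omega) (by omega) h1 h2 hc
        by_cases hj : j = s + m + 1
        · subst hj
          exact (W.not_three_rim (W.symm e1) (W.symm hc) hsm (by omega) (by omega)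
            (by omega)).elim
        · right; congr 1; omega
    have e2 : G (v (s + h + 3)) x := by
      obtain ⟨c, hc, hne⟩ := W.deg_ge (v (s + h + 3)) (v (s + m + 2))
      exact (hnext c hc).resolve_right hne ▸ hc
    have e3 : G (v (s + h + 3)) (v (s + m + 2)) := by
      obtain ⟨c, hc, hne⟩ := W.deg_ge (v (s + h + 3)) x
      exact (hnext c hc).resolve_left hne ▸ hc
    refine W.rim_ne _ (W.cross_chord (by omega) e1 (by omega) (by omega) (by omega) (by omega)
      (fun t _ _ => (W.rim_ne t).symm) (fun t h1 h2 e => ?_) e2 e3).2.symm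
    have := W.rim_inj e (by omega) (by omega)
    omega

/-- In an ear with `v k` adjacent to `v (k + 2)`, the vertex `v (k + 1)` is adjacent to
`v (k - 1)`. -/
theorem adj_of_ear (W : WheelCycle m G v x) (hmh : m = 2 * h + 1) (hh : 3 ≤ h) {s k : ℤ}
    (B : TwoBoundary m G v s k) (hE : G (v k) (v (k + 2))) : G (v (k + 1)) (v (k - 1)) := by
  have hx := W.not_spoke_of_ear hmh hh B hE
  have hk := B.right
  have hm : 0 < m := by omega
  obtain ⟨c, hf, hck⟩ := W.deg_ge (v (k + 1)) (v k)
  rcases W.adj_cases hm hf with rfl | ⟨b, h1, h2, rfl⟩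
  · exact absurd hf hx
  have hbk : b ≠ k + m := fun e => hck (e ▸ W.rim_add k)
  by_cases hb : b = k + m - 1
  · rw [hb, show k + m - 1 = k - 1 + m by ring, W.rim_add] at hf
    exact hf
  by_cases hb2 : b = k + 2
  · subst hb2
    exact (W.no_triangle hk hf (W.symm hE)).elim
  exfalso
  have full : ∀ t ≠ v (k + 1), t ≠ v (k + 2) → ¬ G t (v k) := fun t n1 n2 hG => by
    rcases W.deg_le hk hE (W.symm hG) with e | e | e
    · have := W.rim_inj e (by omega) (by omega); omega
    · exact n1 e.symm
    · exact n2 e.symm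
  have full' : ∀ t ≠ v k, t ≠ v b → ¬ G t (v (k + 1)) := fun t n1 n2 hG => by
    rcases W.deg_le (W.symm hk) hf (W.symm hG) with e | e | e
    · exact hck e.symm
    · exact n1 e.symm
    · exact n2 e.symm
  -- the vertices other than `v k` on the side of the edge `v (k + 1) v b` containing `v k`
  let T : Set V := {u | (∃ t, b < t ∧ t < k + m ∧ u = v t) ∨ (u = x ∧ 2 * (b - (k + 1)) < m)}
  have hne : ∀ i j, v i = v j → i < j → j < i + m → False := fun i j e h1 h2 => by
    have := W.rim_inj e (by omega) (by omega); omega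
  have hTne : ∀ u ∈ T, ∀ t, k ≤ t → t ≤ b → u ≠ v t := by
    rintro u (⟨t, h3, h4, rfl⟩ | ⟨rfl, -⟩) t' h5 h6 e
    · by_cases h7 : t' = k
      · subst h7
        rw [← W.rim_add t'] at e
        exact hne _ _ e (by omega) (by omega)
      · exact hne _ _ e.symm (by omega) (by omega)
    · exact W.rim_ne _ e.symm
  refine W.no_cut T (v b) ⟨v (k + m - 1), Or.inl ⟨_, by omega, by omega, rfl⟩⟩
    ⟨v (k + 2), fun hT => hTne _ hT (k + 2) (by omega) (by omega) rfl,
      fun e => hne _ _ e (by omega) (by omega)⟩ fun t ht u hG => ?_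
  by_contra! hu
  obtain ⟨huT, hub⟩ := hu
  have htk := hTne t ht
  have huk : u ≠ v k := by
    rintro rfl
    exact full t (htk _ (by omega) (by omega)) (htk _ (by omega) (by omega)) hG
  have huk' : u ≠ v (k + 1) := by
    rintro rfl
    exact full' t (htk _ (by omega) (by omega)) (htk _ (by omega) (by omega)) hG
  rcases lt_or_ge (2 * (b - (k + 1))) m with hc | hc
  · obtain ⟨a, h3, h4, rfl⟩ : ∃ a, k + 1 < a ∧ a < b ∧ u = v a := by
      rcases W.cover u with rfl | ⟨i, rfl⟩
      · exact absurd (Or.inr ⟨rfl, hc⟩) huT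
      · obtain ⟨j, h5, h6, h7⟩ := W.exists_rim_window hm k i
        rw [h7] at huT hub huk huk' ⊢
        refine ⟨j, ?_, ?_, rfl⟩
        · have : j ≠ k := fun e => huk (congrArg v e)
          have : j ≠ k + 1 := fun e => huk' (congrArg v e)
          omega
        · by_contra h8
          have : j ≠ b := fun e => hub (congrArg v e)
          exact huT (Or.inl ⟨j, by omega, by omega, rfl⟩)
    have := (W.cross_chord hc hf (a := k + 2) (a' := a) (by omega) (by omega) h3 h4
      (fun t' h5 h6 e => hne _ _ e (by omega) (by omega))
      (fun t' h5 h6 => htk t' (by omega) h6) (W.symm hE) (W.symm hG)).2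
    exact htk k (by omega) (by omega) this.symm
  · obtain ⟨t, h3, h4, rfl⟩ := ht.resolve_right fun e => by omega
    have hf' : G (v (b - m)) (v (k + 1)) := by rw [W.rim_sub]; exact W.symm hf
    have hG' : G (v (t - m)) u := by rw [W.rim_sub]; exact hG
    have := (W.cross_chord (by omega) hf' (a := k) (a' := t - m) (by omega) (by omega)
      (by omega) (by omega) (c := v (k + 2)) (c' := u)
      (fun t' h5 h6 e => ?_) (fun t' h5 h6 e => ?_) hE hG').1
    · omega
    · exact hne _ _ e.symm (by omega) (by omega)
    · subst e
      by_cases h7 : t' = b - m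
      · subst h7; exact hub (W.rim_sub b)
      · by_cases h8 : t' < k
        · exact huT (Or.inl ⟨t' + m, by omega, by omega, (W.rim_add t').symm⟩)
        · by_cases h9 : t' = k
          · exact huk (congrArg v h9)
          · exact huk' (congrArg v (show t' = k + 1 by omega))

/-- With exactly two boundary edges, both diagonals at distance two through a boundary edge
are edges of the cycle. -/
theorem adj_of_twoBoundary (W : WheelCycle m G v x) (hmh : m = 2 * h + 1) (hh : 3 ≤ h) {s k : ℤ}
    (B : TwoBoundary m G v s k) : G (v k) (v (k + 2)) ∧ G (v (k + 1)) (v (k - 1)) := by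
  rcases (W.ear_of_twoBoundary hmh hh B).2 with hE | hE
  · exact ⟨hE, W.adj_of_ear hmh hh B hE⟩
  · refine ⟨?_, W.symm hE⟩
    have := W.reflect.adj_of_ear hmh hh (B.reflect W) (by
      have := W.symm hE
      rw [← W.rim_sub, ← W.rim_sub (k - 1)] at this
      convert this using 2 <;> ring)
    rw [← W.rim_sub, ← W.rim_sub (k + 2)]
    convert this using 2 <;> ring

end WheelCycle

theorem rim_eq_iff {m : ℕ} [NeZero m] (i j : ℤ) : rim m i = rim m j ↔ (m : ℤ) ∣ i - j :=
  (Fin.castSucc_injective m).eq_iff.trans (residue_eq_iff i j)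

theorem rim_ne_last {m : ℕ} [NeZero m] (i : ℤ) : rim m i ≠ Fin.last m :=
  Fin.castSucc_ne_last _

theorem eq_last_or_eq_rim {m : ℕ} [NeZero m] (u : Fin (m + 1)) :
    u = Fin.last m ∨ ∃ i, u = rim m i := by
  induction u using Fin.lastCases with
  | last => exact Or.inl rfl
  | cast k => exact Or.inr ⟨k, by rw [rim, residue_natCast]⟩

theorem rim_ne_of_lt {m : ℕ} [NeZero m] {i j : ℤ} (h1 : i < j) (h2 : j < i + m) :
    rim m i ≠ rim m j := by
  rw [Ne, rim_eq_iff, dvd_sub_comm]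
  intro h
  have := Int.le_of_dvd (by omega) h
  omega

/-- A vertex outside an arc is the center or a rim vertex of the complementary arc. -/
theorem eq_last_or_eq_rim_of_notMem_arc {m : ℕ} [NeZero m] {i j : ℤ} {c : Fin (m + 1)}
    (hc : ∀ t, i ≤ t → t ≤ j → c ≠ rim m t) :
    c = Fin.last m ∨ ∃ b, j < b ∧ b < i + m ∧ c = rim m b := by
  have hm : (0 : ℤ) < m := by exact_mod_cast Nat.pos_of_neZero m
  refine (eq_last_or_eq_rim c).imp_right ?_
  rintro ⟨k, rfl⟩
  have h1 := Int.emod_nonneg (k - i) hm.ne'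
  have h2 := Int.emod_lt_of_pos (k - i) hm
  have e : rim m k = rim m (i + (k - i) % m) := by
    rw [rim_eq_iff]
    refine ⟨(k - i) / m, ?_⟩
    have := Int.emod_add_mul_ediv (k - i) m
    linarith
  refine ⟨_, ?_, by omega, e⟩
  by_contra h
  exact hc _ (by omega) (by omega) e

theorem IsOnePlaneHC.wheelCycle {m : ℕ} [NeZero m] (hn : 8 ≤ m + 1) {w : Fin m → Pt} {x : Pt}
    (hw : IsRegularWheel w x) {σ : Equiv.Perm (Fin (m + 1))}
    (hC : IsOnePlaneHC (wheelPts w x) σ) :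
    WheelCycle (m : ℤ) (fun a b => s(a, b) ∈ cycEdges σ) (rim m) (Fin.last m) where
  symm h := Sym2.eq_swap ▸ h
  rim_eq := rim_eq_iff
  rim_ne := rim_ne_last
  cover := eq_last_or_eq_rim
  loopless u h := by
    have hne : σ u ≠ u := Equiv.Perm.mem_support.1 (hC.1.2 ▸ Finset.mem_univ u)
    rcases (IsHamCycle.mem_cycEdges u u).1 h with e | e
    · exact hne e.symm
    · exact hne (Equiv.Perm.eq_inv_iff_eq.1 e)
  deg_le ha hb hc := by
    rw [IsHamCycle.mem_cycEdges] at ha hb hc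
    grind
  deg_ge u y := by
    by_cases h : σ u = y
    · exact ⟨σ⁻¹ u, (IsHamCycle.mem_cycEdges _ _).2 (Or.inr rfl),
        fun e => hC.1.ne_inv (by omega) u (h.trans e.symm)⟩
    · exact ⟨σ u, (IsHamCycle.mem_cycEdges _ _).2 (Or.inl rfl), h⟩
  no_short_cycle S hS hcard h := by
    have huniv := hC.1.eq_univ_of_mapsTo (S := (S : Set (Fin (m + 1)))) hS fun u hu => by
      obtain ⟨a, ha, b, hb, hab, hua, hub⟩ := h u hu
      rw [IsHamCycle.mem_cycEdges] at hua hub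
      rw [Finset.mem_coe]
      grind
    have h1 := Finset.card_le_card (fun y _ => huniv y : (Finset.univ : Finset _) ⊆ S)
    rw [Finset.card_univ, Fintype.card_fin] at h1
    omega
  no_cut T b hT hu := hC.1.not_cut hT hu
  cross_chord {i j a a' c c'} hij hE h1 h2 h3 h4 hc hc' hac hac' := by
    have hne : ∀ t, i < t → t < j → rim m i ≠ rim m t ∧ rim m j ≠ rim m t := fun t h h' =>
      ⟨rim_ne_of_lt h (by omega), (rim_ne_of_lt h' (by omega)).symm⟩
    have e := hC.eq_of_inter hE hac hac'
      ⟨(hne a h1 h2).1, (hc i le_rfl (by omega)).symm, (hne a h1 h2).2,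
        (hc j (by omega) le_rfl).symm⟩
      ⟨(hne a' h3 h4).1, (hc' i le_rfl (by omega)).symm, (hne a' h3 h4).2,
        (hc' j (by omega) le_rfl).symm⟩
      (chord_inter hw hij h1 h2 (eq_last_or_eq_rim_of_notMem_arc hc))
      (chord_inter hw hij h3 h4 (eq_last_or_eq_rim_of_notMem_arc hc'))
    rcases Sym2.eq_iff.1 e with ⟨e1, e2⟩ | ⟨e1, -⟩
    · refine ⟨?_, e2⟩
      rcases lt_trichotomy a a' with h | h | h
      · exact absurd e1 (rim_ne_of_lt h (by omega))
      · exact h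
      · exact absurd e1.symm (rim_ne_of_lt h (by omega))
    · exact absurd e1.symm (hc' a h1.le h2.le)
  cross_spoke {i j i' j' a} hij hij' hE hE' hx h1 h2 h3 h4 := by
    have e := hC.eq_of_inter hx hE hE'
      ⟨(rim_ne_last _).symm, (rim_ne_last _).symm, (rim_ne_of_lt h1 (by omega)).symm,
        rim_ne_of_lt h2 (by omega)⟩
      ⟨(rim_ne_last _).symm, (rim_ne_last _).symm, (rim_ne_of_lt h3 (by omega)).symm,
        rim_ne_of_lt h4 (by omega)⟩
      (by rw [openSegment_symm, Set.inter_comm]; exact chord_inter hw hij h1 h2 (Or.inl rfl))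
      (by rw [openSegment_symm, Set.inter_comm]; exact chord_inter hw hij' h3 h4 (Or.inl rfl))
    have inj : ∀ b b', rim m b = rim m b' → b < b' + m → b' < b + m → b = b' := by
      intro b b' e h5 h6
      rcases lt_trichotomy b b' with h | h | h
      · exact absurd e (rim_ne_of_lt h h6)
      · exact h
      · exact absurd e.symm (rim_ne_of_lt h h5)
    rcases Sym2.eq_iff.1 e with ⟨e1, e2⟩ | ⟨e1, -⟩
    · exact ⟨inj _ _ e1 (by omega) (by omega), inj _ _ e2 (by omega) (by omega)⟩
    · exact absurd e1 (rim_ne_of_lt (by omega) (by omega))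

/-- if a 1-plane Hamiltonian cycle on `n = m + 1 ≥ 8` points in
regular wheel configuration (`n` even) has exactly the two boundary edges
`v_r v_{r+1}` and `v_s v_{s+1}` (`r ≠ s`), then for each `k ∈ {r, s}` both
`v_k v_{k+2}` and `v_{k+1} v_{k-1}` are edges of the cycle. -/
theorem stmt12 {m : ℕ} [NeZero m] (hn : 8 ≤ m + 1) (heven : Even (m + 1))
    (w : Fin m → Pt) (x : Pt) (hw : IsRegularWheel w x)
    (σ : Equiv.Perm (Fin (m + 1))) (hC : IsOnePlaneHC (wheelPts w x) σ)
    (r s : Fin m) (hrs : r ≠ s)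
    (hbd : ∀ k : Fin m, s(k.castSucc, (k + 1).castSucc) ∈ cycEdges σ ↔ k = r ∨ k = s) :
    ∀ k : Fin m, k = r ∨ k = s →
      s(k.castSucc, (k + 1 + 1).castSucc) ∈ cycEdges σ ∧
      s((k + 1).castSucc, (k - 1).castSucc) ∈ cycEdges σ := by
  obtain ⟨h, hm⟩ : ∃ h : ℕ, m = 2 * h + 1 := by
    obtain ⟨l, hl⟩ := heven
    exact ⟨l - 1, by omega⟩
  have W := hC.wheelCycle hn hw
  have hrim : ∀ k : Fin m, k.castSucc = rim m (k : ℕ) := fun k => by rw [rim, residue_natCast]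
  have hrim1 : ∀ k : Fin m, (k + 1).castSucc = rim m ((k : ℕ) + 1) := fun k => by
    rw [rim, ← residue_add_one (by omega), residue_natCast]
  have hrim2 : ∀ k : Fin m, (k + 1 + 1).castSucc = rim m ((k : ℕ) + 2) := fun k => by
    rw [rim, show ((k : ℕ) : ℤ) + 2 = (k : ℕ) + 1 + 1 by ring, ← residue_add_one (by omega),
      ← residue_add_one (by omega), residue_natCast]
  have hrim3 : ∀ k : Fin m, (k - 1).castSucc = rim m ((k : ℕ) - 1) := fun k => by
    rw [rim, ← residue_sub_one (by omega), residue_natCast]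
  have hedge : ∀ i : ℤ, s(rim m i, rim m (i + 1)) ∈ cycEdges σ →
      residue m i = r ∨ residue m i = s := fun i hi => by
    rw [← hbd, residue_add_one (by omega)]
    exact hi
  have hedge' : ∀ k : Fin m, k = r ∨ k = s →
      s(rim m (k : ℕ), rim m ((k : ℕ) + 1)) ∈ cycEdges σ := fun k hk => by
    rw [← hrim, ← hrim1]; exact (hbd k).2 hk
  have main : ∀ k l : Fin m, (k = r ∧ l = s ∨ k = s ∧ l = r) →
      s(k.castSucc, (k + 1 + 1).castSucc) ∈ cycEdges σ ∧
      s((k + 1).castSucc, (k - 1).castSucc) ∈ cycEdges σ := by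
    intro k l hkl
    have hne : k ≠ l := by rintro rfl; rcases hkl with ⟨h1, h2⟩ | ⟨h1, h2⟩ <;> simp_all
    have hkl' : (k : ℕ) ≠ l := fun e => hne (Fin.ext e)
    -- the window starts at the representative of `l` just below `k`
    obtain ⟨l', hl1, hl2, hl3⟩ : ∃ l' : ℤ, l' < (k : ℕ) ∧ ((k : ℕ) : ℤ) < l' + m ∧
        residue m l' = l := by
      have := k.isLt
      have := l.isLt
      rcases lt_or_gt_of_ne hkl' with h1 | h1
      · refine ⟨(l : ℕ) - m, by omega, by omega, ?_⟩
        rw [← residue_natCast l, residue_eq_iff, residue_natCast]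
        exact ⟨-1, by ring⟩
      · exact ⟨(l : ℕ), by omega, by omega, residue_natCast l⟩
    have hl4 : rim m l' = l.castSucc := by rw [rim, hl3]
    have B : WheelCycle.TwoBoundary (m : ℤ) (fun a b => s(a, b) ∈ cycEdges σ) (rim m) l'
        (k : ℕ) :=
      { left := by
          rw [hl4, rim, ← residue_add_one (by omega), hl3]
          exact (hbd l).2 (by tauto)
        right := hedge' k (by tauto)
        lt := hl1
        lt_add := hl2
        eq := fun i h1 h2 h3 => by
          have h4 : residue m i = residue m (k : ℕ) ∨ residue m i = residue m l' := by
            rw [residue_natCast, hl3]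
            rcases hedge i h3 with e | e <;> rcases hkl with ⟨e1, e2⟩ | ⟨e1, e2⟩ <;>
              simp [e, e1, e2]
          rcases h4 with e | e
          · exact W.rim_inj (congrArg Fin.castSucc e) (by omega) (by omega)
          · have := W.rim_inj (congrArg Fin.castSucc e) (by omega) (by omega)
            omega }
    rw [hrim2, hrim3, hrim1, hrim]
    exact W.adj_of_twoBoundary (h := h) (by omega) (by omega) B
  rintro k (rfl | rfl)
  · exact main _ s (Or.inl ⟨rfl, rfl⟩)
  · exact main _ r (Or.inr ⟨rfl, rfl⟩)

end
end

section
/- Let P be a set of n points in regular wheel configuration in the plane, where n ≥ 10 is even. Then any family of pairwise edge-disjoint 1-plane Hamiltonian cycles on P has cardinality at most ⌊(n−1)/3⌋. -/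
open Finset

noncomputable section

theorem inv_apply_apply {α : Type*} (σ : Equiv.Perm α) (z : α) : σ⁻¹ (σ z) = z :=
  σ.symm_apply_apply z

theorem apply_inv_apply {α : Type*} (σ : Equiv.Perm α) (z : α) : σ (σ⁻¹ z) = z :=
  σ.apply_symm_apply z

theorem EdgesCross.symm {n : ℕ} {v : Fin n → Pt} {e f : Sym2 (Fin n)}
    (h : EdgesCross v e f) : EdgesCross v f e :=
  ⟨fun a hf he => h.1 a he hf, by rw [Set.inter_comm]; exact h.2⟩

theorem mem_cycEdges_inv {n : ℕ} {σ : Equiv.Perm (Fin n)} {e : Sym2 (Fin n)} :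
    e ∈ cycEdges σ⁻¹ ↔ e ∈ cycEdges σ := by
  constructor
  · rintro ⟨i, rfl⟩
    exact ⟨σ⁻¹ i, by rw [apply_inv_apply, Sym2.eq_swap]⟩
  · rintro ⟨i, rfl⟩
    exact ⟨σ i, by rw [inv_apply_apply, Sym2.eq_swap]⟩

theorem cycEdges_inv {n : ℕ} (σ : Equiv.Perm (Fin n)) : cycEdges σ⁻¹ = cycEdges σ :=
  Set.ext fun _ => mem_cycEdges_inv

/-- The combinatorial data of a 1-plane Hamiltonian cycle on a wheel whose rim is indexed
`m`-periodically by the integers. -/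
structure IsWheelCycle {n : ℕ} (m : ℤ) (v : Fin n → Pt) (σ : Equiv.Perm (Fin n))
    (u : ℤ → Fin n) (x : Fin n) : Prop where
  nine_le : 9 ≤ m
  periodic : ∀ i, u (i + m) = u i
  inj : ∀ i j, i < j → j < i + m → u i ≠ u j
  ne_center : ∀ i, u i ≠ x
  cover : ∀ a z, z = x ∨ ∃ i, a ≤ i ∧ i < a + m ∧ z = u i
  exits : ∀ T : Set (Fin n), T.Nonempty → Tᶜ.Nonempty → ∃ z ∈ T, σ z ∉ T
  cross_chord : ∀ a b c d, a < c → c < b → b < d → d < a + m →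
    EdgesCross v s(u a, u b) s(u c, u d)
  cross_spoke : ∀ a b c, a < c → c < b → 2 * (b - a) < m →
    EdgesCross v s(u a, u b) s(x, u c)
  onePlane : OnePlane v (cycEdges σ)

/-- The rim vertices with index in `[p, q]`. -/
def rimArc {n : ℕ} (u : ℤ → Fin n) (p q : ℤ) : Set (Fin n) :=
  {z | ∃ i, p ≤ i ∧ i ≤ q ∧ z = u i}

namespace IsWheelCycle

variable {n : ℕ} {m : ℤ} {v : Fin n → Pt} {σ : Equiv.Perm (Fin n)} {u : ℤ → Fin n} {x : Fin n}

theorem enters (h : IsWheelCycle m v σ u x) (T : Set (Fin n)) (hT : T.Nonempty)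
    (hTc : Tᶜ.Nonempty) : ∃ z ∈ T, σ⁻¹ z ∉ T := by
  obtain ⟨z, hz, hz'⟩ := h.exits Tᶜ hTc (by rwa [compl_compl])
  exact ⟨σ z, not_not.1 hz', by rwa [inv_apply_apply]⟩

theorem reverse (h : IsWheelCycle m v σ u x) : IsWheelCycle m v σ⁻¹ u x :=
  { h with
    exits := h.enters
    onePlane := by rw [cycEdges_inv]; exact h.onePlane }

theorem reflect (h : IsWheelCycle m v σ u x) : IsWheelCycle m v σ (fun i => u (-i)) x where
  nine_le := h.nine_le
  periodic i := by
    have := h.periodic (-(i + m))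
    rw [show -(i + m) + m = -i by ring] at this
    exact this.symm
  inj i j h1 h2 := (h.inj (-j) (-i) (by lia) (by lia)).symm
  ne_center i := h.ne_center _
  cover a z := by
    rcases h.cover (-a - m + 1) z with hz | ⟨i, h1, h2, h3⟩
    · exact Or.inl hz
    · exact Or.inr ⟨-i, by lia, by lia, by simpa using h3⟩
  exits := h.exits
  cross_chord a b c d h1 h2 h3 h4 := by
    have := h.cross_chord (-d) (-c) (-b) (-a) (by lia) (by lia) (by lia) (by lia)
    rw [Sym2.eq_swap (a := u (-a)), Sym2.eq_swap (a := u (-c))]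
    exact this.symm
  cross_spoke a b c h1 h2 h3 := by
    rw [Sym2.eq_swap (a := u (-a))]
    exact h.cross_spoke (-b) (-a) (-c) (by lia) (by lia) (by lia)
  onePlane := h.onePlane

theorem exists_notMem_pair (h : IsWheelCycle m v σ u x) (y z : Fin n) : ∃ w, w ≠ y ∧ w ≠ z := by
  by_contra! hc
  have hm := h.nine_le
  have h01 := h.inj 0 1 (by lia) (by lia)
  have h02 := h.inj 0 2 (by lia) (by lia)
  have h12 := h.inj 1 2 (by lia) (by lia)
  have h0 := hc (u 0)
  have h1 := hc (u 1)
  have h2 := hc (u 2)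
  grind

theorem apply_ne (h : IsWheelCycle m v σ u x) (z : Fin n) : σ z ≠ z := by
  intro hz
  obtain ⟨w, hw, -⟩ := h.exists_notMem_pair z z
  obtain ⟨y, rfl, hy'⟩ := h.exits {z} ⟨z, rfl⟩ ⟨w, hw⟩
  exact hy' hz

theorem apply_apply_ne (h : IsWheelCycle m v σ u x) (z : Fin n) : σ (σ z) ≠ z := by
  intro hz
  obtain ⟨w, hw, hw'⟩ := h.exists_notMem_pair z (σ z)
  obtain ⟨y, hy, hy'⟩ := h.exits {z, σ z} ⟨z, by simp⟩ ⟨w, by simp [hw, hw']⟩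
  simp only [Set.mem_insert_iff, Set.mem_singleton_iff] at hy hy'
  rcases hy with rfl | rfl <;> simp_all

theorem edge_injective (h : IsWheelCycle m v σ u x) :
    Function.Injective fun z => s(z, σ z) := by
  intro y z hyz
  rcases Sym2.eq_iff.1 hyz with ⟨h1, -⟩ | ⟨h1, h2⟩
  · exact h1
  · subst h1
    exact absurd h2 (h.apply_apply_ne z)

theorem eq_of_cross (h : IsWheelCycle m v σ u x) {e : Sym2 (Fin n)} (he : e ∈ cycEdges σ)
    {y z : Fin n} (hy : EdgesCross v e s(y, σ y)) (hz : EdgesCross v e s(z, σ z)) : y = z :=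
  h.edge_injective (h.onePlane e he ⟨⟨y, rfl⟩, hy⟩ ⟨⟨z, rfl⟩, hz⟩)

theorem eq_of_u_eq (h : IsWheelCycle m v σ u x) {i j : ℤ} (hij : u i = u j) (h1 : j < i + m)
    (h2 : i < j + m) : i = j := by
  rcases lt_trichotomy i j with hlt | heq | hgt
  · exact absurd hij (h.inj i j hlt h1)
  · exact heq
  · exact absurd hij.symm (h.inj j i hgt h2)

theorem rimArc_compl_nonempty (h : IsWheelCycle m v σ u x) (p q : ℤ) :
    (rimArc u p q)ᶜ.Nonempty :=
  ⟨x, fun ⟨i, _, _, hi⟩ => h.ne_center i hi.symm⟩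

/-- Every segment from inside a short arc to outside of it crosses the chord of that arc. -/
theorem cross_of_notMem_rimArc (h : IsWheelCycle m v σ u x) {a b c : ℤ} (hac : a < c) (hcb : c < b)
    (hs : 2 * (b - a) < m) {y : Fin n} (hy : y ∉ rimArc u a b) :
    EdgesCross v s(u a, u b) s(u c, y) := by
  rcases h.cover a y with rfl | ⟨i, h1, h2, rfl⟩
  · rw [Sym2.eq_swap (a := u c)]
    exact h.cross_spoke a b c hac hcb hs
  · have : b < i := by
      by_contra hb
      exact hy ⟨i, h1, by lia, rfl⟩
    exact h.cross_chord a b c i hac hcb this h2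

theorem not_exit_and_enter (h : IsWheelCycle m v σ u x) {a b i j : ℤ} (hs : 2 * (b - a) < m)
    (hab : σ (u a) = u b) (hai : a < i) (hib : i < b) (haj : a < j) (hjb : j < b)
    (hi : σ (u i) ∉ rimArc u a b) (hj : σ⁻¹ (u j) ∉ rimArc u a b) : False := by
  have he : s(u a, u b) ∈ cycEdges σ := ⟨u a, by rw [hab]⟩
  have h1 := h.cross_of_notMem_rimArc hai hib hs hi
  have h2 := h.cross_of_notMem_rimArc haj hjb hs hj
  have h3 := h.eq_of_cross he (z := σ⁻¹ (u j)) h1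
    (by rw [apply_inv_apply, Sym2.eq_swap (a := σ⁻¹ (u j))]; exact h2)
  exact hj (h3 ▸ ⟨i, hai.le, hib.le, rfl⟩)

/-- In an arc `[p, q]` of this kind the cycle enters only at `q` and leaves only at `p`. -/
def IsPocket (σ : Equiv.Perm (Fin n)) (u : ℤ → Fin n) (p q : ℤ) : Prop :=
  (∀ i, p ≤ i → i ≤ q → i ≠ p → σ (u i) ∈ rimArc u p q) ∧
  ∀ i, p ≤ i → i ≤ q → i ≠ q → σ⁻¹ (u i) ∈ rimArc u p q

theorem isPocket_left (h : IsWheelCycle m v σ u x) {a b : ℤ} (hL : 2 ≤ b - a)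
    (hs : 2 * (b - a) < m) (hab : σ (u a) = u b) (hb : σ (u b) ∉ rimArc u a b)
    (ha : σ⁻¹ (u a) ∈ rimArc u a b) : IsPocket σ u a (b - 1) := by
  have he : s(u a, u b) ∈ cycEdges σ := ⟨u a, by rw [hab]⟩
  have hab' : σ⁻¹ (u b) = u a := by rw [← hab, inv_apply_apply]
  obtain ⟨_, ⟨c, hc1, hc2, rfl⟩, hc⟩ := h.enters (rimArc u a b) ⟨u a, a, le_rfl, by lia, rfl⟩
    (h.rimArc_compl_nonempty a b)
  have hca : a < c := lt_of_le_of_ne hc1 (by rintro rfl; exact hc ha)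
  have hcb : c < b := lt_of_le_of_ne hc2 (by
    rintro rfl
    exact hc (by rw [hab']; exact ⟨a, le_rfl, by lia, rfl⟩))
  have hout : ∀ i, a ≤ i → i ≤ b - 1 → i ≠ a → σ (u i) ∈ rimArc u a (b - 1) := by
    intro i h1 h2 h3
    by_contra hn
    have hmem : σ (u i) ∈ rimArc u a b := by
      by_contra hn'
      exact h.not_exit_and_enter hs hab (by lia) (by lia) hca hcb hn' hc
    obtain ⟨j, hj1, hj2, hj⟩ := hmem
    rcases eq_or_ne j b with rfl | hjb
    · have := h.eq_of_u_eq (σ.injective (hj.trans hab.symm)) (by lia) (by lia)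
      lia
    · exact hn ⟨j, hj1, by lia, hj⟩
  have hin : ∀ i, a ≤ i → i ≤ b - 1 → i ≠ c → σ⁻¹ (u i) ∈ rimArc u a (b - 1) := by
    intro i h1 h2 h3
    by_contra hn
    have hmem : σ⁻¹ (u i) ∈ rimArc u a b := by
      by_contra hn'
      rcases eq_or_ne i a with rfl | hia
      · exact hn' ha
      have e1 := h.cross_of_notMem_rimArc (c := i) (by lia) (by lia) hs hn'
      have e2 := h.cross_of_notMem_rimArc hca hcb hs hc
      have := h.reverse.eq_of_cross (mem_cycEdges_inv.2 he) e1 e2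
      exact h3 (h.eq_of_u_eq this (by lia) (by lia))
    obtain ⟨j, hj1, hj2, hj⟩ := hmem
    rcases eq_or_ne j b with rfl | hjb
    · apply hb
      rw [← hj, apply_inv_apply]
      exact ⟨i, h1, by lia, rfl⟩
    · exact hn ⟨j, hj1, by lia, hj⟩
  have hcq : c = b - 1 := by
    by_contra hne
    obtain ⟨_, ⟨i, hi1, hi2, rfl⟩, hi⟩ := h.exits (rimArc u (c + 1) (b - 1))
      ⟨u (c + 1), c + 1, le_rfl, by lia, rfl⟩ (h.rimArc_compl_nonempty _ _)
    obtain ⟨j, hj1, hj2, hj⟩ := hout i (by lia) hi2 (by lia)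
    have hjc : j < c := by
      rcases lt_trichotomy j c with h1 | rfl | h1
      · exact h1
      · exact absurd ⟨i, by lia, by lia, by rw [← hj, inv_apply_apply]⟩ hc
      · exact absurd ⟨j, by lia, hj2, hj⟩ hi
    have hy : σ⁻¹ (u c) ∉ rimArc u j i := fun ⟨k, hk1, hk2, hk⟩ => hc ⟨k, by lia, by lia, hk⟩
    have e1 := h.cross_of_notMem_rimArc hjc (show c < i by lia) (by lia) hy
    have e2 := h.cross_of_notMem_rimArc hca hcb hs hc
    rw [Sym2.eq_swap (a := u j), ← hj] at e1
    rw [← hab] at e2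
    have hmem : s(u c, σ⁻¹ (u c)) ∈ cycEdges σ := mem_cycEdges_inv.1 ⟨_, rfl⟩
    have := h.eq_of_u_eq (h.eq_of_cross hmem e1.symm e2.symm) (by lia) (by lia)
    lia
  exact ⟨hout, hcq ▸ hin⟩

theorem mem_rimArc_reflect {p q : ℤ} {z : Fin n} :
    z ∈ rimArc (fun i => u (-i)) (-q) (-p) ↔ z ∈ rimArc u p q := by
  constructor
  · rintro ⟨i, h1, h2, h3⟩
    exact ⟨-i, by lia, by lia, h3⟩
  · rintro ⟨i, h1, h2, h3⟩
    exact ⟨-i, by lia, by lia, by simpa using h3⟩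

theorem isPocket_of_reflect {p q : ℤ} (h : IsPocket σ⁻¹ (fun i => u (-i)) (-q) (-p)) :
    IsPocket σ u p q := by
  obtain ⟨h1, h2⟩ := h
  simp only [mem_rimArc_reflect, inv_inv] at h1 h2
  refine ⟨fun i hp hq hne => ?_, fun i hp hq hne => ?_⟩
  · simpa using h2 (-i) (by lia) (by lia) (by lia)
  · simpa using h1 (-i) (by lia) (by lia) (by lia)

/-- Removing a suitable endpoint of a short chord from the arc it cuts off leaves a pocket. -/
theorem isPocket_of_apply (h : IsWheelCycle m v σ u x) {a b : ℤ} (hL : 2 ≤ b - a)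
    (hs : 2 * (b - a) < m) (hab : σ (u a) = u b) :
    IsPocket σ u a (b - 1) ∨ IsPocket σ u (a + 1) b := by
  have hab' : σ⁻¹ (u b) = u a := by rw [← hab, inv_apply_apply]
  by_cases hb : σ (u b) ∈ rimArc u a b <;> by_cases ha : σ⁻¹ (u a) ∈ rimArc u a b
  · exfalso
    have hne : (rimArc u a b).Nonempty := ⟨u a, a, le_rfl, by lia, rfl⟩
    obtain ⟨_, ⟨i, hi1, hi2, rfl⟩, hi⟩ := h.exits _ hne (h.rimArc_compl_nonempty a b)
    obtain ⟨_, ⟨j, hj1, hj2, rfl⟩, hj⟩ := h.enters _ hne (h.rimArc_compl_nonempty a b)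
    have : i ≠ b := by rintro rfl; exact hi hb
    have : j ≠ a := by rintro rfl; exact hj ha
    have : i ≠ a := by rintro rfl; exact hi ⟨b, by lia, le_rfl, hab⟩
    have : j ≠ b := by rintro rfl; exact hj ⟨a, le_rfl, by lia, hab'⟩
    exact h.not_exit_and_enter hs hab (by lia) (by lia) (by lia) (by lia) hi hj
  · right
    apply isPocket_of_reflect
    have := h.reverse.reflect.isPocket_left (a := -b) (b := -a) (by lia) (by lia)
      (by simpa using hab') (by rw [mem_rimArc_reflect]; simpa using ha)
      (by rw [mem_rimArc_reflect]; simpa using hb)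
    rwa [show -(a + 1) = -a - 1 by ring]
  · exact Or.inl (h.isPocket_left hL hs hab hb ha)
  · exfalso
    have hne : (rimArc u (a + 1) (b - 1)).Nonempty := ⟨u (a + 1), a + 1, le_rfl, by lia, rfl⟩
    obtain ⟨_, ⟨i, hi1, hi2, rfl⟩, hi⟩ := h.exits _ hne (h.rimArc_compl_nonempty _ _)
    obtain ⟨_, ⟨j, hj1, hj2, rfl⟩, hj⟩ := h.enters _ hne (h.rimArc_compl_nonempty _ _)
    refine h.not_exit_and_enter (i := i) (j := j) hs hab (by lia) (by lia) (by lia) (by lia) ?_ ?_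
    · rintro ⟨k, hk1, hk2, hk⟩
      have : k ≠ a := by
        rintro rfl
        exact ha ⟨i, by lia, by lia, by rw [← hk, inv_apply_apply]⟩
      have : k ≠ b := by
        rintro rfl
        have := h.eq_of_u_eq (σ.injective (hk.trans hab.symm)) (by lia) (by lia)
        lia
      exact hi ⟨k, by lia, by lia, hk⟩
    · rintro ⟨k, hk1, hk2, hk⟩
      rw [Equiv.Perm.inv_eq_iff_eq] at hk
      have : k ≠ a := by
        rintro rfl
        have := h.eq_of_u_eq (hk.trans hab) (by lia) (by lia)
        lia
      have : k ≠ b := by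
        rintro rfl
        exact hb ⟨j, by lia, by lia, hk.symm⟩
      exact hj ⟨k, by lia, by lia, by rw [hk, inv_apply_apply]⟩

theorem exists_pocket (h : IsWheelCycle m v σ u x) {a b : ℤ} (hL : 2 ≤ b - a)
    (hs : 2 * (b - a) < m) (hab : s(u a, u b) ∈ cycEdges σ) :
    ∃ p q c d, (p = a ∧ q = b - 1 ∨ p = a + 1 ∧ q = b) ∧ (c = p ∨ c = q) ∧ (d = p ∨ d = q) ∧
      (∀ i, p ≤ i → i ≤ q → i ≠ c → σ (u i) ∈ rimArc u p q) ∧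
      ∀ i, p ≤ i → i ≤ q → i ≠ d → σ⁻¹ (u i) ∈ rimArc u p q := by
  obtain ⟨z, hz⟩ := hab
  rcases Sym2.eq_iff.1 hz with ⟨rfl, h2⟩ | ⟨h1, rfl⟩
  · rcases h.isPocket_of_apply hL hs h2.symm with hp | hp
    · exact ⟨a, b - 1, a, b - 1, by simp, by simp, by simp, hp.1, hp.2⟩
    · exact ⟨a + 1, b, a + 1, b, by simp, by simp, by simp, hp.1, hp.2⟩
  · have h2 : σ⁻¹ (u a) = u b := by rw [h1, inv_apply_apply]
    rcases h.reverse.isPocket_of_apply hL hs h2 with hp | hp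
    · exact ⟨a, b - 1, b - 1, a, by simp, by simp, by simp, by simpa using hp.2, hp.1⟩
    · exact ⟨a + 1, b, b, a + 1, by simp, by simp, by simp, by simpa using hp.2, hp.1⟩

end IsWheelCycle

/-- At least two sides of the triangle on `u i, u (i + 1), u (i + 2)` belong to `E`. -/
def HasTwoSides {n : ℕ} (E : Set (Sym2 (Fin n))) (u : ℤ → Fin n) (i : ℤ) : Prop :=
  s(u i, u (i + 1)) ∈ E ∧ s(u (i + 1), u (i + 2)) ∈ E ∨
  s(u i, u (i + 1)) ∈ E ∧ s(u i, u (i + 2)) ∈ E ∨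
  s(u (i + 1), u (i + 2)) ∈ E ∧ s(u i, u (i + 2)) ∈ E

open Classical in
/-- The indices in `[a, b)` at which `E` contains a side of the rim polygon. -/
def sideSet {n : ℕ} (E : Set (Sym2 (Fin n))) (u : ℤ → Fin n) (a b : ℤ) : Finset ℤ :=
  {i ∈ Ico a b | s(u i, u (i + 1)) ∈ E}

open Classical in
/-- The indices in `[a, b)` of the triangles of consecutive rim vertices with two sides in `E`. -/
def triangleSet {n : ℕ} (E : Set (Sym2 (Fin n))) (u : ℤ → Fin n) (a b : ℤ) : Finset ℤ :=
  {i ∈ Ico a b | HasTwoSides E u i}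

/-- The number of polygon sides and triangles with two sides in `E` inside the arc `[a, b]`. -/
def arcWeight {n : ℕ} (E : Set (Sym2 (Fin n))) (u : ℤ → Fin n) (a b : ℤ) : ℕ :=
  #(sideSet E u a b) + #(triangleSet E u a (b - 1))

theorem card_le_card_filter_not_add_one (s : Finset ℤ) (P : ℤ → Prop) [DecidablePred P]
    (hP : ∀ i ∈ s, ∀ j ∈ s, P i → P j → i = j) : #s ≤ #{i ∈ s | ¬ P i} + 1 := by
  rw [← card_filter_add_card_filter_not (s := s) P, add_comm]
  gcongr
  exact card_le_one.2 fun i hi j hj =>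
    hP i (mem_filter.1 hi).1 j (mem_filter.1 hj).1 (mem_filter.1 hi).2 (mem_filter.1 hj).2

theorem arcWeight_mono {n : ℕ} {E : Set (Sym2 (Fin n))} {u : ℤ → Fin n} {a b p q : ℤ}
    (hp : a ≤ p) (hq : q ≤ b) : arcWeight E u p q ≤ arcWeight E u a b := by
  classical
  refine add_le_add (card_le_card ?_) (card_le_card ?_)
  · exact filter_subset_filter _ (Ico_subset_Ico hp hq)
  · exact filter_subset_filter _ (Ico_subset_Ico hp (by lia))

namespace IsWheelCycle

variable {n : ℕ} {m : ℤ} {v : Fin n → Pt} {σ : Equiv.Perm (Fin n)} {u : ℤ → Fin n} {x : Fin n}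

theorem hasTwoSides (h : IsWheelCycle m v σ u x) {i : ℤ} (hd : s(u i, u (i + 2)) ∈ cycEdges σ) :
    HasTwoSides (cycEdges σ) u i := by
  have hm := h.nine_le
  obtain ⟨p, q, c, -, hpq, hc, -, hout, -⟩ := h.exists_pocket (by lia) (by lia) hd
  have hq : q = p + 1 := by lia
  subst hq
  have hside : s(u p, u (p + 1)) ∈ cycEdges σ := by
    rcases hc with rfl | rfl
    · obtain ⟨j, hj1, hj2, hj⟩ := hout (c + 1) (by lia) (by lia) (by lia)
      have : j ≠ c + 1 := by rintro rfl; exact h.apply_ne _ hj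
      obtain rfl : j = c := by lia
      exact ⟨u (j + 1), by rw [hj, Sym2.eq_swap]⟩
    · obtain ⟨j, hj1, hj2, hj⟩ := hout p (by lia) (by lia) (by lia)
      have : j ≠ p := by rintro rfl; exact h.apply_ne _ hj
      obtain rfl : j = p + 1 := by lia
      exact ⟨u p, by rw [hj]⟩
  rcases hpq with ⟨rfl, -⟩ | ⟨rfl, -⟩
  · exact Or.inr (Or.inl ⟨hside, hd⟩)
  · rw [add_assoc, one_add_one_eq_two] at hside
    exact Or.inr (Or.inr ⟨hside, hd⟩)

theorem card_le_of_short (h : IsWheelCycle m v σ u x) {F A B : Finset ℤ}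
    (hF : Set.InjOn u F) (hshort : ∀ i ∈ F, (∃ k ∈ A, s(u i, σ (u i)) = s(u k, u (k + 1))) ∨
      ∃ k ∈ B, s(u i, σ (u i)) = s(u k, u (k + 2))) : #F ≤ #A + #B := by
  have hinj : Set.InjOn (fun i => s(u i, σ (u i))) F :=
    fun i hi j hj hij => hF hi hj (h.edge_injective hij)
  rw [← card_image_of_injOn hinj]
  calc #(F.image fun i => s(u i, σ (u i)))
      ≤ #(A.image (fun k => s(u k, u (k + 1))) ∪ B.image (fun k => s(u k, u (k + 2)))) := by
        refine card_le_card (image_subset_iff.2 fun i hi => ?_)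
        rcases hshort i hi with ⟨k, hk, he⟩ | ⟨k, hk, he⟩ <;> rw [mem_union, he]
        · exact Or.inl (mem_image_of_mem _ hk)
        · exact Or.inr (mem_image_of_mem _ hk)
    _ ≤ _ := (card_union_le _ _).trans (add_le_add card_image_le card_image_le)

theorem injOn_of_subset_Ico (h : IsWheelCycle m v σ u x) {F : Finset ℤ} {a : ℤ}
    (hF : F ⊆ Ico a (a + m)) : Set.InjOn u F := by
  intro i hi j hj hij
  have h1 := mem_Ico.1 (hF hi)
  have h2 := mem_Ico.1 (hF hj)
  exact h.eq_of_u_eq hij (by lia) (by lia)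

theorem card_le_arcWeight (h : IsWheelCycle m v σ u x) {p q : ℤ} (hpq : q < p + m) {F : Finset ℤ}
    (hF : F ⊆ Icc p q)
    (hshort : ∀ i ∈ F, ∃ j, p ≤ j ∧ j ≤ q ∧ σ (u i) = u j ∧ j - i ≤ 2 ∧ i - j ≤ 2) :
    #F ≤ arcWeight (cycEdges σ) u p q := by
  refine h.card_le_of_short (h.injOn_of_subset_Ico (a := p) fun i hi => ?_) fun i hi => ?_
  · have := mem_Icc.1 (hF hi)
    exact mem_Ico.2 ⟨by lia, by lia⟩
  obtain ⟨j, hj1, hj2, hj, hj3, hj4⟩ := hshort i hi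
  have hi' := mem_Icc.1 (hF hi)
  have hij : j ≠ i := by rintro rfl; exact h.apply_ne _ hj
  have he : s(u i, u j) ∈ cycEdges σ := ⟨u i, by rw [hj]⟩
  simp only [sideSet, triangleSet, mem_filter, mem_Ico, hj]
  obtain rfl | rfl | rfl | rfl : j = i + 1 ∨ i = j + 1 ∨ j = i + 2 ∨ i = j + 2 := by lia
  · exact Or.inl ⟨i, ⟨⟨by lia, by lia⟩, he⟩, rfl⟩
  · rw [Sym2.eq_swap] at he ⊢
    exact Or.inl ⟨j, ⟨⟨by lia, by lia⟩, he⟩, rfl⟩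
  · exact Or.inr ⟨i, ⟨⟨by lia, by lia⟩, h.hasTwoSides he⟩, rfl⟩
  · rw [Sym2.eq_swap] at he ⊢
    exact Or.inr ⟨j, ⟨⟨by lia, by lia⟩, h.hasTwoSides he⟩, rfl⟩

/-- A short chord of span at least three cuts off an arc of weight at least three. -/
theorem three_le_arcWeight (h : IsWheelCycle m v σ u x) {a b : ℤ} (hL : 3 ≤ b - a)
    (hs : 2 * (b - a) < m) (hab : s(u a, u b) ∈ cycEdges σ) :
    3 ≤ arcWeight (cycEdges σ) u a b := by
  classical
  induction hk : (b - a).toNat using Nat.strong_induction_on generalizing a b with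
  | _ k ih =>
  obtain ⟨p, q, c, d, hpq, hc, hd, hout, hin⟩ := h.exists_pocket (by lia) hs hab
  by_cases hlong : ∃ i j, p ≤ i ∧ j ≤ q ∧ 3 ≤ j - i ∧ s(u i, u j) ∈ cycEdges σ
  · obtain ⟨i, j, hi, hj, hij, he⟩ := hlong
    exact (ih (j - i).toNat (by lia) hij (by lia) he rfl).trans
      (arcWeight_mono (by lia) (by lia))
  push Not at hlong
  have hcard : #((Icc p q).erase c) ≤ arcWeight (cycEdges σ) u p q := by
    refine h.card_le_arcWeight (by lia) (erase_subset _ _) fun i hi => ?_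
    obtain ⟨hic, hi⟩ := mem_erase.1 hi
    obtain ⟨hi1, hi2⟩ := mem_Icc.1 hi
    obtain ⟨j, hj1, hj2, hj⟩ := hout i hi1 hi2 hic
    refine ⟨j, hj1, hj2, hj, ?_, ?_⟩
    · by_contra hn
      exact hlong i j hi1 hj2 (by lia) ⟨u i, by rw [hj]⟩
    · by_contra hn
      exact hlong j i hj1 hi2 (by lia) ⟨u i, by rw [hj, Sym2.eq_swap]⟩
  have hmono : arcWeight (cycEdges σ) u p q ≤ arcWeight (cycEdges σ) u a b :=
    arcWeight_mono (by lia) (by lia)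
  rw [card_erase_of_mem (mem_Icc.2 (by lia)), Int.card_Icc] at hcard
  rcases eq_or_lt_of_le hL with h3 | h3
  · obtain rfl : q = p + 2 := by lia
    obtain ⟨j, hj1, hj2, hj⟩ := hout (p + 1) (by lia) (by lia) (by lia)
    obtain ⟨k, hk1, hk2, hk⟩ := hin (p + 1) (by lia) (by lia) (by lia)
    have hj3 : j ≠ p + 1 := by rintro rfl; exact h.apply_ne _ hj
    have hk3 : k ≠ p + 1 := by rintro rfl; exact h.reverse.apply_ne _ hk
    have hjk : j ≠ k := by
      rintro rfl
      refine h.apply_apply_ne (u (p + 1)) ?_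
      rw [hj, ← hk, apply_inv_apply]
    have ej : s(u (p + 1), u j) ∈ cycEdges σ := ⟨_, by rw [hj]⟩
    have ek : s(u (p + 1), u k) ∈ cycEdges σ := mem_cycEdges_inv.1 ⟨_, by rw [hk]⟩
    have hsides : s(u p, u (p + 1)) ∈ cycEdges σ ∧ s(u (p + 1), u (p + 2)) ∈ cycEdges σ := by
      rw [Sym2.eq_swap (a := u p)]
      obtain ⟨rfl, rfl⟩ | ⟨rfl, rfl⟩ : j = p ∧ k = p + 2 ∨ k = p ∧ j = p + 2 := by lia
      · exact ⟨ej, ek⟩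
      · exact ⟨ek, ej⟩
    have h1 : ({p, p + 1} : Finset ℤ) ⊆ sideSet (cycEdges σ) u p (p + 2) := by
      intro i hi
      simp only [mem_insert, mem_singleton] at hi
      rw [sideSet, mem_filter, mem_Ico]
      rcases hi with rfl | rfl
      · exact ⟨by lia, hsides.1⟩
      · exact ⟨by lia, by rw [add_assoc, one_add_one_eq_two]; exact hsides.2⟩
    have h2 : ({p} : Finset ℤ) ⊆ triangleSet (cycEdges σ) u p (p + 2 - 1) := by
      rw [singleton_subset_iff, triangleSet, mem_filter, mem_Ico]
      exact ⟨by lia, Or.inl hsides⟩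
    have h1' := card_le_card h1
    have h2' := card_le_card h2
    rw [card_pair (by lia)] at h1'
    rw [card_singleton] at h2'
    unfold arcWeight at hmono ⊢
    lia
  · lia

theorem u_add_mul (h : IsWheelCycle m v σ u x) (i k : ℤ) : u (i + k * m) = u i := by
  induction k using Int.induction_on with
  | zero => simp
  | succ k ih => rw [← ih, ← h.periodic (i + k * m)]; ring_nf
  | pred k ih => rw [← ih, ← h.periodic (i + (-k - 1) * m)]; ring_nf

theorem u_emod (h : IsWheelCycle m v σ u x) (i : ℤ) : u (i % m) = u i := by
  have := h.u_add_mul (i % m) (i / m)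
  rw [mul_comm, Int.emod_add_mul_ediv] at this
  exact this.symm

theorem u_emod_add (h : IsWheelCycle m v σ u x) (i c : ℤ) : u (i % m + c) = u (i + c) := by
  rw [← h.u_emod (i % m + c), ← h.u_emod (i + c), Int.emod_add_emod]

theorem six_le_weight_of_arcs (h : IsWheelCycle m v σ u x) {a b : ℤ}
    (h1 : 3 ≤ arcWeight (cycEdges σ) u a b) (h2 : 3 ≤ arcWeight (cycEdges σ) u b (a + m))
    (ha : a ≤ b) (hb : b ≤ a + m) :
    6 ≤ #(sideSet (cycEdges σ) u 0 m) + #(triangleSet (cycEdges σ) u 0 m) := by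
  have hm := h.nine_le
  have key : ∀ (P : ℤ → Prop) [DecidablePred P], (∀ i, P i → P (i % m)) →
      ∀ c d, c ≤ b → d ≤ a + m →
      #{i ∈ Ico a c | P i} + #{i ∈ Ico b d | P i} ≤ #{i ∈ Ico 0 m | P i} := by
    intro P _ hP c d hc hd
    rw [← card_union_of_disjoint]
    · refine card_le_card_of_injOn (· % m) ?_ ?_
      · intro i hi
        have hi : P i := by
          rcases mem_union.1 (mem_coe.1 hi) with hi | hi <;> exact (mem_filter.1 hi).2
        exact mem_coe.2 (mem_filter.2 ⟨mem_Ico.2 ⟨Int.emod_nonneg _ (by lia),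
          Int.emod_lt_of_pos _ (by lia)⟩, hP i hi⟩)
      · intro i hi j hj hij
        simp only [coe_union, coe_filter, mem_Ico, Set.mem_union, Set.mem_ofPred_eq] at hi hj
        have : u i = u j := by rw [← h.u_emod i, ← h.u_emod j]; exact congrArg u hij
        exact h.eq_of_u_eq this (by lia) (by lia)
    · rw [disjoint_left]
      intro i hi hj
      have := mem_Ico.1 (mem_filter.1 hi).1
      have := mem_Ico.1 (mem_filter.1 hj).1
      lia
  classical
  have k1 := key (fun i => s(u i, u (i + 1)) ∈ cycEdges σ)
    (fun i hi => by rwa [h.u_emod, h.u_emod_add]) b (a + m) le_rfl le_rfl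
  have k2 := key (fun i => HasTwoSides (cycEdges σ) u i)
    (fun i hi => by unfold HasTwoSides; rwa [h.u_emod, h.u_emod_add, h.u_emod_add])
    (b - 1) (a + m - 1) (by lia) (by lia)
  unfold arcWeight sideSet triangleSet at *
  lia

theorem exists_rim_or_center (h : IsWheelCycle m v σ u x) (a i : ℤ) (hi : u i ≠ σ⁻¹ x) :
    ∃ j, a ≤ j ∧ j < a + m ∧ σ (u i) = u j := by
  rcases h.cover a (σ (u i)) with hx | hj
  · exact absurd (by rw [← hx, inv_apply_apply]) hi
  · exact hj

theorem six_le_weight_of_short (h : IsWheelCycle m v σ u x) (hodd : Odd m)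
    (hshort : ∀ a b, 3 ≤ b - a → 2 * (b - a) < m → s(u a, u b) ∉ cycEdges σ) :
    6 ≤ #(sideSet (cycEdges σ) u 0 m) + #(triangleSet (cycEdges σ) u 0 m) := by
  classical
  have hm := h.nine_le
  obtain ⟨r, hr⟩ := hodd
  have hinj : Set.InjOn u (Ico 0 m) := h.injOn_of_subset_Ico (a := 0) (by simp)
  have hcard := card_le_card_filter_not_add_one (Ico 0 m) (fun i => u i = σ⁻¹ x)
    fun i hi j hj h1 h2 => hinj hi hj (h1.trans h2.symm)
  rw [Int.card_Ico] at hcard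
  have hle : #{i ∈ Ico 0 m | ¬ u i = σ⁻¹ x} ≤
      #(sideSet (cycEdges σ) u 0 m) + #(triangleSet (cycEdges σ) u 0 m) := by
    refine h.card_le_of_short (hinj.mono (coe_subset.2 (filter_subset _ _))) fun i hi => ?_
    obtain ⟨-, hix⟩ := mem_filter.1 hi
    have hside : ∀ k, s(u i, σ (u i)) = s(u k, u (k + 1)) →
        ∃ k ∈ sideSet (cycEdges σ) u 0 m, s(u i, σ (u i)) = s(u k, u (k + 1)) := by
      intro k hk
      refine ⟨k % m, mem_filter.2 ⟨mem_Ico.2 ⟨Int.emod_nonneg _ (by lia),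
        Int.emod_lt_of_pos _ (by lia)⟩, ?_⟩, ?_⟩ <;> rw [h.u_emod, h.u_emod_add, ← hk]
      exact ⟨_, rfl⟩
    have htri : ∀ k, s(u i, σ (u i)) = s(u k, u (k + 2)) →
        ∃ k ∈ triangleSet (cycEdges σ) u 0 m, s(u i, σ (u i)) = s(u k, u (k + 2)) := by
      intro k hk
      refine ⟨k % m, mem_filter.2 ⟨mem_Ico.2 ⟨Int.emod_nonneg _ (by lia),
        Int.emod_lt_of_pos _ (by lia)⟩, h.hasTwoSides ?_⟩, ?_⟩ <;> rw [h.u_emod, h.u_emod_add, ← hk]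
      exact ⟨_, rfl⟩
    obtain ⟨j, hj1, hj2, hj⟩ := h.exists_rim_or_center (i - r) i hix
    have hij : j ≠ i := by rintro rfl; exact h.apply_ne _ hj
    have h1 : j - i ≤ 2 := by
      by_contra hn
      exact hshort i j (by lia) (by lia) ⟨u i, by rw [hj]⟩
    have h2 : i - j ≤ 2 := by
      by_contra hn
      exact hshort j i (by lia) (by lia) ⟨u i, by rw [hj, Sym2.eq_swap]⟩
    obtain rfl | rfl | rfl | rfl : j = i + 1 ∨ i = j + 1 ∨ j = i + 2 ∨ i = j + 2 := by lia
    · exact Or.inl (hside i (by rw [hj]))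
    · exact Or.inl (hside j (by rw [hj, Sym2.eq_swap]))
    · exact Or.inr (htri i (by rw [hj]))
    · exact Or.inr (htri j (by rw [hj, Sym2.eq_swap]))
  lia

theorem six_le_weight (h : IsWheelCycle m v σ u x) (hodd : Odd m) :
    6 ≤ #(sideSet (cycEdges σ) u 0 m) + #(triangleSet (cycEdges σ) u 0 m) := by
  have hm := h.nine_le
  by_cases hex : ∃ L, 3 ≤ L ∧ 2 * L < m ∧ ∃ a, s(u a, u (a + L)) ∈ cycEdges σ
  swap
  · push Not at hex
    refine h.six_le_weight_of_short hodd fun a b h1 h2 h3 => hex (b - a) h1 h2 a ?_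
    rwa [add_sub_cancel]
  obtain ⟨L, ⟨hL, hs, a, ha⟩, hmax⟩ := Int.exists_greatest_of_bdd
    (P := fun L => 3 ≤ L ∧ 2 * L < m ∧ ∃ a, s(u a, u (a + L)) ∈ cycEdges σ)
    ⟨m, fun z hz => by lia⟩ hex
  have hmax' : ∀ i j, L < j - i → 2 * (j - i) < m → s(u i, u j) ∉ cycEdges σ := by
    intro i j h1 h2 h3
    have := hmax (j - i) ⟨by lia, h2, i, by rwa [add_sub_cancel]⟩
    lia
  refine h.six_le_weight_of_arcs (h.three_le_arcWeight (by lia) (by lia) ha) ?_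
    (by lia) (by lia)
  obtain ⟨p, q, -, d, hpq, -, hd, -, hin⟩ := h.exists_pocket (by lia) (by lia) ha
  by_cases hlong : ∃ i j, q + 1 ≤ i ∧ j < p + m ∧ 3 ≤ j - i ∧ s(u i, u j) ∈ cycEdges σ
  · obtain ⟨i, j, hi, hj, hij, he⟩ := hlong
    have hs' : 2 * (j - i) < m := by
      by_contra hn
      obtain ⟨r, hr⟩ := hodd
      refine hmax' j (i + m) (by lia) (by lia) ?_
      rwa [h.periodic, Sym2.eq_swap]
    exact (h.three_le_arcWeight hij hs' he).trans (arcWeight_mono (by lia) (by lia))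
  push Not at hlong
  have hinj : Set.InjOn u (Icc (q + 1) (p + m - 1)) :=
    h.injOn_of_subset_Ico (a := p) fun i hi => by
      have := mem_Icc.1 hi
      exact mem_Ico.2 (by lia)
  have c1 := card_le_card_filter_not_add_one (Icc (q + 1) (p + m - 1)) (fun i => u i = σ⁻¹ x)
    fun i hi j hj h1 h2 => hinj hi hj (h1.trans h2.symm)
  have c2 := card_le_card_filter_not_add_one {i ∈ Icc (q + 1) (p + m - 1) | ¬ u i = σ⁻¹ x}
    (fun i => u i = σ⁻¹ (u d))
    fun i hi j hj h1 h2 => hinj (mem_filter.1 hi).1 (mem_filter.1 hj).1 (h1.trans h2.symm)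
  rw [Int.card_Icc] at c1
  refine le_trans ?_ ((h.card_le_arcWeight (p := q + 1) (q := p + m - 1)
    (F := {i ∈ {i ∈ Icc (q + 1) (p + m - 1) | ¬ u i = σ⁻¹ x} | ¬ u i = σ⁻¹ (u d)})
    (by lia) ((filter_subset _ _).trans (filter_subset _ _)) fun i hi => ?_).trans
    (arcWeight_mono (by lia) (by lia)))
  · lia
  · simp only [mem_filter, mem_Icc] at hi
    obtain ⟨⟨⟨hi1, hi2⟩, hix⟩, hid⟩ := hi
    obtain ⟨j, hj1, hj2, hj⟩ := h.exists_rim_or_center p i hix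
    have hjq : q + 1 ≤ j := by
      by_contra hn
      have hjd : j ≠ d := by
        rintro rfl
        exact hid (by rw [← hj, inv_apply_apply])
      obtain ⟨k, hk1, hk2, hk⟩ := hin j hj1 (by lia) hjd
      rw [← hj, inv_apply_apply] at hk
      have := h.eq_of_u_eq hk (by lia) (by lia)
      lia
    refine ⟨j, hjq, by lia, hj, ?_, ?_⟩
    · by_contra hn
      exact hlong i j hi1 hj2 (by lia) ⟨u i, by rw [hj]⟩
    · by_contra hn
      exact hlong j i hjq (by lia) (by lia) ⟨u i, by rw [hj, Sym2.eq_swap]⟩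

end IsWheelCycle

/-- Twice the signed area of the triangle `P Q R`. -/
def orient (P Q R : Pt) : ℝ := (Q 0 - P 0) * (R 1 - P 1) - (Q 1 - P 1) * (R 0 - P 0)

theorem openSegment_inter_nonempty_s13 {A B C D : Pt} (h1 : 0 < orient A C B) (h2 : 0 < orient A B D)
    (h3 : 0 < orient C B D) (h4 : 0 < orient A C D) :
    (openSegment ℝ A B ∩ openSegment ℝ C D).Nonempty := by
  have hs : orient A B D + orient A C B = orient C B D + orient A C D := by
    unfold orient; ring
  have hpos : 0 < orient C B D + orient A C D := by linarith
  refine ⟨(orient C B D / (orient C B D + orient A C D)) • A +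
    (orient A C D / (orient C B D + orient A C D)) • B,
    ⟨_, _, div_pos h3 hpos, div_pos h4 hpos, by field_simp, rfl⟩,
    ⟨orient A B D / (orient C B D + orient A C D), orient A C B / (orient C B D + orient A C D),
      div_pos h2 hpos, div_pos h1 hpos, by rw [← add_div, hs, div_self hpos.ne'], ?_⟩⟩
  ext i
  simp only [PiLp.add_apply, PiLp.smul_apply, smul_eq_mul]
  field_simp
  fin_cases i <;> simp [orient] <;> ring

theorem sin_two_mul_add_sin_two_mul_sub (p q : ℝ) :
    Real.sin (2 * p) + Real.sin (2 * q) - Real.sin (2 * p + 2 * q) =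
      4 * Real.sin p * Real.sin q * Real.sin (p + q) := by
  rw [Real.sin_add (2 * p), Real.sin_add p, Real.sin_two_mul, Real.sin_two_mul, Real.cos_two_mul',
    Real.cos_two_mul', Real.cos_sq', Real.cos_sq']
  ring

theorem orient_circle {P Q R x : Pt} {r α β γ : ℝ}
    (hP : P 0 = x 0 + r * Real.cos α ∧ P 1 = x 1 + r * Real.sin α)
    (hQ : Q 0 = x 0 + r * Real.cos β ∧ Q 1 = x 1 + r * Real.sin β)
    (hR : R 0 = x 0 + r * Real.cos γ ∧ R 1 = x 1 + r * Real.sin γ) :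
    orient P Q R = r ^ 2 * (4 * Real.sin ((β - α) / 2) * Real.sin ((γ - β) / 2) *
      Real.sin ((γ - α) / 2)) := by
  have h := sin_two_mul_add_sin_two_mul_sub ((β - α) / 2) ((γ - β) / 2)
  rw [show (β - α) / 2 + (γ - β) / 2 = (γ - α) / 2 by ring,
    show 2 * ((β - α) / 2) + 2 * ((γ - β) / 2) = γ - α by ring,
    show 2 * ((β - α) / 2) = β - α by ring, show 2 * ((γ - β) / 2) = γ - β by ring] at h
  rw [← h, orient, hP.1, hP.2, hQ.1, hQ.2, hR.1, hR.2, Real.sin_sub, Real.sin_sub, Real.sin_sub]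
  ring

theorem orient_center {P Q x : Pt} {r α β : ℝ}
    (hP : P 0 = x 0 + r * Real.cos α ∧ P 1 = x 1 + r * Real.sin α)
    (hQ : Q 0 = x 0 + r * Real.cos β ∧ Q 1 = x 1 + r * Real.sin β) :
    orient P Q x = r ^ 2 * Real.sin (β - α) := by
  rw [orient, hP.1, hP.2, hQ.1, hQ.2, Real.sin_sub]
  ring

/-- The rim index of a wheel with `m` rim vertices, extended periodically to the integers. -/
def rimIndex (m : ℕ) (hm : 0 < m) (i : ℤ) : Fin (m + 1) :=
  Fin.castSucc ⟨(i % m).toNat, by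
    have := Int.emod_lt_of_pos i (Int.natCast_pos.2 hm)
    have := Int.emod_nonneg i (Int.natCast_pos.2 hm).ne'
    lia⟩

theorem rimIndex_eq_iff {m : ℕ} (hm : 0 < m) {i j : ℤ} :
    rimIndex m hm i = rimIndex m hm j ↔ i % m = j % m := by
  have := Int.emod_nonneg i (Int.natCast_pos.2 hm).ne'
  have := Int.emod_nonneg j (Int.natCast_pos.2 hm).ne'
  simp only [rimIndex, Fin.castSucc_inj, Fin.mk.injEq]
  lia

theorem rimIndex_ne {m : ℕ} (hm : 0 < m) {i j : ℤ} (h1 : i < j) (h2 : j < i + m) :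
    rimIndex m hm i ≠ rimIndex m hm j := by
  rw [Ne, rimIndex_eq_iff, Int.emod_eq_emod_iff_emod_sub_eq_zero, ← neg_sub,
    ← Int.dvd_iff_emod_eq_zero, dvd_neg]
  intro h
  have := Int.le_of_dvd (by lia) h
  lia

/-- The polar angle of the rim vertex with integer index `i`. -/
def rimAngle (m : ℕ) (θ : ℝ) (i : ℤ) : ℝ := θ + 2 * Real.pi * i / m

theorem wheelPts_rimIndex {m : ℕ} (hm : 0 < m) {w : Fin m → Pt} {x : Pt} {r θ : ℝ}
    (hw : ∀ i : Fin m, w i 0 = x 0 + r * Real.cos (θ + 2 * Real.pi * (i : ℕ) / m) ∧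
      w i 1 = x 1 + r * Real.sin (θ + 2 * Real.pi * (i : ℕ) / m)) (i : ℤ) :
    wheelPts w x (rimIndex m hm i) 0 = x 0 + r * Real.cos (rimAngle m θ i) ∧
    wheelPts w x (rimIndex m hm i) 1 = x 1 + r * Real.sin (rimAngle m θ i) := by
  have hm' : (m : ℝ) ≠ 0 := by positivity
  have hi : ((i % m).toNat : ℤ) = i % m :=
    Int.toNat_of_nonneg (Int.emod_nonneg i (Int.natCast_pos.2 hm).ne')
  have hang : rimAngle m θ i =
      θ + 2 * Real.pi * ((i % m).toNat : ℕ) / m + (i / m : ℤ) * (2 * Real.pi) := by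
    have h : (i : ℝ) = ((i % m).toNat : ℕ) + m * (i / m : ℤ) := by
      exact_mod_cast (show i = ((i % m).toNat : ℤ) + m * (i / m) by
        rw [hi, Int.emod_add_mul_ediv])
    rw [rimAngle, h]
    field_simp
    ring
  rw [hang, Real.cos_add_int_mul_two_pi, Real.sin_add_int_mul_two_pi, rimIndex, wheelPts,
    Fin.snoc_castSucc]
  exact hw _

theorem orient_rim_pos {m : ℕ} (hm : 0 < m) {w : Fin m → Pt} {x : Pt} {r θ : ℝ} (hr : 0 < r)
    (hw : ∀ i : Fin m, w i 0 = x 0 + r * Real.cos (θ + 2 * Real.pi * (i : ℕ) / m) ∧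
      w i 1 = x 1 + r * Real.sin (θ + 2 * Real.pi * (i : ℕ) / m)) {i j k : ℤ}
    (hij : i < j) (hjk : j < k) (hki : k < i + m) :
    0 < orient (wheelPts w x (rimIndex m hm i)) (wheelPts w x (rimIndex m hm j))
      (wheelPts w x (rimIndex m hm k)) := by
  have hsin : ∀ a b : ℤ, a < b → b < a + m →
      0 < Real.sin ((rimAngle m θ b - rimAngle m θ a) / 2) := by
    intro a b h1 h2
    have hm' : (0 : ℝ) < m := by positivity
    have h1' : (a : ℝ) < b := by exact_mod_cast h1
    have h2' : (b : ℝ) < a + m := by exact_mod_cast h2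
    have he : (rimAngle m θ b - rimAngle m θ a) / 2 = Real.pi * ((b - a) / m) := by
      unfold rimAngle; field_simp; ring
    rw [he]
    refine Real.sin_pos_of_pos_of_lt_pi
      (mul_pos Real.pi_pos (div_pos (by linarith) hm')) ?_
    exact mul_lt_of_lt_one_right Real.pi_pos ((div_lt_one hm').2 (by linarith))
  rw [orient_circle (wheelPts_rimIndex hm hw i) (wheelPts_rimIndex hm hw j)
    (wheelPts_rimIndex hm hw k)]
  have := hsin i j hij (by lia)
  have := hsin j k hjk (by lia)
  have := hsin i k (by lia) hki
  positivity

theorem orient_rim_center_pos {m : ℕ} (hm : 0 < m) {w : Fin m → Pt} {x : Pt} {r θ : ℝ} (hr : 0 < r)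
    (hw : ∀ i : Fin m, w i 0 = x 0 + r * Real.cos (θ + 2 * Real.pi * (i : ℕ) / m) ∧
      w i 1 = x 1 + r * Real.sin (θ + 2 * Real.pi * (i : ℕ) / m)) {i j : ℤ}
    (hij : i < j) (hji : 2 * (j - i) < m) :
    0 < orient (wheelPts w x (rimIndex m hm i)) (wheelPts w x (rimIndex m hm j)) x := by
  have hm' : (0 : ℝ) < m := by positivity
  have h1' : (i : ℝ) < j := by exact_mod_cast hij
  have h2' : 2 * ((j : ℝ) - i) < m := by exact_mod_cast hji
  have he : rimAngle m θ j - rimAngle m θ i = Real.pi * (2 * (j - i) / m) := by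
    unfold rimAngle; field_simp; ring
  rw [orient_center (wheelPts_rimIndex hm hw i) (wheelPts_rimIndex hm hw j), he]
  refine mul_pos (by positivity) (Real.sin_pos_of_pos_of_lt_pi
    (mul_pos Real.pi_pos (div_pos (by linarith) hm')) ?_)
  exact mul_lt_of_lt_one_right Real.pi_pos ((div_lt_one hm').2 h2')

theorem IsHamCycle.exists_exit {n : ℕ} {σ : Equiv.Perm (Fin n)} (h : IsHamCycle σ)
    (T : Set (Fin n)) (hT : T.Nonempty) (hTc : Tᶜ.Nonempty) : ∃ z ∈ T, σ z ∉ T := by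
  by_contra! hc
  obtain ⟨y, hy⟩ := hT
  obtain ⟨z, hz⟩ := hTc
  have hmem : ∀ z, σ z ≠ z := fun z => Equiv.Perm.mem_support.1 (h.2 ▸ mem_univ z)
  obtain ⟨k, rfl⟩ := h.1.exists_pow_eq (hmem y) (hmem z)
  refine hz ?_
  clear hz
  induction k with
  | zero => exact hy
  | succ k ih => rw [pow_succ', Equiv.Perm.mul_apply]; exact hc _ ih

theorem IsOnePlaneHC.isWheelCycle {m : ℕ} (hm : 9 ≤ m) {w : Fin m → Pt} {x : Pt}
    (hw : IsRegularWheel w x) {σ : Equiv.Perm (Fin (m + 1))}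
    (hσ : IsOnePlaneHC (wheelPts w x) σ) :
    IsWheelCycle m (wheelPts w x) σ (rimIndex m (by lia)) (Fin.last m) := by
  obtain ⟨r, θ, hr, hw⟩ := hw
  have hm0 : 0 < m := by lia
  have hx : wheelPts w x (Fin.last m) = x := Fin.snoc_last ..
  have hne : ∀ i, rimIndex m hm0 i ≠ Fin.last m := fun i => Fin.castSucc_ne_last _
  exact {
    nine_le := by lia
    periodic := fun i => by rw [rimIndex_eq_iff, Int.add_emod_right]
    inj := fun i j => rimIndex_ne hm0
    ne_center := hne
    cover := by
      intro a z
      induction z using Fin.lastCases with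
      | last => exact Or.inl rfl
      | cast k =>
        have h1 := Int.emod_nonneg (k - a) (Int.natCast_pos.2 hm0).ne'
        have h2 := Int.emod_lt_of_pos (k - a) (Int.natCast_pos.2 hm0)
        refine Or.inr ⟨a + (k - a) % m, by lia, by lia, ?_⟩
        have h3 : (a + (k - a) % (m : ℤ)) % m = k := by
          rw [Int.add_emod_emod, add_sub_cancel]
          exact Int.emod_eq_of_lt (by lia) (by exact_mod_cast k.isLt)
        rw [rimIndex, Fin.castSucc_inj]
        ext
        simp only [h3, Int.toNat_natCast]
    exits := hσ.1.exists_exit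
    cross_chord := by
      intro a b c d hac hcb hbd hda
      have hI : ∀ i j : ℤ, i < j → j < i + m → rimIndex m hm0 i ≠ rimIndex m hm0 j :=
        fun i j => rimIndex_ne hm0
      refine ⟨?_, openSegment_inter_nonempty_s13
        (orient_rim_pos hm0 hr hw hac hcb (by lia)) (orient_rim_pos hm0 hr hw (by lia) hbd hda)
        (orient_rim_pos hm0 hr hw hcb hbd (by lia)) (orient_rim_pos hm0 hr hw hac (by lia) hda)⟩
      intro z hz hz'
      rcases Sym2.mem_iff.1 hz with rfl | rfl <;> rcases Sym2.mem_iff.1 hz' with h | h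
      · exact hI _ _ hac (by lia) h
      · exact hI _ _ (by lia) hda h
      · exact hI _ _ hcb (by lia) h.symm
      · exact hI _ _ hbd (by lia) h
    cross_spoke := by
      intro a b c hac hcb hab
      rw [Sym2.eq_swap (a := Fin.last m)]
      refine ⟨?_, openSegment_inter_nonempty_s13 (orient_rim_pos hm0 hr hw hac hcb (by lia))
        ?_ ?_ ?_⟩
      · intro z hz hz'
        rcases Sym2.mem_iff.1 hz with rfl | rfl <;> rcases Sym2.mem_iff.1 hz' with h | h
        · exact rimIndex_ne hm0 hac (by lia) h
        · exact hne _ h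
        · exact rimIndex_ne hm0 hcb (by lia) h.symm
        · exact hne _ h
      all_goals
        rw [hx]
        exact orient_rim_center_pos hm0 hr hw (by lia) (by lia)
    onePlane := hσ.2 }

theorem not_hasTwoSides_of_disjoint {n : ℕ} {E F : Set (Sym2 (Fin n))} (h : Disjoint E F)
    {u : ℤ → Fin n} {i : ℤ} (hE : HasTwoSides E u i) : ¬ HasTwoSides F u i := by
  have hd : ∀ e ∈ E, e ∉ F := fun e he => Set.disjoint_left.1 h he
  have h₁ := hd s(u i, u (i + 1))
  have h₂ := hd s(u (i + 1), u (i + 2))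
  have h₃ := hd s(u i, u (i + 2))
  unfold HasTwoSides at *
  tauto

theorem sum_card_le_of_pairwise {ι : Type*} (S : Finset ι) (f : ι → Finset ℤ) (m : ℕ)
    (hf : ∀ a ∈ S, f a ⊆ Ico 0 (m : ℤ))
    (hd : ∀ a ∈ S, ∀ b ∈ S, a ≠ b → Disjoint (f a) (f b)) : ∑ a ∈ S, #(f a) ≤ m := by
  rw [← card_biUnion hd]
  simpa using card_le_card (biUnion_subset.2 hf)

/-- any family of pairwise edge-disjoint 1-plane Hamiltonian
cycles on `n = m + 1 ≥ 10` points in regular wheel configuration (`n` even) has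
cardinality at most `⌊(n - 1) / 3⌋`. -/
theorem stmt13 {m : ℕ} (hn : 10 ≤ m + 1) (heven : Even (m + 1))
    (w : Fin m → Pt) (x : Pt) (hw : IsRegularWheel w x)
    (S : Finset (Equiv.Perm (Fin (m + 1))))
    (hS : ∀ σ ∈ S, IsOnePlaneHC (wheelPts w x) σ)
    (hdisj : ∀ σ ∈ S, ∀ τ ∈ S, σ ≠ τ → Disjoint (cycEdges σ) (cycEdges τ)) :
    S.card ≤ m / 3 := by
  classical
  have hm : 9 ≤ m := by lia
  have hodd : Odd (m : ℤ) := by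
    rw [Int.odd_coe_nat]
    exact Nat.not_even_iff_odd.1 (Nat.even_add_one.1 heven)
  have hsides := sum_card_le_of_pairwise S
    (fun σ => sideSet (cycEdges σ) (rimIndex m (by lia)) 0 m) m
    (fun σ _ => filter_subset _ _) fun σ hσ τ hτ hne => disjoint_left.2 fun i hi hi' =>
      Set.disjoint_left.1 (hdisj σ hσ τ hτ hne) (mem_filter.1 hi).2 (mem_filter.1 hi').2
  have htriangles := sum_card_le_of_pairwise S
    (fun σ => triangleSet (cycEdges σ) (rimIndex m (by lia)) 0 m) m
    (fun σ _ => filter_subset _ _) fun σ hσ τ hτ hne => disjoint_left.2 fun i hi hi' =>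
      not_hasTwoSides_of_disjoint (hdisj σ hσ τ hτ hne) (mem_filter.1 hi).2 (mem_filter.1 hi').2
  have hsum := S.card_nsmul_le_sum _ 6 fun σ hσ =>
    ((hS σ hσ).isWheelCycle hm hw).six_le_weight hodd
  rw [sum_add_distrib, smul_eq_mul] at hsum
  have h := hsum.trans (add_le_add hsides htriangles)
  lia

end
end

section
/- Let P be a set of n points in regular wheel configuration in the plane, where n ≥ 10 is even. Then there exists a family of ⌊(n−1)/3⌋ pairwise edge-disjoint 1-plane Hamiltonian cycles on P. -/
open Finset

noncomputable section

/-- Signed offsets from the apex of the vertices visited by a zigzag closed walk; position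
`m / 4 + 1` is reserved for the center. -/
def offset (m p : ℕ) : ℤ :=
  if p ≤ m / 4 then (if p % 2 = 0 then -(p : ℤ) else p)
  else if p ≤ m / 2 + 1 then (if p % 2 = 0 then (p : ℤ) - 1 else 1 - p)
  else (if p % 2 = 0 then (m : ℤ) + 1 - p else p - m - 1)

/-- The rim vertex with label `z` modulo `m`. -/
def rimLabel (m : ℕ) (z : ℤ) : Fin (m + 1) := Fin.ofNat (m + 1) (z % m).toNat

/-- The zigzag cycle with apex `A`, listed by position. -/
def zigzag (m : ℕ) (A : ℤ) (p : ℕ) : Fin (m + 1) :=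
  if p = m / 4 + 1 then Fin.last m else rimLabel m (A + offset m p)

/-- The strip, orthogonal to the axis of the zigzag, containing its `p`-th edge. -/
def strip (m p : ℕ) : ℕ :=
  if p ≤ m / 4 then p else if p ≤ m / 2 then p - 1 else if p = m / 2 + 1 then m / 2 else m - p

lemma rimLabel_val {m : ℕ} (hm : 0 < m) (z : ℤ) : ((rimLabel m z : ℕ) : ℤ) = z % m := by
  have h1 := Int.emod_nonneg z (b := (m : ℤ)) (by omega)
  have h2 := Int.emod_lt_of_pos z (b := (m : ℤ)) (by omega)
  simp only [rimLabel, Fin.val_ofNat]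
  rw [Nat.mod_eq_of_lt (by omega)]
  omega

lemma rimLabel_lt {m : ℕ} (hm : 0 < m) (z : ℤ) : (rimLabel m z : ℕ) < m := by
  have h1 := rimLabel_val hm z
  have h2 := Int.emod_lt_of_pos z (b := (m : ℤ)) (by omega)
  omega

lemma rimLabel_ne_last {m : ℕ} (hm : 0 < m) (z : ℤ) : rimLabel m z ≠ Fin.last m := by
  intro h
  have h1 := rimLabel_lt hm z
  rw [h] at h1
  simp at h1

lemma dvd_sub_of_rimLabel_eq {m : ℕ} (hm : 0 < m) {y z : ℤ} (h : rimLabel m y = rimLabel m z) :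
    (m : ℤ) ∣ y - z := by
  have h1 := rimLabel_val hm y
  rw [h, rimLabel_val hm z] at h1
  exact Int.ModEq.dvd h1

lemma eq_zero_of_dvd_of_lt {m : ℕ} {z : ℤ} (h : (m : ℤ) ∣ z) (h1 : z < m) (h2 : -(m : ℤ) < z) :
    z = 0 :=
  Int.eq_zero_of_abs_lt_dvd h (abs_lt.2 ⟨h2, h1⟩)

lemma zigzag_succ_last {m : ℕ} (hm : 9 ≤ m) (ho : m % 2 = 1) (A : ℤ) :
    zigzag m A (m + 1) = zigzag m A 0 := by
  have h : offset m (m + 1) = offset m 0 := by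
    unfold offset; split_ifs <;> omega
  rw [zigzag, zigzag, if_neg (by omega), if_neg (by omega), h]

lemma zigzag_eq_cases {m : ℕ} (hm : 0 < m) {A A' : ℤ} {p p' : ℕ}
    (h : zigzag m A p = zigzag m A' p') :
    (p = m / 4 + 1 ∧ p' = m / 4 + 1) ∨
      (p ≠ m / 4 + 1 ∧ p' ≠ m / 4 + 1 ∧ (m : ℤ) ∣ A + offset m p - (A' + offset m p')) := by
  unfold zigzag at h
  split_ifs at h with h1 h2 h2
  · exact Or.inl ⟨h1, h2⟩
  · exact absurd h.symm (rimLabel_ne_last hm _)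
  · exact absurd h (rimLabel_ne_last hm _)
  · exact Or.inr ⟨h1, h2, dvd_sub_of_rimLabel_eq hm h⟩

lemma zigzag_injOn {m : ℕ} (hm : 9 ≤ m) (ho : m % 2 = 1) (A : ℤ) {p p' : ℕ} (hp : p ≤ m)
    (hp' : p' ≤ m) (h : zigzag m A p = zigzag m A p') : p = p' := by
  rcases zigzag_eq_cases (by omega) h with ⟨h1, h2⟩ | ⟨h1, h2, h3⟩
  · omega
  · rw [add_sub_add_left_eq_sub] at h3
    have h4 : offset m p - offset m p' = 0 := by
      apply eq_zero_of_dvd_of_lt h3 <;> unfold offset <;> split_ifs <;> omega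
    unfold offset at h4
    split_ifs at h4 <;> omega

/-- The zigzag as a bijection from positions to vertices. -/
def zigzagEquiv {m : ℕ} (hm : 9 ≤ m) (ho : m % 2 = 1) (A : ℤ) : Equiv.Perm (Fin (m + 1)) :=
  Equiv.ofBijective (fun p => zigzag m A p) (Finite.injective_iff_bijective.1 fun p p' h =>
    Fin.ext (zigzag_injOn hm ho A (by omega) (by omega) h))

/-- The zigzag as a cyclic permutation of the vertices. -/
def zigzagCycle {m : ℕ} (hm : 9 ≤ m) (ho : m % 2 = 1) (A : ℤ) : Equiv.Perm (Fin (m + 1)) :=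
  zigzagEquiv hm ho A * finRotate (m + 1) * (zigzagEquiv hm ho A)⁻¹

lemma isHamCycle_zigzagCycle {m : ℕ} (hm : 9 ≤ m) (ho : m % 2 = 1) (A : ℤ) :
    IsHamCycle (zigzagCycle hm ho A) := by
  obtain ⟨l, rfl⟩ : ∃ l, m = l + 1 := ⟨m - 1, by omega⟩
  refine ⟨isCycle_finRotate.conj, ?_⟩
  rw [zigzagCycle, Equiv.Perm.support_conj, support_finRotate]
  simp

lemma mem_cycEdges_zigzagCycle {m : ℕ} (hm : 9 ≤ m) (ho : m % 2 = 1) (A : ℤ)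
    {e : Sym2 (Fin (m + 1))} (he : e ∈ cycEdges (zigzagCycle hm ho A)) :
    ∃ p ≤ m, e = s(zigzag m A p, zigzag m A (p + 1)) := by
  obtain ⟨i, rfl⟩ := he
  obtain ⟨p, rfl⟩ := (zigzagEquiv hm ho A).surjective i
  refine ⟨p, by omega, ?_⟩
  have h1 : zigzagCycle hm ho A (zigzagEquiv hm ho A p)
      = zigzagEquiv hm ho A (finRotate (m + 1) p) := by
    simp [zigzagCycle]
  rw [h1]
  change s(zigzag m A p, zigzag m A (finRotate (m + 1) p : Fin (m + 1))) = _
  by_cases hp : (p : ℕ) = m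
  · have : p = Fin.last m := Fin.ext hp
    subst this
    simp [zigzag_succ_last hm ho]
  · rw [coe_finRotate_of_ne_last (fun h => hp (by simp [h]))]

lemma offset_add_offset_succ {m : ℕ} (hm : 9 ≤ m) (ho : m % 2 = 1) {p : ℕ} (hp : p ≤ m)
    (h : p ≠ m / 4) (h' : p ≠ m / 4 + 1) :
    -1 ≤ offset m p + offset m (p + 1) ∧ offset m p + offset m (p + 1) ≤ 1 := by
  unfold offset
  split_ifs <;> omega

lemma eq_of_dvd_three_mul_sub_add {m : ℕ} {t t' d : ℤ} (h : (m : ℤ) ∣ 3 * t - 3 * t' + d)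
    (hd : -2 ≤ d) (hd' : d ≤ 2) (ht : 0 ≤ t) (htm : 3 * t + 3 ≤ m) (ht' : 0 ≤ t')
    (htm' : 3 * t' + 3 ≤ m) : t = t' := by
  have := eq_zero_of_dvd_of_lt h (by omega) (by omega)
  omega

/-- Spokes of zigzags with different apexes have different rim endpoints. -/
lemma eq_of_dvd_spoke {m : ℕ} (hm : 9 ≤ m) (ho : m % 2 = 1) {A A' t t' : ℤ}
    (hA : (m : ℤ) ∣ 2 * A - (3 * t + 1)) (hA' : (m : ℤ) ∣ 2 * A' - (3 * t' + 1))
    (ht : 0 ≤ t) (htm : 3 * t + 3 ≤ m) (ht' : 0 ≤ t') (htm' : 3 * t' + 3 ≤ m) {p p' : ℕ}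
    (hp : p = m / 4 ∨ p = m / 4 + 2) (hp' : p' = m / 4 ∨ p' = m / 4 + 2)
    (h : (m : ℤ) ∣ A + offset m p - (A' + offset m p')) : t = t' := by
  obtain ⟨s, d, hd, hd', hsd⟩ : ∃ s d : ℤ, -1 ≤ d ∧ d ≤ 1 ∧
      2 * (offset m p - offset m p') = m * s + d := by
    have : ∃ d : ℤ, -1 ≤ d ∧ d ≤ 1 ∧ (2 * (offset m p - offset m p') = d ∨
        2 * (offset m p - offset m p') = m + d ∨ 2 * (offset m p - offset m p') = -m + d) := by
      have h4 : m % 4 = 1 ∨ m % 4 = 3 := by omega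
      have : 2 * (offset m p - offset m p') = 0 ∨
          2 * (offset m p - offset m p') = 4 * (m / 4 : ℕ) + 2 ∨
          2 * (offset m p - offset m p') = -(4 * (m / 4 : ℕ) + 2) := by
        unfold offset
        split_ifs <;> omega
      rcases this with h | h | h
      · exact ⟨0, by omega, by omega, Or.inl h⟩
      · exact ⟨4 * (m / 4 : ℕ) + 2 - m, by omega, by omega, by omega⟩
      · exact ⟨m - (4 * (m / 4 : ℕ) + 2), by omega, by omega, by omega⟩
    obtain ⟨d, hd, hd', h | h | h⟩ := this
    · exact ⟨0, d, hd, hd', by linarith⟩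
    · exact ⟨1, d, hd, hd', by linarith⟩
    · exact ⟨-1, d, hd, hd', by linarith⟩
  refine eq_of_dvd_three_mul_sub_add (m := m) (d := d) ?_ (by omega) (by omega) ht htm ht' htm'
  obtain ⟨⟨a, ha⟩, ⟨a', ha'⟩, ⟨b, hb⟩⟩ := And.intro hA (And.intro hA' h)
  exact ⟨2 * b - a + a' - s, by linear_combination 2 * hb - ha + ha' - hsd⟩

lemma eq_of_dvd_chord {m : ℕ} (hm : 9 ≤ m) (ho : m % 2 = 1) {A A' t t' : ℤ}
    (hA : (m : ℤ) ∣ 2 * A - (3 * t + 1)) (hA' : (m : ℤ) ∣ 2 * A' - (3 * t' + 1))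
    (ht : 0 ≤ t) (htm : 3 * t + 3 ≤ m) (ht' : 0 ≤ t') (htm' : 3 * t' + 3 ≤ m) {p p' : ℕ}
    (hp : p ≤ m) (hp' : p' ≤ m) (h₁ : p ≠ m / 4) (h₂ : p ≠ m / 4 + 1) (h₁' : p' ≠ m / 4)
    (h₂' : p' ≠ m / 4 + 1)
    (h : (m : ℤ) ∣ (A + offset m p + (A + offset m (p + 1))) -
      (A' + offset m p' + (A' + offset m (p' + 1)))) : t = t' := by
  obtain ⟨b₁, b₂⟩ := offset_add_offset_succ hm ho hp h₁ h₂
  obtain ⟨b₁', b₂'⟩ := offset_add_offset_succ hm ho hp' h₁' h₂'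
  refine eq_of_dvd_three_mul_sub_add (m := m) (d := offset m p + offset m (p + 1) -
    (offset m p' + offset m (p' + 1))) ?_ (by omega) (by omega) ht htm ht' htm'
  obtain ⟨⟨a, ha⟩, ⟨a', ha'⟩, ⟨b, hb⟩⟩ := And.intro hA (And.intro hA' h)
  exact ⟨b - a + a', by linear_combination hb - ha + ha'⟩

lemma zigzag_apex_eq_of_edge_eq {m : ℕ} (hm : 9 ≤ m) (ho : m % 2 = 1) {A A' t t' : ℤ}
    (hA : (m : ℤ) ∣ 2 * A - (3 * t + 1)) (hA' : (m : ℤ) ∣ 2 * A' - (3 * t' + 1))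
    (ht : 0 ≤ t) (htm : 3 * t + 3 ≤ m) (ht' : 0 ≤ t') (htm' : 3 * t' + 3 ≤ m)
    {p p' : ℕ} (hp : p ≤ m) (hp' : p' ≤ m)
    (h : s(zigzag m A p, zigzag m A (p + 1)) = s(zigzag m A' p', zigzag m A' (p' + 1))) :
    t = t' := by
  have spoke {r r' : ℕ} := @eq_of_dvd_spoke m hm ho A A' t t' hA hA' ht htm ht' htm' r r'
  rcases Sym2.eq_iff.1 h with ⟨h1, h2⟩ | ⟨h1, h2⟩
  · rcases zigzag_eq_cases (by omega) h1 with ⟨c, c'⟩ | ⟨c, c', e⟩ <;>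
      rcases zigzag_eq_cases (by omega) h2 with ⟨d, d'⟩ | ⟨d, d', f⟩
    · omega
    · exact spoke (by omega) (by omega) f
    · exact spoke (by omega) (by omega) e
    · refine eq_of_dvd_chord hm ho hA hA' ht htm ht' htm' hp hp' (by omega) c (by omega) c' ?_
      obtain ⟨⟨a, ha⟩, ⟨b, hb⟩⟩ := And.intro e f
      exact ⟨a + b, by linear_combination ha + hb⟩
  · rcases zigzag_eq_cases (by omega) h1 with ⟨c, c'⟩ | ⟨c, c', e⟩ <;>
      rcases zigzag_eq_cases (by omega) h2 with ⟨d, d'⟩ | ⟨d, d', f⟩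
    · omega
    · exact spoke (by omega) (by omega) f
    · exact spoke (by omega) (by omega) e
    · refine eq_of_dvd_chord hm ho hA hA' ht htm ht' htm' hp hp' (by omega) c (by omega) d' ?_
      obtain ⟨⟨a, ha⟩, ⟨b, hb⟩⟩ := And.intro e f
      exact ⟨a + b, by linear_combination ha + hb⟩

lemma exists_coords_of_mem_openSegment {u v z : Pt} (h : z ∈ openSegment ℝ u v) :
    ∃ a b : ℝ, 0 < a ∧ 0 < b ∧ a + b = 1 ∧ ∀ i, z i = a * u i + b * v i := by
  obtain ⟨a, b, ha, hb, hab, rfl⟩ := h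
  exact ⟨a, b, ha, hb, hab, fun i => by simp⟩

lemma convex_comb_bounds {lo hi u v a b : ℝ} (ha : 0 < a) (hb : 0 < b) (hab : a + b = 1)
    (hu : lo ≤ u) (hu' : u ≤ hi) (hv : lo ≤ v) (hv' : v ≤ hi) (huv : u ≠ v) :
    lo < a * u + b * v ∧ a * u + b * v ≤ hi := by
  have hb' : b = 1 - a := by linarith
  subst hb'
  constructor
  · rcases lt_or_gt_of_ne huv with h | h <;> nlinarith
  · nlinarith

/-- Axial coordinate, in units of the radius, of the rim vertices at distance `j` from the apex. -/
def axial (m j : ℕ) : ℝ := Real.cos (2 * Real.pi * j / m)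

lemma axial_lt {m i j : ℕ} (hm : 0 < m) (hij : i < j) (hj : 2 * j ≤ m) :
    axial m j < axial m i := by
  have hm' : (0 : ℝ) < m := by exact_mod_cast hm
  have hij' : (i : ℝ) < j := by exact_mod_cast hij
  have hj' : 2 * (j : ℝ) ≤ m := by exact_mod_cast hj
  have hpi := Real.pi_pos
  apply Real.cos_lt_cos_of_nonneg_of_le_pi
  · positivity
  · rw [div_le_iff₀ hm']; nlinarith
  · gcongr

lemma axial_le {m i j : ℕ} (hm : 0 < m) (hij : i ≤ j) (hj : 2 * j ≤ m) :
    axial m j ≤ axial m i := by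
  rcases hij.eq_or_lt with rfl | h
  · rfl
  · exact (axial_lt hm h hj).le

lemma axial_pos {m j : ℕ} (hj : 4 * j < m) : 0 < axial m j := by
  have hm' : (0 : ℝ) < m := by exact_mod_cast (by omega : 0 < m)
  have hj' : 4 * (j : ℝ) < m := by exact_mod_cast hj
  have hpi := Real.pi_pos
  apply Real.cos_pos_of_mem_Ioo
  constructor
  · have : 0 ≤ 2 * Real.pi * j / m := by positivity
    linarith
  · rw [div_lt_iff₀ hm']; nlinarith

lemma axial_neg {m j : ℕ} (hj : m < 4 * j) (hj2 : 2 * j ≤ m) (hm : 0 < m) : axial m j < 0 := by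
  have hm' : (0 : ℝ) < m := by exact_mod_cast hm
  have hj' : (m : ℝ) < 4 * j := by exact_mod_cast hj
  have hj2' : 2 * (j : ℝ) ≤ m := by exact_mod_cast hj2
  have hpi := Real.pi_pos
  apply Real.cos_neg_of_pi_div_two_lt_of_lt
  · rw [lt_div_iff₀ hm']; nlinarith
  · have : 2 * Real.pi * j / m ≤ Real.pi := by rw [div_le_iff₀ hm']; nlinarith
    linarith

lemma sin_rim_pos {m j : ℕ} (hj : 0 < j) (hj2 : 2 * j < m) :
    0 < Real.sin (2 * Real.pi * j / m) := by
  have hm' : (0 : ℝ) < m := by exact_mod_cast (by omega : 0 < m)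
  have hj' : (0 : ℝ) < j := by exact_mod_cast hj
  have hj2' : 2 * (j : ℝ) < m := by exact_mod_cast hj2
  have hpi := Real.pi_pos
  apply Real.sin_pos_of_pos_of_lt_pi
  · positivity
  · rw [div_lt_iff₀ hm']; nlinarith

/-- The axial coordinate of the vertex at position `p` of the zigzag. -/
def zigX (m p : ℕ) : ℝ :=
  if p = m / 4 + 1 then 0 else axial m (offset m p).natAbs

/-- The transversal coordinate of the vertex at position `p` of the zigzag. -/
def zigY (m p : ℕ) : ℝ :=
  if p = m / 4 + 1 then 0 else Real.sin (2 * Real.pi * (offset m p : ℝ) / m)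

lemma cos_offset (m p : ℕ) :
    Real.cos (2 * Real.pi * (offset m p : ℝ) / m) = axial m (offset m p).natAbs := by
  unfold axial
  rcases Int.natAbs_eq (offset m p) with h | h
  · rw [show ((offset m p : ℤ) : ℝ) = (((offset m p).natAbs : ℤ) : ℝ) by rw [← h],
      Int.cast_natCast]
  · rw [show ((offset m p : ℤ) : ℝ) = ((-((offset m p).natAbs : ℤ) : ℤ) : ℝ) by rw [← h],
      ← Real.cos_neg, Int.cast_neg, Int.cast_natCast]
    congr 1; ring

lemma wheelPts_rimLabel {m : ℕ} (hm : 0 < m) {w : Fin m → Pt} {x : Pt} {r θ : ℝ}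
    (hw : ∀ i : Fin m, w i 0 = x 0 + r * Real.cos (θ + 2 * Real.pi * (i : ℕ) / m) ∧
      w i 1 = x 1 + r * Real.sin (θ + 2 * Real.pi * (i : ℕ) / m)) (z : ℤ) :
    wheelPts w x (rimLabel m z) 0 = x 0 + r * Real.cos (θ + 2 * Real.pi * z / m) ∧
      wheelPts w x (rimLabel m z) 1 = x 1 + r * Real.sin (θ + 2 * Real.pi * z / m) := by
  have hm' : (m : ℝ) ≠ 0 := by exact_mod_cast hm.ne'
  have h1 : rimLabel m z = Fin.castSucc ⟨rimLabel m z, rimLabel_lt hm z⟩ := rfl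
  have h2 : (z : ℝ) = ((rimLabel m z : ℕ) : ℝ) + (z / m : ℤ) * m := by
    have h3 := Int.emod_add_ediv_mul z m
    rw [← rimLabel_val hm z] at h3
    exact_mod_cast h3.symm
  have h4 : θ + 2 * Real.pi * z / m
      = θ + 2 * Real.pi * (rimLabel m z : ℕ) / m + (z / m : ℤ) * (2 * Real.pi) := by
    rw [h2]; field_simp; ring
  rw [h4, Real.cos_add_int_mul_two_pi, Real.sin_add_int_mul_two_pi, h1, wheelPts, Fin.snoc_castSucc]
  exact hw _

lemma exists_zigzag_coords {m : ℕ} (hm : 0 < m) {w : Fin m → Pt} {x : Pt}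
    (hw : IsRegularWheel w x) (A : ℤ) :
    ∃ X Y : Pt → ℝ,
      (∀ p, X (wheelPts w x (zigzag m A p)) = zigX m p) ∧
      (∀ p, Y (wheelPts w x (zigzag m A p)) = zigY m p) ∧
      ∀ u v, ∀ z ∈ openSegment ℝ u v, ∃ a b : ℝ, 0 < a ∧ 0 < b ∧ a + b = 1 ∧
        X z = a * X u + b * X v ∧ Y z = a * Y u + b * Y v := by
  obtain ⟨r, θ, hr, hw⟩ := hw
  obtain ⟨φ, hφ⟩ : ∃ φ, φ = θ + 2 * Real.pi * A / m := ⟨_, rfl⟩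
  have hang (p : ℕ) : θ + 2 * Real.pi * ((A + offset m p : ℤ) : ℝ) / m
      = φ + 2 * Real.pi * (offset m p : ℝ) / m := by
    rw [hφ]; push_cast; ring
  have hcs := Real.sin_sq_add_cos_sq φ
  refine ⟨fun v => ((v 0 - x 0) * Real.cos φ + (v 1 - x 1) * Real.sin φ) / r,
    fun v => ((v 1 - x 1) * Real.cos φ - (v 0 - x 0) * Real.sin φ) / r, ?_, ?_, ?_⟩
  · intro p
    unfold zigzag zigX
    split_ifs with h
    · simp [wheelPts]
    · obtain ⟨h0, h1⟩ := wheelPts_rimLabel hm hw (A + offset m p)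
      beta_reduce
      rw [h0, h1, hang, ← cos_offset, Real.cos_add φ, Real.sin_add φ, div_eq_iff hr.ne']
      linear_combination r * Real.cos (2 * Real.pi * (offset m p : ℝ) / m) * hcs
  · intro p
    unfold zigzag zigY
    split_ifs with h
    · simp [wheelPts]
    · obtain ⟨h0, h1⟩ := wheelPts_rimLabel hm hw (A + offset m p)
      beta_reduce
      rw [h0, h1, hang, Real.cos_add φ, Real.sin_add φ, div_eq_iff hr.ne']
      linear_combination r * Real.sin (2 * Real.pi * (offset m p : ℝ) / m) * hcs
  · intro u v z hz
    obtain ⟨a, b, ha, hb, hab, h⟩ := exists_coords_of_mem_openSegment hz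
    refine ⟨a, b, ha, hb, hab, ?_, ?_⟩ <;>
    · simp only [h]
      field_simp
      obtain rfl : b = 1 - a := by linarith
      ring

lemma zigX_center (m : ℕ) : zigX m (m / 4 + 1) = 0 := if_pos rfl

lemma zigX_eq_axial {m p j : ℕ} (h : p ≠ m / 4 + 1) (hj : (offset m p).natAbs = j) :
    zigX m p = axial m j := by
  rw [zigX, if_neg h, hj]

lemma natAbs_offset {m p : ℕ} (hm : 9 ≤ m) (hp : p ≤ m + 1) :
    (offset m p).natAbs =
      if p ≤ m / 4 then p else if p ≤ m / 2 + 1 then p - 1 else m + 1 - p := by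
  unfold offset
  split_ifs <;> omega

lemma zigX_strip {m p : ℕ} (hm : 9 ≤ m) (ho : m % 2 = 1) (hp : p ≤ m) {a b : ℝ}
    (ha : 0 < a) (hb : 0 < b) (hab : a + b = 1) :
    a * zigX m p + b * zigX m (p + 1) ≤ axial m (strip m p) ∧
      (strip m p < m / 2 →
        axial m (strip m p + 1) < a * zigX m p + b * zigX m (p + 1)) := by
  have hpos : 0 < axial m (m / 4) := axial_pos (by omega)
  have hneg : axial m (m / 4 + 1) < 0 := axial_neg (by omega) (by omega) (by omega)
  have hq : strip m p < m / 2 → axial m (strip m p + 1) < axial m (strip m p) := fun h =>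
    axial_lt (by omega) (by omega) (by omega)
  have key : (strip m p = m / 2 ∧ zigX m p = axial m (m / 2) ∧ zigX m (p + 1) = axial m (m / 2)) ∨
      (strip m p < m / 2 ∧
        ((zigX m p = axial m (strip m p) ∧ zigX m (p + 1) = axial m (strip m p + 1)) ∨
        (zigX m p = axial m (strip m p + 1) ∧ zigX m (p + 1) = axial m (strip m p)) ∨
        (strip m p = m / 4 ∧ zigX m p = axial m (m / 4) ∧ zigX m (p + 1) = 0) ∨
        (strip m p = m / 4 ∧ zigX m p = 0 ∧ zigX m (p + 1) = axial m (m / 4 + 1)))) := by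
    have hX {p j : ℕ} (hp : p ≤ m + 1) (h : p ≠ m / 4 + 1)
        (hj : (if p ≤ m / 4 then p else if p ≤ m / 2 + 1 then p - 1 else m + 1 - p) = j) :
        zigX m p = axial m j :=
      zigX_eq_axial h ((natAbs_offset hm hp).trans hj)
    have hs : strip m p = if p ≤ m / 4 then p else if p ≤ m / 2 then p - 1
      else if p = m / 2 + 1 then m / 2 else m - p := rfl
    rcases lt_trichotomy p (m / 4) with h | rfl | h
    · refine Or.inr ⟨by grind, Or.inl ⟨hX (by omega) (by omega) ?_, hX (by omega) (by omega) ?_⟩⟩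
        <;> grind
    · exact Or.inr ⟨by grind, Or.inr (Or.inr (Or.inl
        ⟨by grind, hX (by omega) (by omega) (by grind), zigX_center m⟩))⟩
    rcases (Nat.succ_le_of_lt h).eq_or_lt with rfl | h
    · exact Or.inr ⟨by grind, Or.inr (Or.inr (Or.inr
        ⟨by grind, zigX_center m, hX (by omega) (by omega) (by grind)⟩))⟩
    rcases lt_trichotomy p (m / 2 + 1) with h' | rfl | h'
    · refine Or.inr ⟨by grind, Or.inl ⟨hX (by omega) (by omega) ?_, hX (by omega) (by omega) ?_⟩⟩
        <;> grind
    · refine Or.inl ⟨by grind, hX (by omega) (by omega) ?_, hX (by omega) (by omega) ?_⟩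
        <;> grind
    · refine Or.inr ⟨by grind, Or.inr (Or.inl
        ⟨hX (by omega) (by omega) ?_, hX (by omega) (by omega) ?_⟩)⟩ <;> grind
  rcases key with ⟨h1, h2, h3⟩ | ⟨h1, h⟩
  · rw [h1, h2, h3, ← add_mul, hab]
    exact ⟨by simp, fun h => absurd h (by omega)⟩
  · have hq := hq h1
    have := @convex_comb_bounds (axial m (strip m p + 1)) (axial m (strip m p)) (zigX m p)
      (zigX m (p + 1)) a b ha hb hab
    rcases h with ⟨h2, h3⟩ | ⟨h2, h3⟩ | ⟨h4, h2, h3⟩ | ⟨h4, h2, h3⟩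
    · rw [h2, h3] at this ⊢
      obtain ⟨h5, h6⟩ := this hq.le le_rfl le_rfl hq.le hq.ne'
      exact ⟨h6, fun _ => h5⟩
    · rw [h2, h3] at this ⊢
      obtain ⟨h5, h6⟩ := this le_rfl hq.le hq.le le_rfl hq.ne
      exact ⟨h6, fun _ => h5⟩
    · rw [h2, h3, h4] at this ⊢
      obtain ⟨h5, h6⟩ := this (by linarith) le_rfl hneg.le hpos.le hpos.ne'
      exact ⟨h6, fun _ => h5⟩
    · rw [h2, h3, h4] at this ⊢
      obtain ⟨h5, h6⟩ := this hneg.le hpos.le le_rfl (by linarith) hneg.ne'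
      exact ⟨h6, fun _ => h5⟩

lemma strip_le (m p : ℕ) : strip m p ≤ m / 2 := by
  unfold strip; split_ifs <;> omega

lemma strip_eq_of_le {m p p' : ℕ} (hm : 9 ≤ m) (ho : m % 2 = 1) (hp : p ≤ m) (hp' : p' ≤ m)
    {a b a' b' : ℝ} (ha : 0 < a) (hb : 0 < b) (hab : a + b = 1)
    (ha' : 0 < a') (hb' : 0 < b') (hab' : a' + b' = 1)
    (h : a * zigX m p + b * zigX m (p + 1) = a' * zigX m p' + b' * zigX m (p' + 1)) :
    strip m p = strip m p' := by
  obtain ⟨h1, h2⟩ := zigX_strip hm ho hp ha hb hab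
  obtain ⟨h3, h4⟩ := zigX_strip hm ho hp' ha' hb' hab'
  have h5 := strip_le m p
  have h6 := strip_le m p'
  rcases lt_trichotomy (strip m p) (strip m p') with hlt | heq | hlt
  · have := axial_le (m := m) (by omega) (Nat.succ_le_of_lt hlt) (by omega)
    have := h2 (by omega)
    simp only [Nat.succ_eq_add_one] at *
    linarith
  · exact heq
  · have := axial_le (m := m) (by omega) (Nat.succ_le_of_lt hlt) (by omega)
    have := h4 (by omega)
    simp only [Nat.succ_eq_add_one] at *
    linarith

lemma exists_sign_zigY {m : ℕ} (hm : 9 ≤ m) (ho : m % 2 = 1) :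
    ∃ s S₁ S₂ : ℝ, s * s = 1 ∧ 0 < S₁ ∧ 0 < S₂ ∧
      zigY m (m / 4) = s * S₁ ∧ zigY m (m / 4 + 2) = -(s * S₂) ∧
      zigY m (m - m / 4) = s * S₂ ∧ zigY m (m - m / 4 + 1) = -(s * S₁) := by
  have pos {p j : ℕ} (h : p ≠ m / 4 + 1) (hj : offset m p = j) :
      zigY m p = Real.sin (2 * Real.pi * j / m) := by
    rw [zigY, if_neg h, hj, Int.cast_natCast]
  have neg {p j : ℕ} (h : p ≠ m / 4 + 1) (hj : offset m p = -j) :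
      zigY m p = -Real.sin (2 * Real.pi * j / m) := by
    rw [zigY, if_neg h, hj, Int.cast_neg, Int.cast_natCast, ← Real.sin_neg]
    congr 1; ring
  have h₁ := sin_rim_pos (m := m) (j := m / 4) (by omega) (by omega)
  have h₂ := sin_rim_pos (m := m) (j := m / 4 + 1) (by omega) (by omega)
  rcases Nat.mod_two_eq_zero_or_one (m / 4) with h | h
  · refine ⟨-1, _, _, by norm_num, h₁, h₂, ?_, ?_, ?_, ?_⟩
    · rw [neg (j := m / 4)]
      · ring
      · omega
      · unfold offset; split_ifs <;> omega
    · rw [pos (j := m / 4 + 1)]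
      · ring
      · omega
      · unfold offset; split_ifs <;> omega
    · rw [neg (j := m / 4 + 1)]
      · ring
      · omega
      · unfold offset; split_ifs <;> omega
    · rw [pos (j := m / 4)]
      · ring
      · omega
      · unfold offset; split_ifs <;> omega
  · refine ⟨1, _, _, by norm_num, h₁, h₂, ?_, ?_, ?_, ?_⟩
    · rw [pos (j := m / 4)]
      · ring
      · omega
      · unfold offset; split_ifs <;> omega
    · rw [neg (j := m / 4 + 1)]
      · ring
      · omega
      · unfold offset; split_ifs <;> omega
    · rw [pos (j := m / 4 + 1)]
      · ring
      · omega
      · unfold offset; split_ifs <;> omega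
    · rw [neg (j := m / 4)]
      · ring
      · omega
      · unfold offset; split_ifs <;> omega

lemma not_meet_both_center_edges {m : ℕ} (hm : 9 ≤ m) (ho : m % 2 = 1)
    {a b a' b' c d c' d' : ℝ} (ha : 0 < a) (hb : 0 < b')
    (hcd : c + d = 1) (hcd' : c' + d' = 1)
    (hX : a * zigX m (m / 4) + b * zigX m (m / 4 + 1)
      = c * zigX m (m - m / 4) + d * zigX m (m - m / 4 + 1))
    (hY : a * zigY m (m / 4) + b * zigY m (m / 4 + 1)
      = c * zigY m (m - m / 4) + d * zigY m (m - m / 4 + 1))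
    (hX' : a' * zigX m (m / 4 + 1) + b' * zigX m (m / 4 + 2)
      = c' * zigX m (m - m / 4) + d' * zigX m (m - m / 4 + 1))
    (hY' : a' * zigY m (m / 4 + 1) + b' * zigY m (m / 4 + 2)
      = c' * zigY m (m - m / 4) + d' * zigY m (m - m / 4 + 1)) : False := by
  obtain ⟨s, S₁, S₂, hs, hS₁, hS₂, h1, h2, h3, h4⟩ := exists_sign_zigY hm ho
  have hC : 0 < axial m (m / 4) := axial_pos (by omega)
  have hC' : axial m (m / 4 + 1) < 0 := axial_neg (by omega) (by omega) (by omega)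
  have hx0 : zigX m (m / 4 + 1) = 0 := by simp [zigX]
  have hy0 : zigY m (m / 4 + 1) = 0 := by simp [zigY]
  have hx1 : zigX m (m / 4) = axial m (m / 4) := by
    rw [zigX, if_neg (by omega)]; congr 1; unfold offset; split_ifs <;> omega
  have hx2 : zigX m (m / 4 + 2) = axial m (m / 4 + 1) := by
    rw [zigX, if_neg (by omega)]; congr 1; unfold offset; split_ifs <;> omega
  have hx3 : zigX m (m - m / 4) = axial m (m / 4 + 1) := by
    rw [zigX, if_neg (by omega)]; congr 1; unfold offset; split_ifs <;> omega
  have hx4 : zigX m (m - m / 4 + 1) = axial m (m / 4) := by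
    rw [zigX, if_neg (by omega)]; congr 1; unfold offset; split_ifs <;> omega
  rw [hx0, hx1, hx3, hx4] at hX
  rw [hx0, hx2, hx3, hx4] at hX'
  rw [hy0, h1, h3, h4] at hY
  rw [hy0, h2, h3, h4] at hY'
  obtain rfl : d = 1 - c := by linarith
  obtain rfl : d' = 1 - c' := by linarith
  have hd : 0 < (c' - c) * (axial m (m / 4) - axial m (m / 4 + 1)) := by
    nlinarith [mul_pos ha hC, mul_pos hb (neg_pos.2 hC')]
  have hc : 0 < c' - c := pos_of_mul_pos_left hd (by linarith)
  have e1 : a * S₁ + b' * S₂ = -((c' - c) * (S₁ + S₂)) := by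
    linear_combination s * hY - s * hY' - (a * S₁ + b' * S₂ + (c' - c) * (S₁ + S₂)) * hs
  have := mul_pos hc (add_pos hS₁ hS₂)
  nlinarith [mul_pos ha hS₁, mul_pos hb hS₂]

lemma onePlane_zigzagCycle {m : ℕ} (hm : 9 ≤ m) (ho : m % 2 = 1) (A : ℤ)
    {w : Fin m → Pt} {x : Pt} (hw : IsRegularWheel w x) :
    OnePlane (wheelPts w x) (cycEdges (zigzagCycle hm ho A)) := by
  obtain ⟨X, Y, hX, hY, hseg⟩ := exists_zigzag_coords (by omega) hw A
  have hmeet : ∀ {p p' : ℕ}, EdgesCross (wheelPts w x) s(zigzag m A p, zigzag m A (p + 1))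
      s(zigzag m A p', zigzag m A (p' + 1)) → ∃ a b a' b' : ℝ, 0 < a ∧ 0 < b ∧ a + b = 1 ∧
      0 < a' ∧ 0 < b' ∧ a' + b' = 1 ∧
      a * zigX m p + b * zigX m (p + 1) = a' * zigX m p' + b' * zigX m (p' + 1) ∧
      a * zigY m p + b * zigY m (p + 1) = a' * zigY m p' + b' * zigY m (p' + 1) := by
    rintro p p' ⟨-, z, hz, hz'⟩
    obtain ⟨a, b, ha, hb, hab, h1, h2⟩ := hseg _ _ z hz
    obtain ⟨a', b', ha', hb', hab', h1', h2'⟩ := hseg _ _ z hz'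
    rw [hX, hX] at h1 h1'
    rw [hY, hY] at h2 h2'
    exact ⟨a, b, a', b', ha, hb, hab, ha', hb', hab', h1.symm.trans h1', h2.symm.trans h2'⟩
  have hne : ∀ {p p' : ℕ}, EdgesCross (wheelPts w x) s(zigzag m A p, zigzag m A (p + 1))
      s(zigzag m A p', zigzag m A (p' + 1)) → p ≠ p' ∧ p + 1 ≠ p' ∧ p ≠ p' + 1 := by
    rintro p p' ⟨h, -⟩
    refine ⟨?_, ?_, ?_⟩ <;> rintro rfl
    · exact h (zigzag m A p) (by simp) (by simp)
    · exact h (zigzag m A (p + 1)) (by simp) (by simp)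
    · exact h (zigzag m A (p' + 1)) (by simp) (by simp)
  rintro e he f₁ ⟨hf₁, hc₁⟩ f₂ ⟨hf₂, hc₂⟩
  obtain ⟨p, hp, rfl⟩ := mem_cycEdges_zigzagCycle hm ho A he
  obtain ⟨p₁, hp₁, rfl⟩ := mem_cycEdges_zigzagCycle hm ho A hf₁
  obtain ⟨p₂, hp₂, rfl⟩ := mem_cycEdges_zigzagCycle hm ho A hf₂
  have n₁ := hne hc₁
  have n₂ := hne hc₂
  obtain ⟨a, b, a₁, b₁, ha, hb, hab, ha₁, hb₁, hab₁, hx₁, hy₁⟩ := hmeet hc₁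
  obtain ⟨c, d, a₂, b₂, hc, hd, hcd, ha₂, hb₂, hab₂, hx₂, hy₂⟩ := hmeet hc₂
  have s₁ := strip_eq_of_le hm ho hp hp₁ ha hb hab ha₁ hb₁ hab₁ hx₁
  have s₂ := strip_eq_of_le hm ho hp hp₂ hc hd hcd ha₂ hb₂ hab₂ hx₂
  by_contra hfne
  have n₃ : p₁ ≠ p₂ := by rintro rfl; exact hfne rfl
  have key : p = m - m / 4 ∧
      (p₁ = m / 4 ∧ p₂ = m / 4 + 1 ∨ p₁ = m / 4 + 1 ∧ p₂ = m / 4) := by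
    unfold strip at s₁ s₂
    split_ifs at s₁ s₂ <;> omega
  obtain ⟨rfl, ⟨rfl, rfl⟩ | ⟨rfl, rfl⟩⟩ := key
  · exact not_meet_both_center_edges hm ho ha₁ hb₂ hab hcd hx₁.symm hy₁.symm hx₂.symm hy₂.symm
  · exact not_meet_both_center_edges hm ho ha₂ hb₁ hcd hab hx₂.symm hy₂.symm hx₁.symm hy₁.symm

/-- on `n = m + 1 ≥ 10` points in regular wheel configuration
(`n` even) there is a family of `⌊(n - 1) / 3⌋` pairwise edge-disjoint 1-plane
Hamiltonian cycles. -/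
theorem stmt14 {m : ℕ} (hn : 10 ≤ m + 1) (heven : Even (m + 1))
    (w : Fin m → Pt) (x : Pt) (hw : IsRegularWheel w x) :
    ∃ S : Finset (Equiv.Perm (Fin (m + 1))), S.card = m / 3 ∧
      (∀ σ ∈ S, IsOnePlaneHC (wheelPts w x) σ) ∧
      (∀ σ ∈ S, ∀ τ ∈ S, σ ≠ τ → Disjoint (cycEdges σ) (cycEdges τ)) := by
  have hm : 9 ≤ m := by omega
  have ho : m % 2 = 1 := by
    obtain ⟨l, hl⟩ := heven
    omega
  let apex : ℕ → ℤ := fun t => (3 * t + 1) * (m / 2 + 1 : ℕ)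
  have hapex (t : ℕ) : (m : ℤ) ∣ 2 * apex t - (3 * t + 1) := by
    refine ⟨3 * t + 1, ?_⟩
    have : 2 * ((m / 2 + 1 : ℕ) : ℤ) = m + 1 := by omega
    linear_combination (3 * (t : ℤ) + 1) * this
  have hdisj : ∀ t < m / 3, ∀ t' < m / 3, t ≠ t' →
      Disjoint (cycEdges (zigzagCycle hm ho (apex t)))
        (cycEdges (zigzagCycle hm ho (apex t'))) := by
    intro t ht t' ht' hne
    rw [Set.disjoint_left]
    intro e he he'
    obtain ⟨p, hp, rfl⟩ := mem_cycEdges_zigzagCycle hm ho _ he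
    obtain ⟨p', hp', h⟩ := mem_cycEdges_zigzagCycle hm ho _ he'
    have := zigzag_apex_eq_of_edge_eq hm ho (hapex t) (hapex t') (by omega) (by omega)
      (by omega) (by omega) hp hp' h
    omega
  have hinj : Set.InjOn (fun t => zigzagCycle hm ho (apex t)) (Finset.range (m / 3)) := by
    intro t ht t' ht' h
    simp only [Finset.coe_range, Set.mem_Iio] at ht ht'
    by_contra hne
    have h1 := hdisj t ht t' ht' hne
    simp only at h
    rw [← h, disjoint_self] at h1
    exact Set.notMem_empty s(0, zigzagCycle hm ho (apex t) 0) (Set.bot_eq_empty ▸ h1.subset ⟨0, rfl⟩)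
  refine ⟨(Finset.range (m / 3)).image fun t => zigzagCycle hm ho (apex t), ?_, ?_, ?_⟩
  · rw [Finset.card_image_of_injOn hinj, Finset.card_range]
  · simp only [Finset.mem_image, Finset.mem_range]
    rintro _ ⟨t, ht, rfl⟩
    exact ⟨isHamCycle_zigzagCycle hm ho _, onePlane_zigzagCycle hm ho _ hw⟩
  · simp only [Finset.mem_image, Finset.mem_range]
    rintro _ ⟨t, ht, rfl⟩ _ ⟨t', ht', rfl⟩ hne
    exact hdisj t ht t' ht' fun h => hne (by rw [h])

end
end
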